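/- (Finiteness of the initial time blow-up away from the support of the initial measure.) Let T > 0 and let u : ℂ × (0,T) → (0,∞) be a smooth positive solution of the logarithmic fast diffusion equation ∂u/∂t = Δ log u such that for every t ∈ (0,T) the conformal metric u(·,t)|dz|² is complete on ℂ, and such that u starts weakly from a non-zero Radon measure μ on ℂ with no atoms. Then for every z ∈ ℂ \ supp(μ), the limit û(z) := lim_{t ↘ 0} u(z,t)/(2t) exists and is finite. -/

import Mathlib

open Set MeasureTheory Filter Metric

/-- The Euclidean Laplacian of `f : ℂ → ℝ` at `z`, i.e. `∂²f/∂x² + ∂²f/∂y²`. -/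
noncomputable def lap (f : ℂ → ℝ) (z : ℂ) : ℝ :=
  iteratedFDeriv ℝ 2 f z ![1, 1] + iteratedFDeriv ℝ 2 f z ![Complex.I, Complex.I]

/-- The time-timeSlice of a spacetime `M ⊆ ℂ × ℝ` at time `t`. -/
def timeSlice (M : Set (ℂ × ℝ)) (t : ℝ) : Set ℂ := {z | (z, t) ∈ M}

/-- The conformal distance on `Ω` induced by a conformal factor `v`: the infimum of
`v`-lengths of `C¹` paths in `Ω` joining `x` to `y`. -/
noncomputable def confDist (v : ℂ → ℝ) (Ω : Set ℂ) (x y : ℂ) : ℝ :=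
  sInf {L : ℝ | ∃ γ : ℝ → ℂ, ContDiffOn ℝ 1 γ (Icc 0 1) ∧
    (∀ s ∈ Icc (0:ℝ) 1, γ s ∈ Ω) ∧ γ 0 = x ∧ γ 1 = y ∧
    L = ∫ s in (0:ℝ)..1, Real.sqrt (v (γ s)) * ‖derivWithin γ (Icc 0 1) s‖}

/-- The conformal ball of centre `p` and radius `ρ` in `Ω` for the metric `v|dz|²`. -/
def confBall (v : ℂ → ℝ) (Ω : Set ℂ) (p : ℂ) (ρ : ℝ) : Set ℂ :=
  {z ∈ connectedComponentIn Ω p | confDist v Ω p z < ρ}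

/-- The conformal metric `v|dz|²` is complete on `Ω`: every connected component of `Ω` is a
complete metric space with respect to the induced distance `confDist v Ω`. -/
def ConfComplete (v : ℂ → ℝ) (Ω : Set ℂ) : Prop :=
  ∀ x₀ ∈ Ω, ∀ x : ℕ → ℂ, (∀ n, x n ∈ connectedComponentIn Ω x₀) →
    (∀ ε : ℝ, 0 < ε → ∃ N : ℕ, ∀ m ≥ N, ∀ n ≥ N, confDist v Ω (x m) (x n) < ε) →
    ∃ l ∈ connectedComponentIn Ω x₀,
      Tendsto (fun n => confDist v Ω (x n) l) atTop (nhds 0)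

/-- A conformal Ricci flow spacetime in the ambient space `ℂ × (0,T)`:
`M` is a connected open subset of `ℂ × (0,T)` with non-empty time-slices, and `u` is a smooth
positive conformal factor on `M` solving the logarithmic fast diffusion equation
`∂u/∂t = Δ log u`. -/
structure ConfRFS (T : ℝ) (M : Set (ℂ × ℝ)) (u : ℂ → ℝ → ℝ) : Prop where
  sub : M ⊆ {p : ℂ × ℝ | p.2 ∈ Ioo 0 T}
  opn : IsOpen M
  conn : IsConnected M
  nonempty : ∀ t ∈ Ioo (0:ℝ) T, (timeSlice M t).Nonempty
  pos : ∀ p ∈ M, 0 < u p.1 p.2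
  smooth : ContDiffOn ℝ (⊤ : ℕ∞) (fun p : ℂ × ℝ => u p.1 p.2) M
  lfde : ∀ p ∈ M, deriv (u p.1) p.2 = lap (fun z => Real.log (u z p.2)) p.1

/-- A conformal Ricci flow spacetime is complete if the metric `u(·,t)|dz|²` is complete on the
timeSlice `M_t` for every `t ∈ (0,T)`. -/
def ConfRFSComplete (T : ℝ) (M : Set (ℂ × ℝ)) (u : ℂ → ℝ → ℝ) : Prop :=
  ∀ t ∈ Ioo (0:ℝ) T, ConfComplete (fun z => u z t) (timeSlice M t)

/-- There is a time-preserving path in `M` from time `s` to the point `(z,t)`. -/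
def TimePreservingFrom (M : Set (ℂ × ℝ)) (s : ℝ) (z : ℂ) (t : ℝ) : Prop :=
  ∃ γ : ℝ → ℂ, ContinuousOn γ (Icc s t) ∧ (∀ r ∈ Icc s t, (γ r, r) ∈ M) ∧ γ t = z

/-- The hindsight function of a spacetime `M`. -/
noncomputable def hindsight (M : Set (ℂ × ℝ)) (z : ℂ) (t : ℝ) : ℝ :=
  sInf {s : ℝ | 0 < s ∧ s ≤ t ∧ TimePreservingFrom M s z t}

/-- A spacetime is initially determined if its hindsight function vanishes identically. -/
def InitiallyDetermined (M : Set (ℂ × ℝ)) : Prop :=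
  ∀ p ∈ M, hindsight M p.1 p.2 = 0

/-- A spacetime in `ℂ × (0,T)` is expanding if worldlines persist until the final time. -/
def Expanding (T : ℝ) (M : Set (ℂ × ℝ)) : Prop :=
  ∀ (z : ℂ) (t t' : ℝ), (z, t) ∈ M → t ≤ t' → t' < T → (z, t') ∈ M

/-- An expanding spacetime is continuous if each timeSlice is the interior of the intersection of
all later slices. -/
def ContinuousSpacetime (T : ℝ) (M : Set (ℂ × ℝ)) : Prop :=
  ∀ s ∈ Ioo (0:ℝ) T, timeSlice M s = interior (⋂ t ∈ Ioo s T, timeSlice M t)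

/-- The vanishing time of the point `(z,t)`: the supremum of the connected component containing
`t` of the set of times at which `z` belongs to the spacetime. -/
noncomputable def vanishTime (M : Set (ℂ × ℝ)) (z : ℂ) (t : ℝ) : ℝ :=
  sSup (connectedComponentIn {r : ℝ | (z, r) ∈ M} t)

/-- The (closed) support of a measure on `ℂ`: the points all of whose open neighbourhoods have
positive measure. -/
def measSupport (μ : Measure ℂ) : Set ℂ :=
  {x | ∀ U : Set ℂ, IsOpen U → x ∈ U → μ U ≠ 0}

/-- The `v`-length of a path on `[0,1]`. -/
noncomputable def clen (v : ℂ → ℝ) (γ : ℝ → ℂ) : ℝ :=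
  ∫ s in (0:ℝ)..1, Real.sqrt (v (γ s)) * ‖deriv γ s‖

/-- `y` can be reached from `x` by a `C¹` path of `v`-length less than `ρ`. -/
def Reach (v : ℂ → ℝ) (x y : ℂ) (ρ : ℝ) : Prop :=
  ∃ γ : ℝ → ℂ, ContDiff ℝ 1 γ ∧ γ 0 = x ∧ γ 1 = y ∧ clen v γ < ρ

lemma clen_nonneg (v : ℂ → ℝ) (γ : ℝ → ℂ) : 0 ≤ clen v γ :=
  intervalIntegral.integral_nonneg zero_le_one fun _ _ => by positivity

lemma continuous_clen_integrand {v : ℂ → ℝ} (hv : Continuous v) {γ : ℝ → ℂ}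
    (hγ : ContDiff ℝ 1 γ) : Continuous fun s => Real.sqrt (v (γ s)) * ‖deriv γ s‖ :=
  ((hv.comp hγ.continuous).sqrt).mul (hγ.continuous_deriv le_rfl).norm

lemma deriv_comp_affine (γ : ℝ → ℂ) (hγ : ContDiff ℝ 1 γ) (b c s : ℝ) :
    deriv (fun s => γ (b + c * s)) s = c • deriv γ (b + c * s) := by
  have h1 : HasDerivAt (fun s : ℝ => b + c * s) c s := by
    simpa using ((hasDerivAt_id s).const_mul c).const_add b
  exact ((hγ.differentiable one_ne_zero _).hasDerivAt.scomp s h1).deriv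

lemma contDiff_comp_affine {γ : ℝ → ℂ} (hγ : ContDiff ℝ 1 γ) (b c : ℝ) :
    ContDiff ℝ 1 (fun s => γ (b + c * s)) :=
  hγ.comp (contDiff_const.add (contDiff_const.mul contDiff_id))

lemma clen_comp_affine (v : ℂ → ℝ) {γ : ℝ → ℂ} (hγ : ContDiff ℝ 1 γ) (b : ℝ) {c : ℝ}
    (hc : 0 ≤ c) : clen v (fun s => γ (b + c * s)) =
      ∫ s in b..(b + c), Real.sqrt (v (γ s)) * ‖deriv γ s‖ := by
  have := intervalIntegral.smul_integral_comp_add_mul (a := 0) (b := 1)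
    (fun s => Real.sqrt (v (γ s)) * ‖deriv γ s‖) c b
  simp only [mul_zero, add_zero, mul_one] at this
  rw [← this, clen, smul_eq_mul, ← intervalIntegral.integral_const_mul]
  congr 1; ext s
  rw [deriv_comp_affine γ hγ, norm_smul, Real.norm_of_nonneg hc]; ring

lemma clen_reverse (v : ℂ → ℝ) {γ : ℝ → ℂ} (hγ : ContDiff ℝ 1 γ) :
    clen v (fun s => γ (1 + (-1) * s)) = clen v γ := by
  have := intervalIntegral.integral_comp_sub_left (a := 0) (b := 1)
    (fun s => Real.sqrt (v (γ s)) * ‖deriv γ s‖) 1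
  simp only [sub_zero, sub_self] at this
  rw [clen, clen, ← this]
  congr 1; ext s
  rw [deriv_comp_affine γ hγ, norm_smul]; simp [sub_eq_add_neg]

/-- A path which is `C¹` on `[0,1]`, slowed down at both ends, is `C¹` on the whole line and has
the same length. -/
lemma clen_smoothTransition {v : ℂ → ℝ} (hv : Continuous v) {γ : ℝ → ℂ}
    (hγ : ContDiffOn ℝ 1 γ (Icc 0 1)) :
    ContDiff ℝ 1 (fun s => γ (Real.smoothTransition s)) ∧
    clen v (fun s => γ (Real.smoothTransition s)) =
      ∫ s in (0:ℝ)..1, Real.sqrt (v (γ s)) * ‖derivWithin γ (Icc 0 1) s‖ := by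
  have hσ : ContDiff ℝ 1 Real.smoothTransition := Real.smoothTransition.contDiff (n := 1)
  have hmem : ∀ s, Real.smoothTransition s ∈ Icc (0:ℝ) 1 := fun s =>
    ⟨Real.smoothTransition.nonneg s, Real.smoothTransition.le_one s⟩
  have hC : ContDiff ℝ 1 (fun s => γ (Real.smoothTransition s)) := by
    rw [← contDiffOn_univ]
    exact hγ.comp hσ.contDiffOn (fun s _ => hmem s)
  refine ⟨hC, ?_⟩
  set g : ℝ → ℝ := fun s => Real.sqrt (v (γ s)) * ‖derivWithin γ (Icc 0 1) s‖
  have hg : ContinuousOn g (Icc 0 1) := by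
    refine ((hv.comp_continuousOn hγ.continuousOn).sqrt).mul ?_
    exact (hγ.continuousOn_derivWithin (uniqueDiffOn_Icc zero_lt_one) le_rfl).norm
  have h1 := intervalIntegral.integral_comp_mul_deriv' (a := 0) (b := 1)
    (f := Real.smoothTransition) (f' := deriv Real.smoothTransition) (g := g)
    (fun x _ => (hσ.differentiable one_ne_zero x).hasDerivAt)
    ((hσ.continuous_deriv le_rfl).continuousOn)
    (hg.mono (by rintro _ ⟨s, _, rfl⟩; exact hmem s))
  simp only [Real.smoothTransition.zero, Real.smoothTransition.one] at h1
  rw [← h1, clen]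
  congr 1; ext s
  have hd : HasDerivAt (fun s => γ (Real.smoothTransition s))
      (deriv Real.smoothTransition s • derivWithin γ (Icc 0 1) (Real.smoothTransition s)) s := by
    have a := ((hγ.differentiableOn one_ne_zero) _ (hmem s)).hasDerivWithinAt
    have b := (hσ.differentiable one_ne_zero s).hasDerivAt
    have := HasDerivWithinAt.scomp (s := univ) s a b.hasDerivWithinAt (fun s _ => hmem s)
    exact hasDerivWithinAt_univ.1 this
  have hn : 0 ≤ deriv Real.smoothTransition s := Real.smoothTransition.monotone.deriv_nonneg
  rw [hd.deriv, norm_smul, Real.norm_of_nonneg hn]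
  simp only [g, Function.comp]; ring

/-- Concatenation of two paths. -/
lemma exists_concat {v : ℂ → ℝ} (hv : Continuous v) {γ₁ γ₂ : ℝ → ℂ} (h₁ : ContDiff ℝ 1 γ₁)
    (h₂ : ContDiff ℝ 1 γ₂) (h : γ₁ 1 = γ₂ 0) :
    ∃ γ : ℝ → ℂ, ContDiff ℝ 1 γ ∧ γ 0 = γ₁ 0 ∧ γ 1 = γ₂ 1 ∧
      clen v γ = clen v γ₁ + clen v γ₂ := by
  set σ := Real.smoothTransition
  obtain ⟨c₁, l₁⟩ := clen_smoothTransition hv h₁.contDiffOn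
  obtain ⟨c₂, l₂⟩ := clen_smoothTransition hv h₂.contDiffOn
  have key : ∀ {γ : ℝ → ℂ}, ContDiff ℝ 1 γ →
      (∫ s in (0:ℝ)..1, Real.sqrt (v (γ s)) * ‖derivWithin γ (Icc 0 1) s‖) = clen v γ := by
    intro γ hγ
    refine intervalIntegral.integral_congr fun s hs => ?_
    rw [uIcc_of_le zero_le_one] at hs
    rw [(hγ.differentiable one_ne_zero s).derivWithin (uniqueDiffOn_Icc zero_lt_one s hs)]
  rw [key h₁] at l₁; rw [key h₂] at l₂
  set δ₁ : ℝ → ℂ := fun s => γ₁ (σ s)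
  set δ₂ : ℝ → ℂ := fun s => γ₂ (σ s)
  have hδ₁ : ∀ s, 1 ≤ s → δ₁ s = γ₁ 1 := fun s hs => by
    simp [δ₁, σ, Real.smoothTransition.one_of_one_le hs]
  have hδ₂ : ∀ s, s ≤ 0 → δ₂ s = γ₂ 0 := fun s hs => by
    simp [δ₂, σ, Real.smoothTransition.zero_of_nonpos hs]
  have e₁ := clen_comp_affine v (contDiff_comp_affine c₁ 0 2) 0 (c := 1/2) (by norm_num)
  have e₂ := clen_comp_affine v (contDiff_comp_affine c₂ (-1) 2) (1/2) (c := 1/2) (by norm_num)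
  have f₁ := contDiff_comp_affine c₁ 0 2
  have f₂ := contDiff_comp_affine c₂ (-1) 2
  set γ : ℝ → ℂ := fun s => δ₁ (0 + 2 * s) + (δ₂ (-1 + 2 * s) - γ₂ 0) with hγdef
  have hγ : ContDiff ℝ 1 γ := f₁.add (f₂.sub contDiff_const)
  refine ⟨γ, hγ, ?_, ?_, ?_⟩
  · simp [hγdef, hδ₂ (-1) (by norm_num), δ₁, σ]
  · have : δ₂ 1 = γ₂ 1 := by simp [δ₂, σ]
    simp only [hγdef]
    norm_num
    rw [hδ₁ 2 (by norm_num), this, h]; ring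
  · have hint : ∀ a b : ℝ, IntervalIntegrable (fun s => Real.sqrt (v (γ s)) * ‖deriv γ s‖)
        volume a b := fun a b => (continuous_clen_integrand hv hγ).intervalIntegrable a b
    have hA : (∫ s in (0:ℝ)..(1/2), Real.sqrt (v (γ s)) * ‖deriv γ s‖) = clen v γ₁ := by
      rw [← l₁]
      have : δ₁ = fun s => δ₁ (0 + 2 * (0 + 1/2 * s)) := by
        ext s; simp only [δ₁]; congr 2; ring
      rw [this, e₁, zero_add]
      refine intervalIntegral.integral_congr_ae ?_
      have : ∀ᵐ x : ℝ, x ≠ 1/2 := by simp [ae_iff]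
      filter_upwards [this] with s hs hs'
      rw [uIoc_of_le (by norm_num)] at hs'
      have hlt : s < 1/2 := lt_of_le_of_ne hs'.2 hs
      have hev : γ =ᶠ[nhds s] fun s => δ₁ (0 + 2 * s) := by
        filter_upwards [Iio_mem_nhds hlt] with x hx
        simp only [hγdef]
        rw [hδ₂ _ (by simp at hx; linarith)]; ring
      rw [hev.deriv_eq, hev.self_of_nhds]
    have hB : (∫ s in (1/2:ℝ)..1, Real.sqrt (v (γ s)) * ‖deriv γ s‖) = clen v γ₂ := by
      rw [← l₂]
      have : δ₂ = fun s => δ₂ (-1 + 2 * (1/2 + 1/2 * s)) := by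
        ext s; simp only [δ₂]; congr 2; ring
      rw [this, e₂]
      rw [show (1/2:ℝ) + 1/2 = 1 by norm_num]
      refine intervalIntegral.integral_congr_ae ?_
      filter_upwards with s hs'
      rw [uIoc_of_le (by norm_num)] at hs'
      have hev : γ =ᶠ[nhds s] fun s => δ₂ (-1 + 2 * s) := by
        filter_upwards [Ioi_mem_nhds hs'.1] with x hx
        simp only [hγdef]
        rw [hδ₁ _ (by simp at hx; linarith), h]; ring
      rw [hev.deriv_eq, hev.self_of_nhds]
    rw [← hA, ← hB, clen, intervalIntegral.integral_add_adjacent_intervals (hint _ _) (hint _ _)]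

lemma Reach.trans {v : ℂ → ℝ} (hv : Continuous v) {x y z : ℂ} {a b : ℝ} (h : Reach v x y a)
    (h' : Reach v y z b) : Reach v x z (a + b) := by
  obtain ⟨γ₁, c₁, rfl, e₁, l₁⟩ := h
  obtain ⟨γ₂, c₂, e₂, rfl, l₂⟩ := h'
  obtain ⟨γ, c, i, j, l⟩ := exists_concat hv c₁ c₂ (e₁.trans e₂.symm)
  exact ⟨γ, c, i, j, by rw [l]; linarith⟩

lemma Reach.symm {v : ℂ → ℝ} {x y : ℂ} {a : ℝ} (h : Reach v x y a) : Reach v y x a := by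
  obtain ⟨γ, c, rfl, rfl, l⟩ := h
  exact ⟨fun s => γ (1 + (-1) * s), contDiff_comp_affine c 1 (-1), by simp, by simp,
    by rwa [clen_reverse v c]⟩

lemma Reach.mono {v : ℂ → ℝ} {x y : ℂ} {a b : ℝ} (h : Reach v x y a) (hab : a ≤ b) :
    Reach v x y b := by
  obtain ⟨γ, c, i, j, l⟩ := h
  exact ⟨γ, c, i, j, l.trans_le hab⟩

lemma contDiff_segment (x y : ℂ) : ContDiff ℝ 1 (fun s : ℝ => x + (s : ℂ) * (y - x)) :=
  contDiff_const.add (Complex.ofRealCLM.contDiff.mul contDiff_const)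

lemma clen_segment_le {v : ℂ → ℝ} (hv : Continuous v) {x y : ℂ} {S : Set ℂ} (hS : Convex ℝ S)
    (hx : x ∈ S) (hy : y ∈ S) {A : ℝ} (hA : ∀ z ∈ S, Real.sqrt (v z) ≤ A) :
    clen v (fun s : ℝ => x + (s : ℂ) * (y - x)) ≤ A * ‖y - x‖ := by
  have hd : ∀ s, deriv (fun s : ℝ => x + (s : ℂ) * (y - x)) s = y - x := fun s => by
    have : HasDerivAt (fun s : ℝ => x + (s : ℂ) * (y - x)) (1 * (y - x)) s :=
      ((Complex.ofRealCLM.hasDerivAt (x := s)).mul_const (y - x)).const_add x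
    simpa using this.deriv
  have h1 : clen v (fun s : ℝ => x + (s : ℂ) * (y - x)) ≤ ∫ s in (0:ℝ)..1, A * ‖y - x‖ := by
    refine intervalIntegral.integral_mono_on zero_le_one
      ((continuous_clen_integrand hv (contDiff_segment x y)).intervalIntegrable _ _)
      intervalIntegrable_const fun s hs => ?_
    rw [hd]
    refine mul_le_mul_of_nonneg_right (hA _ ?_) (norm_nonneg _)
    have := hS.add_smul_sub_mem hx hy hs
    simpa using this
  simpa using h1

/-- `Reach` compares with the conformal distance. -/
lemma confDist_lt_of_reach {v : ℂ → ℝ} {x y : ℂ} {ρ : ℝ} (h : Reach v x y ρ) :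
    confDist v univ x y < ρ := by
  obtain ⟨γ, c, i, j, l⟩ := h
  refine lt_of_le_of_lt (csInf_le ⟨0, ?_⟩ ⟨γ, c.contDiffOn, fun _ _ => mem_univ _, i, j, rfl⟩) ?_
  · rintro _ ⟨γ, -, -, -, -, rfl⟩
    exact intervalIntegral.integral_nonneg zero_le_one fun _ _ => by positivity
  · refine lt_of_eq_of_lt (intervalIntegral.integral_congr fun s hs => ?_) l
    rw [uIcc_of_le zero_le_one] at hs
    rw [(c.differentiable one_ne_zero s).derivWithin (uniqueDiffOn_Icc zero_lt_one s hs)]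

lemma reach_of_confDist_lt {v : ℂ → ℝ} (hv : Continuous v) {x y : ℂ} {ρ : ℝ}
    (h : confDist v univ x y < ρ) : Reach v x y ρ := by
  unfold confDist at h
  obtain ⟨L, ⟨γ, c, -, i, j, rfl⟩, hL⟩ := exists_lt_of_csInf_lt
    (by exact ⟨_, ⟨fun s : ℝ => x + (s : ℂ) * (y - x), (contDiff_segment x y).contDiffOn,
      fun _ _ => mem_univ _, by simp, by simp, rfl⟩⟩) h
  obtain ⟨c', l⟩ := clen_smoothTransition hv c
  exact ⟨_, c', by simp [i], by simp [j], by rw [l]; exact hL⟩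

/-- The part of a path up to its first exit from a closed ball. -/
lemma exists_first_exit {γ : ℝ → ℂ} (hγ : Continuous γ) {p : ℂ} {r c : ℝ} (hc : c ∈ Icc (0:ℝ) 1)
    (h0 : ‖γ 0 - p‖ ≤ r) (h1 : r ≤ ‖γ c - p‖) :
    ∃ b ∈ Icc (0:ℝ) 1, ‖γ b - p‖ = r ∧ ∀ s ∈ Icc 0 b, ‖γ s - p‖ ≤ r := by
  set S : Set ℝ := Icc 0 c ∩ {s | r ≤ ‖γ s - p‖}
  have hcl : IsCompact S := isCompact_Icc.inter_right
    (isClosed_le continuous_const (hγ.sub continuous_const).norm)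
  have hne : S.Nonempty := ⟨c, ⟨hc.1, le_rfl⟩, h1⟩
  obtain ⟨b, hb, hmin⟩ := hcl.exists_isLeast hne
  have hin : ∀ s ∈ Ico 0 b, ‖γ s - p‖ < r := by
    intro s hs
    by_contra hcon
    exact absurd (hmin ⟨⟨hs.1, hs.2.le.trans hb.1.2⟩, not_lt.1 hcon⟩) (not_le.2 hs.2)
  have hle : ‖γ b - p‖ ≤ r := by
    rcases eq_or_lt_of_le hb.1.1 with h | h
    · rw [← h]; exact h0
    · have hcl : IsClosed {s : ℝ | ‖γ s - p‖ ≤ r} :=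
        isClosed_le (hγ.sub continuous_const).norm continuous_const
      have : closure (Ico 0 b) ⊆ {s : ℝ | ‖γ s - p‖ ≤ r} :=
        hcl.closure_subset_iff.2 fun s hs => (hin s hs).le
      rw [closure_Ico h.ne] at this
      exact this ⟨h.le, le_rfl⟩
  refine ⟨b, ⟨hb.1.1, hb.1.2.trans hc.2⟩, le_antisymm hle hb.2, fun s hs => ?_⟩
  rcases eq_or_lt_of_le hs.2 with h | h
  · rw [h]; exact hle
  · exact (hin s ⟨hs.1, h⟩).le

lemma clen_initial_le {v : ℂ → ℝ} (hv : Continuous v) {γ : ℝ → ℂ} (hγ : ContDiff ℝ 1 γ) {b : ℝ}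
    (hb : b ∈ Icc (0:ℝ) 1) : clen v (fun s => γ (0 + b * s)) ≤ clen v γ := by
  rw [clen_comp_affine v hγ 0 hb.1, clen, zero_add]
  exact intervalIntegral.integral_mono_interval le_rfl hb.1 hb.2
    (Eventually.of_forall fun s => by positivity)
    ((continuous_clen_integrand hv hγ).intervalIntegrable _ _)

/-- A lower bound of the length by the Euclidean distance of the end points. -/
lemma le_clen {v : ℂ → ℝ} (hv : Continuous v) {γ : ℝ → ℂ} (hγ : ContDiff ℝ 1 γ) {η : ℝ}
    (hη : 0 ≤ η) (h : ∀ s ∈ Icc (0:ℝ) 1, η ≤ Real.sqrt (v (γ s))) :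
    η * ‖γ 1 - γ 0‖ ≤ clen v γ := by
  have h1 : ∫ s in (0:ℝ)..1, deriv γ s = γ 1 - γ 0 :=
    intervalIntegral.integral_deriv_eq_sub (fun s _ => hγ.differentiable one_ne_zero s)
      ((hγ.continuous_deriv le_rfl).intervalIntegrable _ _)
  calc η * ‖γ 1 - γ 0‖ ≤ η * ∫ s in (0:ℝ)..1, ‖deriv γ s‖ := by
        rw [← h1]
        exact mul_le_mul_of_nonneg_left
          (intervalIntegral.norm_integral_le_integral_norm zero_le_one) hη
    _ = ∫ s in (0:ℝ)..1, η * ‖deriv γ s‖ := by rw [intervalIntegral.integral_const_mul]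
    _ ≤ clen v γ := by
        refine intervalIntegral.integral_mono_on zero_le_one
          ((continuous_const.mul (hγ.continuous_deriv le_rfl).norm).intervalIntegrable _ _)
          ((continuous_clen_integrand hv hγ).intervalIntegrable _ _) fun s hs => ?_
        exact mul_le_mul_of_nonneg_right (h s hs) (norm_nonneg _)

lemma exists_split {v : ℂ → ℝ} (hv : Continuous v) {γ : ℝ → ℂ} (hγ : ContDiff ℝ 1 γ) {τ : ℝ}
    (h0 : 0 ≤ τ) (h1 : τ ≤ clen v γ) : ∃ c ∈ Icc (0:ℝ) 1,
      clen v (fun s => γ (0 + c * s)) = τ ∧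
      clen v (fun s => γ (c + (1 - c) * s)) = clen v γ - τ := by
  have hc := continuous_clen_integrand hv hγ
  have hcont : Continuous fun c => ∫ s in (0:ℝ)..c, Real.sqrt (v (γ s)) * ‖deriv γ s‖ :=
    intervalIntegral.continuous_primitive (fun a b => hc.intervalIntegrable a b) 0
  obtain ⟨c, hc01, hcτ⟩ := intermediate_value_Icc zero_le_one hcont.continuousOn
    (show τ ∈ Icc _ _ from ⟨by simpa using h0, h1⟩)
  refine ⟨c, hc01, ?_, ?_⟩
  · rw [clen_comp_affine v hγ 0 hc01.1, zero_add]; exact hcτ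
  · rw [clen_comp_affine v hγ c (by linarith [hc01.2]), add_sub_cancel, clen, ← hcτ,
      intervalIntegral.integral_interval_sub_left (hc.intervalIntegrable _ _)
      (hc.intervalIntegrable _ _)]

lemma Reach.split {v : ℂ → ℝ} (hv : Continuous v) {x z : ℂ} {a b : ℝ} (ha : 0 < a)
    (hb : 0 < b) (h : Reach v x z (a + b)) :
    ∃ y, Reach v x y a ∧ Reach v y z (2 * b) := by
  obtain ⟨γ, c, rfl, rfl, l⟩ := h
  by_cases hl : clen v γ < a
  · refine ⟨γ 1, ⟨γ, c, rfl, rfl, hl⟩, fun _ => γ 1, contDiff_const, rfl, rfl, ?_⟩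
    simp [clen, hb]
  · obtain ⟨τ, hτ0, hτa, hτb⟩ : ∃ τ, 0 ≤ τ ∧ τ < a ∧ a - b ≤ τ := by
      rcases le_total a b with h | h
      · exact ⟨0, le_rfl, ha, by linarith⟩
      · exact ⟨a - b, by linarith, by linarith, le_rfl⟩
    obtain ⟨d, hd, e1, e2⟩ := exists_split hv c hτ0 (by linarith)
    refine ⟨γ d, ⟨_, contDiff_comp_affine c 0 d, by simp, by simp, by rw [e1]; exact hτa⟩,
      ⟨_, contDiff_comp_affine c d (1 - d), by simp, by simp, by rw [e2]; linarith⟩⟩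

lemma reach_of_near {v : ℂ → ℝ} (hv : Continuous v) {S : Set ℂ} (hS : Bornology.IsBounded S)
    {ε : ℝ} (hε : 0 < ε) : ∃ δ > 0, ∀ x ∈ S, ∀ y ∈ S, dist x y < δ → Reach v x y ε := by
  obtain ⟨M, hM⟩ := hS.subset_closedBall (0:ℂ)
  obtain ⟨Λ, hΛ⟩ := (isCompact_closedBall (0:ℂ) M).bddAbove_image (hv.sqrt.continuousOn)
  have hΛ' : ∀ z ∈ closedBall (0:ℂ) M, Real.sqrt (v z) ≤ |Λ| + 1 := fun z hz =>
    (hΛ (mem_image_of_mem _ hz)).trans (by linarith [le_abs_self Λ])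
  refine ⟨ε / (|Λ| + 1), by positivity, fun x hx y hy h => ⟨_, contDiff_segment x y, by simp,
    by simp, (clen_segment_le hv (convex_closedBall 0 M) (hM hx) (hM hy) hΛ').trans_lt ?_⟩⟩
  rw [dist_comm, dist_eq_norm, lt_div_iff₀ (by positivity)] at h
  linarith

/-- If all small balls centred in a ball are bounded, so is the ball. -/
lemma bounded_reach_of_forall {v : ℂ → ℝ} (hv : Continuous v) {p : ℂ} {R ε : ℝ} (hε : 0 < ε)
    (h : ∀ y, Reach v p y R → Bornology.IsBounded {z | Reach v y z ε}) :
    Bornology.IsBounded {z | Reach v p z R} := by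
  rcases le_or_gt R 0 with hR | hR
  · convert Bornology.isBounded_empty (α := ℂ)
    ext z; simp only [mem_ofPred_eq, mem_empty_iff_false, iff_false]
    rintro ⟨γ, -, -, -, l⟩
    linarith [clen_nonneg v γ]
  have hstep : ∀ n : ℕ, Bornology.IsBounded {z | Reach v p z (min ((n + 1) * (ε / 4)) R)} := by
    intro n
    induction n with
    | zero =>
      refine (h p ⟨fun _ => p, contDiff_const, rfl, rfl, by simpa [clen] using hR⟩).subset ?_
      intro z hz
      refine Reach.mono hz ((min_le_left _ _).trans ?_)
      push_cast; linarith
    | succ n ih =>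
      set a := min ((n + 1) * (ε / 4)) R
      have ha : 0 < a := lt_min (by positivity) hR
      set S := {z | Reach v p z a}
      obtain ⟨δ, hδ, hnear⟩ := reach_of_near hv ih (show 0 < ε / 2 by linarith)
      obtain ⟨t, htS, htf, hcov⟩ := Metric.finite_approx_of_totallyBounded
        (ih.isCompact_closure.totallyBounded.subset subset_closure) δ hδ
      refine ((Bornology.isBounded_biUnion htf).2 fun y hy => h y ?_).subset ?_
      · exact Reach.mono (htS hy) (min_le_right _ _)
      · intro z hz
        have hle : min (((n + 1 : ℕ) + 1) * (ε / 4)) R ≤ a + ε / 4 := by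
          rcases le_total ((n + 1) * (ε / 4)) R with h' | h'
          · simp only [a, min_eq_left h']
            refine (min_le_left _ _).trans (le_of_eq ?_)
            push_cast; ring
          · simp only [a, min_eq_right h']
            exact (min_le_right _ _).trans (by linarith)
        obtain ⟨y, hy, hyz⟩ := Reach.split hv ha (by positivity) (Reach.mono hz hle)
        obtain ⟨i, hi, hyi⟩ := mem_iUnion₂.1 (hcov hy)
        refine mem_biUnion hi ?_
        have := (hnear i (htS hi) y hy (by rw [dist_comm]; exact hyi)).trans hv hyz
        exact this.mono (by linarith)
  obtain ⟨n, hn⟩ := exists_nat_gt (R / (ε / 4))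
  have := hstep n
  rwa [min_eq_right] at this
  rw [div_lt_iff₀ (by positivity)] at hn
  nlinarith

/-- One half of the Hopf–Rinow theorem: metric balls of a complete conformal metric are
bounded. -/
theorem bounded_reach_of_complete {v : ℂ → ℝ} (hv : Continuous v) (hpos : ∀ z, 0 < v z)
    (hc : ConfComplete v univ) (p : ℂ) (R : ℝ) : Bornology.IsBounded {z | Reach v p z R} := by
  by_contra hbad
  have hR : 0 < R := by
    by_contra hR
    refine hbad ?_
    convert Bornology.isBounded_empty (α := ℂ)
    ext z; simp only [mem_ofPred_eq, mem_empty_iff_false, iff_false]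
    rintro ⟨γ, -, -, -, l⟩
    linarith [clen_nonneg v γ]
  let P : ℕ → ℂ → Prop := fun k q => ¬ Bornology.IsBounded {z | Reach v q z (R * (1/2) ^ k)}
  have hnext : ∀ k q, P k q → ∃ q', Reach v q q' (R * (1/2) ^ k) ∧ P (k + 1) q' := by
    intro k q hq
    by_contra hcon
    push Not at hcon
    refine hq (bounded_reach_of_forall hv (ε := R * (1/2) ^ (k + 1)) (by positivity) ?_)
    intro y hy
    exact not_not.1 (hcon y hy)
  choose! f hf1 hf2 using hnext
  let x : ℕ → ℂ := fun n => Nat.rec p (fun k q => f k q) n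
  have hx : ∀ n, P n (x n) := by
    intro n
    induction n with
    | zero => simpa [P, x] using hbad
    | succ n ih => exact hf2 n _ ih
  have hxr : ∀ n, Reach v (x n) (x (n + 1)) (R * (1/2) ^ n) := fun n => hf1 n _ (hx n)
  have hreach : ∀ n k, Reach v (x n) (x (n + k)) (2 * R * (1/2) ^ n) := by
    have : ∀ k n, Reach v (x n) (x (n + k)) (2 * R * (1/2) ^ n) := by
      intro k
      induction k with
      | zero =>
        intro n
        refine ⟨fun _ => x n, contDiff_const, rfl, rfl, ?_⟩
        simp [clen, hR]
      | succ k ih =>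
        intro n
        have h2 := (hxr n).trans hv (ih (n + 1))
        rw [show n + 1 + k = n + (k + 1) by ring] at h2
        refine h2.mono (le_of_eq ?_)
        rw [pow_succ]; ring
    exact fun n k => this k n
  have hcc : connectedComponentIn (univ : Set ℂ) 0 = univ := by
    rw [connectedComponentIn_univ]
    exact PreconnectedSpace.connectedComponent_eq_univ 0
  obtain ⟨l, -, hl⟩ := hc 0 (mem_univ _) x (fun n => by rw [hcc]; trivial) (by
    intro ε hε
    have ht : Tendsto (fun n : ℕ => 4 * R * (1/2 : ℝ) ^ n) atTop (nhds 0) := by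
      simpa using (tendsto_pow_atTop_nhds_zero_of_lt_one (by norm_num : (0:ℝ) ≤ 1/2)
        (by norm_num)).const_mul (4 * R)
    obtain ⟨N, hN⟩ := (ht.eventually (gt_mem_nhds hε)).exists
    refine ⟨N, fun m hm n hn => ?_⟩
    obtain ⟨a, rfl⟩ := Nat.exists_eq_add_of_le hm
    obtain ⟨b, rfl⟩ := Nat.exists_eq_add_of_le hn
    refine confDist_lt_of_reach (((hreach N a).symm.trans hv (hreach N b)).mono ?_)
    linarith)
  obtain ⟨m, -, hm⟩ := (isCompact_closedBall l 1).exists_isMinOn ⟨l, by simp⟩ hv.continuousOn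
  have hη : 0 < Real.sqrt (v m) := Real.sqrt_pos.2 (hpos m)
  set η := Real.sqrt (v m)
  have hball : ∀ z, Reach v l z η → z ∈ closedBall l 1 := by
    rintro z ⟨γ, c, i, rfl, len⟩
    by_contra hz
    rw [mem_closedBall, dist_eq_norm, not_le] at hz
    obtain ⟨b, hb, hb1, hb2⟩ := exists_first_exit c.continuous (p := l) (r := 1) (c := 1)
      (by simp) (by simp [i]) hz.le
    have h1 := le_clen hv (contDiff_comp_affine c 0 b) hη.le (fun s hs => by
      refine Real.sqrt_le_sqrt (hm ?_)
      rw [mem_closedBall, dist_eq_norm]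
      refine hb2 _ ⟨?_, ?_⟩
      · have := mul_nonneg hb.1 hs.1
        linarith
      · have := mul_le_of_le_one_right hb.1 hs.2
        linarith)
    simp only [mul_one, zero_add, mul_zero, i, hb1] at h1
    have h2 := clen_initial_le hv c hb
    simp only [zero_add] at h2
    linarith
  have ht : Tendsto (fun n : ℕ => R * (1/2 : ℝ) ^ n) atTop (nhds 0) := by
    simpa using (tendsto_pow_atTop_nhds_zero_of_lt_one (by norm_num : (0:ℝ) ≤ 1/2)
      (by norm_num)).const_mul R
  obtain ⟨n, h1, h2⟩ := ((ht.eventually (gt_mem_nhds (half_pos hη))).and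
    (hl.eventually (gt_mem_nhds (half_pos hη)))).exists
  refine hx n (isBounded_closedBall.subset fun z hz => hball z ?_)
  exact (((reach_of_confDist_lt hv h2).symm).trans hv hz).mono (by linarith)

lemma continuous_slice {T : ℝ} {u : ℂ → ℝ → ℝ}
    (hcont : ContinuousOn (fun p : ℂ × ℝ => u p.1 p.2) ((univ : Set ℂ) ×ˢ Ioo (0:ℝ) T))
    {t : ℝ} (ht : t ∈ Ioo (0:ℝ) T) : Continuous fun z => u z t := by
  rw [← continuousOn_univ]
  exact hcont.comp (f := fun z => (z, t)) (by fun_prop) (fun z _ => ⟨mem_univ _, ht⟩)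

lemma clen_le_mul_clen {v w : ℂ → ℝ} (hv : Continuous v) (hw : Continuous w) {γ : ℝ → ℂ}
    (hγ : ContDiff ℝ 1 γ) {c : ℝ}
    (h : ∀ s ∈ Icc (0:ℝ) 1, Real.sqrt (v (γ s)) ≤ c * Real.sqrt (w (γ s))) :
    clen v γ ≤ c * clen w γ := by
  rw [clen, clen, ← intervalIntegral.integral_const_mul]
  refine intervalIntegral.integral_mono_on zero_le_one
    ((continuous_clen_integrand hv hγ).intervalIntegrable _ _)
    (((continuous_clen_integrand hw hγ).const_mul c).intervalIntegrable _ _) fun s hs => ?_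
  rw [← mul_assoc]
  exact mul_le_mul_of_nonneg_right (h s hs) (norm_nonneg _)

/-- Metric balls of a complete flow are bounded uniformly on compact time intervals. -/
theorem exists_uniform_bound {T : ℝ} {u : ℂ → ℝ → ℝ}
    (hpos : ∀ (z : ℂ), ∀ t ∈ Ioo (0:ℝ) T, 0 < u z t)
    (hcont : ContinuousOn (fun p : ℂ × ℝ => u p.1 p.2) ((univ : Set ℂ) ×ˢ Ioo (0:ℝ) T))
    (hcomplete : ∀ t ∈ Ioo (0:ℝ) T, ConfComplete (fun z => u z t) univ)
    {s t₀ : ℝ} (hs : 0 < s) (ht : t₀ < T) (R : ℝ) :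
    ∃ ϱ, ∀ t ∈ Icc s t₀, ∀ γ : ℝ → ℂ, ContDiff ℝ 1 γ → ‖γ 0‖ ≤ 1 →
      clen (fun z => u z t) γ < R → ∀ σ ∈ Icc (0:ℝ) 1, ‖γ σ‖ ≤ ϱ := by
  have hsub : ∀ t ∈ Icc s t₀, t ∈ Ioo (0:ℝ) T := fun t h =>
    ⟨hs.trans_le h.1, h.2.trans_lt ht⟩
  refine (isCompact_Icc (a := s) (b := t₀)).induction_on (p := fun S => ∃ ϱ, ∀ t ∈ S ∩ Icc s t₀,
    ∀ γ : ℝ → ℂ, ContDiff ℝ 1 γ → ‖γ 0‖ ≤ 1 →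
      clen (fun z => u z t) γ < R → ∀ σ ∈ Icc (0:ℝ) 1, ‖γ σ‖ ≤ ϱ) ⟨0, by simp⟩ ?_ ?_ ?_
      |>.imp fun ϱ h t ht => h t ⟨ht, ht⟩
  · rintro A B hAB ⟨ϱ, h⟩
    exact ⟨ϱ, fun t ht => h t ⟨hAB ht.1, ht.2⟩⟩
  · rintro A B ⟨ϱ, h⟩ ⟨ϱ', h'⟩
    refine ⟨max ϱ ϱ', ?_⟩
    rintro t ⟨ht | ht, hm⟩ γ c i l σ hσ
    · exact (h t ⟨ht, hm⟩ γ c i l σ hσ).trans (le_max_left _ _)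
    · exact (h' t ⟨ht, hm⟩ γ c i l σ hσ).trans (le_max_right _ _)
  · intro t' ht'
    have htT := hsub t' ht'
    have hv' := continuous_slice hcont htT
    obtain ⟨Λ, hΛ⟩ := (isCompact_closedBall (0:ℂ) 1).bddAbove_image (hv'.sqrt.continuousOn)
    obtain ⟨ϱ₀, hϱ₀⟩ := (bounded_reach_of_complete hv' (fun z => hpos z t' htT)
      (hcomplete t' htT) 0 (|Λ| + 2 * R + 1)).subset_closedBall 0
    set ϱ := max ϱ₀ 1 + 1
    have hϱ0 : ϱ₀ < ϱ := by have := le_max_left ϱ₀ 1; simp only [ϱ]; linarith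
    have hϱ1 : 1 ≤ ϱ := by have := le_max_right ϱ₀ 1; simp only [ϱ]; linarith
    have hopen : IsOpen ((univ : Set ℂ) ×ˢ Ioo (0:ℝ) T) := isOpen_univ.prod isOpen_Ioo
    have hev : ∀ᶠ t in nhds t', ∀ z ∈ closedBall (0:ℂ) ϱ, u z t' < 4 * u z t := by
      refine (isCompact_closedBall (0:ℂ) ϱ).eventually_forall_of_forall_eventually fun z _ => ?_
      have c1 : ContinuousAt (fun p : ℂ × ℝ => u p.1 p.2) (z, t') :=
        hcont.continuousAt (hopen.mem_nhds ⟨mem_univ _, htT⟩)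
      have c2 : ContinuousAt (fun p : ℂ × ℝ => u p.1 t') (z, t') :=
        (hv'.comp continuous_fst).continuousAt
      have c3 := c2.eventually_lt (c1.const_mul 4) (by
        have := hpos z t' htT
        simp only; linarith)
      exact (continuous_swap.tendsto (t', z)).eventually c3
    refine ⟨_, mem_nhdsWithin_of_mem_nhds hev, ϱ, ?_⟩
    rintro t ⟨hlt, ht⟩ γ c i l σ hσ
    by_contra hcon
    obtain ⟨b, hb, hb1, hb2⟩ := exists_first_exit c.continuous (p := 0) (r := ϱ) hσ
      (by simpa using i.trans hϱ1) (by simpa using (not_le.1 hcon).le)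
    simp only [sub_zero] at hb1 hb2
    have hvt := continuous_slice hcont (hsub t ht)
    have e1 : clen (fun z => u z t') (fun s => γ (0 + b * s)) ≤
        2 * clen (fun z => u z t) (fun s => γ (0 + b * s)) := by
      refine clen_le_mul_clen hv' hvt (contDiff_comp_affine c 0 b) fun s hs => ?_
      have hz : γ (0 + b * s) ∈ closedBall (0:ℂ) ϱ := by
        rw [mem_closedBall_zero_iff]
        refine hb2 _ ⟨?_, ?_⟩
        · have := mul_nonneg hb.1 hs.1
          linarith
        · have := mul_le_of_le_one_right hb.1 hs.2
          linarith
      refine (Real.sqrt_le_sqrt (hlt _ hz).le).trans (le_of_eq ?_)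
      rw [Real.sqrt_mul (by norm_num), show (4:ℝ) = 2 ^ 2 by norm_num,
        Real.sqrt_sq (by norm_num)]
    have e2 := clen_initial_le hvt c hb
    have e3 : Reach (fun z => u z t') 0 (γ 0) (|Λ| + 1) := by
      refine ⟨_, contDiff_segment 0 (γ 0), by simp, by simp, (clen_segment_le hv'
        (convex_closedBall 0 1) (by simp) (by simpa using i)
        (fun z hz => hΛ (mem_image_of_mem _ hz))).trans_lt ?_⟩
      rw [sub_zero]
      have := mul_le_mul_of_nonneg_right (le_abs_self Λ) (norm_nonneg (γ 0))
      have := mul_le_of_le_one_right (abs_nonneg Λ) i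
      linarith
    have e4 : Reach (fun z => u z t') (γ 0) (γ b) (2 * R) :=
      ⟨_, contDiff_comp_affine c 0 b, by simp, by simp, by linarith⟩
    have := hϱ₀ ((e3.trans hv' e4).mono (by linarith))
    rw [mem_closedBall_zero_iff, hb1] at this
    linarith

section Taylor

lemma exists_add_mem_of_isCompact {E : Type*} [SeminormedAddCommGroup E] {Ω K : Set E} (hΩ : IsOpen Ω) (hK : IsCompact K)
    (hKΩ : K ⊆ Ω) : ∃ δ > 0, ∀ p ∈ K, ∀ v : E, ‖v‖ ≤ δ → p + v ∈ Ω := by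
  obtain ⟨δ, hδ, h⟩ := hK.exists_cthickening_subset_open hΩ hKΩ
  refine ⟨δ, hδ, fun p hp v hv => h (mem_cthickening_of_dist_le _ p δ K hp ?_)⟩
  simpa [dist_eq_norm] using hv

variable {E : Type*} [NormedAddCommGroup E] [NormedSpace ℝ E]

/-- Taylor expansion of second order, uniformly on compact sets. -/
lemma exists_taylor_two {f : E → ℝ} {Ω K : Set E} (hΩ : IsOpen Ω) (hf : ContDiffOn ℝ 2 f Ω)
    (hK : IsCompact K) (hKΩ : K ⊆ Ω) {ε : ℝ} (hε : 0 < ε) :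
    ∃ δ > 0, ∀ p ∈ K, ∀ v : E, ‖v‖ ≤ δ → p + v ∈ Ω ∧
      |f (p + v) - f p - fderiv ℝ f p v - fderiv ℝ (fderiv ℝ f) p v v / 2| ≤ ε * ‖v‖ ^ 2 := by
  have hf1 : ContDiffOn ℝ 1 (fderiv ℝ f) Ω := hf.fderiv_of_isOpen hΩ (by norm_num)
  have hf2 : ContinuousOn (fderiv ℝ (fderiv ℝ f)) Ω :=
    hf1.continuousOn_fderiv_of_isOpen hΩ le_rfl
  obtain ⟨δ₁, hδ₁, h1⟩ := exists_add_mem_of_isCompact hΩ hK hKΩ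
  obtain ⟨δ₂, hδ₂, h2⟩ := Metric.mem_uniformity_dist.1 (hK.uniformContinuousAt_of_continuousAt
    (β := E →L[ℝ] E →L[ℝ] ℝ) (fderiv ℝ (fderiv ℝ f)) (fun a ha => hf2.continuousAt (hΩ.mem_nhds (hKΩ ha)))
    (Metric.dist_mem_uniformity (α := E →L[ℝ] E →L[ℝ] ℝ) hε))
  refine ⟨min δ₁ (δ₂ / 2), lt_min hδ₁ (half_pos hδ₂), fun p hp v hv => ⟨h1 p hp v
    (hv.trans (min_le_left _ _)), ?_⟩⟩
  set r := min δ₁ (δ₂ / 2)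
  have hmem : ∀ w : E, ‖w‖ ≤ r → p + w ∈ Ω := fun w hw => h1 p hp w (hw.trans (min_le_left _ _))
  have hdf : ∀ w : E, ‖w‖ ≤ r → HasFDerivAt f (fderiv ℝ f (p + w)) (p + w) := fun w hw =>
    ((hf.differentiableOn two_ne_zero).differentiableAt (hΩ.mem_nhds (hmem w hw))).hasFDerivAt
  have hddf : ∀ w : E, ‖w‖ ≤ r →
      HasFDerivAt (fderiv ℝ f) (fderiv ℝ (fderiv ℝ f) (p + w)) (p + w) := fun w hw =>
    ((hf1.differentiableOn one_ne_zero).differentiableAt (hΩ.mem_nhds (hmem w hw))).hasFDerivAt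
  have hr0 : 0 ≤ r := (norm_nonneg _).trans hv
  have hG : ∀ w : E, ‖w‖ ≤ r →
      ‖fderiv ℝ f (p + w) - fderiv ℝ f p - fderiv ℝ (fderiv ℝ f) p w‖ ≤ ε * ‖w‖ := by
    intro w hw
    have := (convex_closedBall (0:E) r).norm_image_sub_le_of_norm_hasFDerivWithin_le
      (f := fun w => fderiv ℝ f (p + w) - fderiv ℝ (fderiv ℝ f) p w)
      (f' := fun w => fderiv ℝ (fderiv ℝ f) (p + w) - fderiv ℝ (fderiv ℝ f) p) (C := ε)
      (x := 0) (y := w) (fun x hx => ?_) (fun x hx => ?_) (by simpa using hr0) (by simpa using hw)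
    · simp only [add_zero, map_zero, sub_zero] at this
      rwa [sub_right_comm]
    · rw [mem_closedBall_zero_iff] at hx
      exact (((hasFDerivAt_comp_add_left p).2 (hddf x hx)).sub
        (fderiv ℝ (fderiv ℝ f) p).hasFDerivAt).hasFDerivWithinAt
    · rw [mem_closedBall_zero_iff] at hx
      have := h2 (a := p) (b := p + x) (by
        simp only [dist_self_add_right]
        exact (hx.trans (min_le_right _ _)).trans_lt (half_lt_self hδ₂)) hp
      have : dist (fderiv ℝ (fderiv ℝ f) p) (fderiv ℝ (fderiv ℝ f) (p + x)) < ε := this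
      rw [dist_comm] at this
      exact (dist_eq_norm (E := E →L[ℝ] E →L[ℝ] ℝ) _ _).symm.le.trans this.le
  have hs : ∀ s ∈ Icc (0:ℝ) 1, ‖s • v‖ ≤ ‖v‖ := fun s hs => by
    rw [norm_smul, Real.norm_of_nonneg hs.1]
    exact mul_le_of_le_one_left (norm_nonneg _) hs.2
  have hline : ∀ s : ℝ, HasDerivAt (fun s : ℝ => p + s • v) v s := fun s => by
    simpa using ((hasDerivAt_id s).smul_const v).const_add p
  have := (convex_Icc (0:ℝ) 1).norm_image_sub_le_of_norm_hasDerivWithin_le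
    (f := fun s : ℝ => f (p + s • v) - s * fderiv ℝ f p v
      - s ^ 2 * (fderiv ℝ (fderiv ℝ f) p v v / 2))
    (f' := fun s : ℝ => fderiv ℝ f (p + s • v) v - fderiv ℝ f p v
      - s * fderiv ℝ (fderiv ℝ f) p v v) (C := ε * ‖v‖ ^ 2) (x := 0) (y := 1)
    (fun s hs' => ?_) (fun s hs' => ?_) (by simp) (by simp)
  · simp only [one_smul, zero_smul, add_zero, Real.norm_eq_abs] at this
    rw [sub_zero, abs_one, mul_one] at this
    refine le_of_eq_of_le (congrArg abs ?_) this
    ring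
  · have a1 := (hdf _ ((hs s hs').trans hv)).comp_hasDerivAt s (hline s)
    have a2 := (hasDerivAt_id s).mul_const (fderiv ℝ f p v)
    have a3 := (hasDerivAt_pow 2 s).mul_const (fderiv ℝ (fderiv ℝ f) p v v / 2)
    refine (((a1.sub a2).sub a3).congr_deriv ?_).hasDerivWithinAt
    simp; ring
  · have b := hG (s • v) ((hs s hs').trans hv)
    have c := (fderiv ℝ f (p + s • v) - fderiv ℝ f p
      - fderiv ℝ (fderiv ℝ f) p (s • v)).le_of_opNorm_le b v
    simp only [sub_apply, map_smul, smul_apply,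
      smul_eq_mul] at c
    refine c.trans ?_
    have := mul_le_mul_of_nonneg_right (mul_le_mul_of_nonneg_left (hs s hs') hε.le)
      (norm_nonneg v)
    linarith [sq ‖v‖, mul_assoc ε ‖v‖ ‖v‖]

lemma exists_bound_fderiv_two {f : E → ℝ} {Ω K : Set E} (hΩ : IsOpen Ω)
    (hf : ContDiffOn ℝ 2 f Ω) (hK : IsCompact K) (hKΩ : K ⊆ Ω) :
    ∃ C > 0, ∀ p ∈ K, ∀ v w : E, |fderiv ℝ (fderiv ℝ f) p v w| ≤ C * ‖v‖ * ‖w‖ := by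
  have hf1 : ContDiffOn ℝ 1 (fderiv ℝ f) Ω := hf.fderiv_of_isOpen hΩ (by norm_num)
  have hf2 : ContinuousOn (fderiv ℝ (fderiv ℝ f)) Ω :=
    hf1.continuousOn_fderiv_of_isOpen hΩ le_rfl
  obtain ⟨C, hC⟩ := hK.exists_bound_of_continuousOn (E := E →L[ℝ] E →L[ℝ] ℝ) (hf2.mono hKΩ)
  refine ⟨|C| + 1, by positivity, fun p hp v w => ?_⟩
  refine ((fderiv ℝ (fderiv ℝ f) p v).le_opNorm w).trans
    (mul_le_mul_of_nonneg_right ?_ (norm_nonneg _))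
  refine ((fderiv ℝ (fderiv ℝ f) p).le_opNorm v).trans
    (mul_le_mul_of_nonneg_right ?_ (norm_nonneg _))
  linarith [hC p hp, le_abs_self C]

lemma exists_taylor_one {f : E → ℝ} {Ω K : Set E} (hΩ : IsOpen Ω) (hf : ContDiffOn ℝ 2 f Ω)
    (hK : IsCompact K) (hKΩ : K ⊆ Ω) :
    ∃ C > 0, ∃ δ > 0, ∀ p ∈ K, ∀ v : E, ‖v‖ ≤ δ → p + v ∈ Ω ∧
      |f (p + v) - f p - fderiv ℝ f p v| ≤ C * ‖v‖ ^ 2 := by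
  obtain ⟨C, hC, h1⟩ := exists_bound_fderiv_two hΩ hf hK hKΩ
  obtain ⟨δ, hδ, h2⟩ := exists_taylor_two hΩ hf hK hKΩ one_pos
  refine ⟨1 + C, by positivity, δ, hδ, fun p hp v hv => ⟨(h2 p hp v hv).1, ?_⟩⟩
  have a := (h2 p hp v hv).2
  have b := h1 p hp v v
  rw [abs_le] at a b ⊢
  constructor <;> nlinarith [a.1, a.2, b.1, b.2, mul_nonneg hC.le (sq_nonneg ‖v‖)]

lemma fderiv_fderiv_apply {f : E → ℝ} {p : E} (h : DifferentiableAt ℝ (fderiv ℝ f) p) (a b : E) :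
    fderiv ℝ (fun q => fderiv ℝ f q a) p b = fderiv ℝ (fderiv ℝ f) p b a := by
  rw [fderiv_clm_apply h (differentiableAt_const a)]
  simp

/-- Directional derivatives commute. -/
lemma fderiv_apply_comm {f : E → ℝ} {Ω : Set E} (hΩ : IsOpen Ω) (hf : ContDiffOn ℝ 2 f Ω)
    {p : E} (hp : p ∈ Ω) (a b : E) :
    fderiv ℝ (fun q => fderiv ℝ f q a) p b = fderiv ℝ (fun q => fderiv ℝ f q b) p a := by
  have hf1 : ContDiffOn ℝ 1 (fderiv ℝ f) Ω := hf.fderiv_of_isOpen hΩ (by norm_num)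
  have hd := (hf1.differentiableOn one_ne_zero).differentiableAt (hΩ.mem_nhds hp)
  rw [fderiv_fderiv_apply hd, fderiv_fderiv_apply hd]
  exact (hf.contDiffAt (hΩ.mem_nhds hp)).isSymmSndFDerivAt (by simp) _ _

end Taylor

lemma bilin_circle (D : ℂ × ℝ →L[ℝ] ℂ × ℝ →L[ℝ] ℝ) (ρ : ℂ) :
    D (ρ, 0) (ρ, 0) + D (Complex.I * ρ, 0) (Complex.I * ρ, 0) =
      ‖ρ‖ ^ 2 * (D (1, 0) (1, 0) + D (Complex.I, 0) (Complex.I, 0)) := by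
  have h1 : ((ρ, 0) : ℂ × ℝ) = ρ.re • ((1, 0) : ℂ × ℝ) + ρ.im • ((Complex.I, 0) : ℂ × ℝ) := by
    ext <;> simp
  have h2 : ((Complex.I * ρ, 0) : ℂ × ℝ) =
      (-ρ.im) • ((1, 0) : ℂ × ℝ) + ρ.re • ((Complex.I, 0) : ℂ × ℝ) :=
    Prod.ext (Complex.ext (by simp) (by simp)) (by simp)
  rw [h1, h2, ← Complex.normSq_eq_norm_sq, Complex.normSq_apply]
  simp only [map_add, map_smul, add_apply, smul_apply,
    smul_eq_mul]
  ring

/-- Second order expansion of the mean over the vertices of a small square, slightly earlier in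
time. -/
lemma exists_four_point {f : ℂ × ℝ → ℝ} {Ω K : Set (ℂ × ℝ)} (hΩ : IsOpen Ω)
    (hf : ContDiffOn ℝ 2 f Ω) (hK : IsCompact K) (hKΩ : K ⊆ Ω) {κ ε : ℝ} (hκ : 0 < κ)
    (hε : 0 < ε) : ∃ δ > 0, ∀ p ∈ K, ∀ (ρ : ℂ) (τ : ℝ), ‖ρ‖ ≤ δ → 0 ≤ τ → τ ≤ κ * ‖ρ‖ ^ 2 →
      |f (p + (ρ, -τ)) + f (p + (Complex.I * ρ, -τ)) + f (p + (-ρ, -τ))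
        + f (p + (-(Complex.I * ρ), -τ)) - 4 * f p + 4 * τ * fderiv ℝ f p (0, 1)
        - ‖ρ‖ ^ 2 * (fderiv ℝ (fderiv ℝ f) p (1, 0) (1, 0)
          + fderiv ℝ (fderiv ℝ f) p (Complex.I, 0) (Complex.I, 0))| ≤ ε * ‖ρ‖ ^ 2 := by
  obtain ⟨C, hC, hb⟩ := exists_bound_fderiv_two hΩ hf hK hKΩ
  obtain ⟨δ, hδ, ht⟩ := exists_taylor_two hΩ hf hK hKΩ (show 0 < ε / 8 by positivity)
  refine ⟨min (min δ 1) (min (1 / κ) (ε / (4 * C * κ ^ 2))), by positivity, ?_⟩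
  intro p hp ρ τ hρ hτ0 hτ
  have hρδ : ‖ρ‖ ≤ δ := hρ.trans ((min_le_left _ _).trans (min_le_left _ _))
  have hρ1 : ‖ρ‖ ≤ 1 := hρ.trans ((min_le_left _ _).trans (min_le_right _ _))
  have hρ2 : ‖ρ‖ ≤ 1 / κ := hρ.trans ((min_le_right _ _).trans (min_le_left _ _))
  have hρ3 : ‖ρ‖ ≤ ε / (4 * C * κ ^ 2) := hρ.trans ((min_le_right _ _).trans (min_le_right _ _))
  have hρ0 := norm_nonneg ρ
  rw [le_div_iff₀ hκ] at hρ2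
  rw [le_div_iff₀ (by positivity)] at hρ3
  have hτρ : τ ≤ ‖ρ‖ := hτ.trans (by nlinarith)
  have hn : ∀ w : ℂ, ‖w‖ = ‖ρ‖ → ‖((w, -τ) : ℂ × ℝ)‖ = ‖ρ‖ := fun w hw => by
    rw [Prod.norm_def]; simp only [hw, norm_neg, Real.norm_of_nonneg hτ0]
    exact max_eq_left hτρ
  set D := fderiv ℝ (fderiv ℝ f) p with hD
  have hexp : ∀ w : ℂ, ((w, -τ) : ℂ × ℝ) = (w, 0) + (-τ) • ((0, 1) : ℂ × ℝ) := fun w => by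
    ext <;> simp
  have e1 := (ht p hp (ρ, -τ) (by rw [hn _ rfl]; exact hρδ)).2
  have e2 := (ht p hp (Complex.I * ρ, -τ) (by rw [hn _ (by simp)]; exact hρδ)).2
  have e3 := (ht p hp (-ρ, -τ) (by rw [hn _ (by simp)]; exact hρδ)).2
  have e4 := (ht p hp (-(Complex.I * ρ), -τ) (by rw [hn _ (by simp)]; exact hρδ)).2
  rw [hn _ (by simp)] at e1 e2 e3 e4
  have hcirc := bilin_circle D ρ
  have hbtt : |D (0, 1) (0, 1)| ≤ C := by
    have := hb p hp (0, 1) (0, 1)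
    simpa [Prod.norm_def] using this
  have hneg : ∀ w : ℂ, ((-w, 0) : ℂ × ℝ) = -(w, 0) := fun w => by ext <;> simp
  rw [hexp ρ] at e1
  rw [hexp (Complex.I * ρ)] at e2
  rw [hexp (-ρ), hneg] at e3
  rw [hexp (-(Complex.I * ρ)), hneg] at e4
  rw [hexp ρ, hexp (Complex.I * ρ), hexp (-ρ), hexp (-(Complex.I * ρ)), hneg, hneg]
  simp only [map_add, map_smul, map_neg, add_apply,
    smul_apply, neg_apply, smul_eq_mul, ← hD]
    at e1 e2 e3 e4 ⊢
  rw [← hcirc]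
  have hτ2 : τ ^ 2 * C ≤ ε / 4 * ‖ρ‖ ^ 2 := by
    have h1 : τ ^ 2 ≤ (κ * ‖ρ‖ ^ 2) ^ 2 := pow_le_pow_left₀ hτ0 hτ 2
    have h2 : ‖ρ‖ ^ 2 ≤ ‖ρ‖ := by nlinarith
    have h3 : C * κ ^ 2 * ‖ρ‖ ^ 2 ≤ ε / 4 := by
      have := mul_le_mul_of_nonneg_left h2 (show 0 ≤ C * κ ^ 2 by positivity)
      linarith
    calc τ ^ 2 * C ≤ (κ * ‖ρ‖ ^ 2) ^ 2 * C := mul_le_mul_of_nonneg_right h1 hC.le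
      _ = (C * κ ^ 2 * ‖ρ‖ ^ 2) * ‖ρ‖ ^ 2 := by ring
      _ ≤ _ := mul_le_mul_of_nonneg_right h3 (by positivity)
  have hbtt2 : |τ ^ 2 * D (0, 1) (0, 1)| ≤ ε / 4 * ‖ρ‖ ^ 2 := by
    rw [abs_mul, abs_of_nonneg (sq_nonneg τ)]
    exact (mul_le_mul_of_nonneg_left hbtt (sq_nonneg _)).trans hτ2
  rw [abs_le] at e1 e2 e3 e4 hbtt2 ⊢
  constructor <;> linarith [e1.1, e1.2, e2.1, e2.2, e3.1, e3.2, e4.1, e4.2, hbtt2.1, hbtt2.2]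

/-- A complete solution of the logarithmic fast diffusion equation on `ℂ × (0,T)`. -/
structure IsFlow (T : ℝ) (u : ℂ → ℝ → ℝ) : Prop where
  pos : ∀ z : ℂ, ∀ t ∈ Ioo (0:ℝ) T, 0 < u z t
  smooth : ContDiffOn ℝ (⊤ : ℕ∞) (fun p : ℂ × ℝ => u p.1 p.2) ((univ : Set ℂ) ×ˢ Ioo (0:ℝ) T)
  lfde : ∀ z : ℂ, ∀ t ∈ Ioo (0:ℝ) T, deriv (u z) t = lap (fun w => Real.log (u w t)) z
  complete : ∀ t ∈ Ioo (0:ℝ) T, ConfComplete (fun z => u z t) univ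

/-- The logarithm of a conformal factor as a function on space-time. -/
noncomputable def logFactor (u : ℂ → ℝ → ℝ) (p : ℂ × ℝ) : ℝ := Real.log (u p.1 p.2)

/-- The time derivative of the logarithm of the conformal factor. -/
noncomputable def logSpeed (u : ℂ → ℝ → ℝ) (p : ℂ × ℝ) : ℝ := fderiv ℝ (logFactor u) p (0, 1)

lemma isOpen_spacetime (T : ℝ) : IsOpen ((univ : Set ℂ) ×ˢ Ioo (0:ℝ) T) :=
  isOpen_univ.prod isOpen_Ioo

lemma two_le_smooth : (2 : WithTop ℕ∞) ≤ ((⊤ : ℕ∞) : WithTop ℕ∞) :=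
  WithTop.coe_le_coe.2 (le_top : (2 : ℕ∞) ≤ ⊤)

section slices

variable {F : Type*} [NormedAddCommGroup F] [NormedSpace ℝ F]

lemma hasFDerivAt_space_slice {f : ℂ × ℝ → F} {z : ℂ} {t : ℝ}
    (hf : DifferentiableAt ℝ f (z, t)) :
    HasFDerivAt (fun w => f (w, t)) ((fderiv ℝ f (z, t)).comp (.inl ℝ ℂ ℝ)) z := by
  exact hf.hasFDerivAt.comp z (hasFDerivAt_prodMk_left z t)

lemma hasDerivAt_time_slice {f : ℂ × ℝ → F} {z : ℂ} {t : ℝ}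
    (hf : DifferentiableAt ℝ f (z, t)) :
    HasDerivAt (fun s => f (z, s)) (fderiv ℝ f (z, t) (0, 1)) t := by
  have := (hf.hasFDerivAt.comp t (hasFDerivAt_prodMk_right z t)).hasDerivAt
  simpa [Function.comp_def] using this

lemma iteratedFDeriv_space_slice {f : ℂ × ℝ → F} {Ω : Set (ℂ × ℝ)} (hΩ : IsOpen Ω)
    (hf : ContDiffOn ℝ 2 f Ω) {z : ℂ} {t : ℝ} (h : (z, t) ∈ Ω) (e : ℂ) :
    iteratedFDeriv ℝ 2 (fun w => f (w, t)) z ![e, e] =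
      fderiv ℝ (fderiv ℝ f) (z, t) (e, 0) (e, 0) := by
  rw [iteratedFDeriv_two_apply]
  simp only [Matrix.cons_val_zero, Matrix.cons_val_one]
  have hf1 : ContDiffOn ℝ 1 (fderiv ℝ f) Ω := hf.fderiv_of_isOpen hΩ (by norm_num)
  have hev : fderiv ℝ (fun w => f (w, t)) =ᶠ[nhds z]
      fun w => (fderiv ℝ f (w, t)).comp (.inl ℝ ℂ ℝ) := by
    have : ∀ᶠ w in nhds z, (w, t) ∈ Ω :=
      (by fun_prop : ContinuousAt (fun w : ℂ => (w, t)) z).eventually (hΩ.mem_nhds h)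
    filter_upwards [this] with w hw
    exact (hasFDerivAt_space_slice
      ((hf.differentiableOn two_ne_zero).differentiableAt (hΩ.mem_nhds hw))).fderiv
  rw [hev.fderiv_eq]
  have hd := hasFDerivAt_space_slice
    ((hf1.differentiableOn one_ne_zero).differentiableAt (hΩ.mem_nhds h))
  rw [(hd.clm_comp (hasFDerivAt_const _ _)).fderiv]
  simp

end slices

namespace IsFlow

variable {T : ℝ} {u : ℂ → ℝ → ℝ}

lemma smooth_logFactor (h : IsFlow T u)
    : ContDiffOn ℝ (⊤ : ℕ∞) (logFactor u) ((univ : Set ℂ) ×ˢ Ioo (0:ℝ) T) :=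
  h.smooth.log fun p hp => (h.pos p.1 p.2 hp.2).ne'

lemma smooth_fderiv_logFactor (h : IsFlow T u) (e : ℂ × ℝ) :
    ContDiffOn ℝ (⊤ : ℕ∞) (fun p => fderiv ℝ (logFactor u) p e)
      ((univ : Set ℂ) ×ˢ Ioo (0:ℝ) T) :=
  (h.smooth_logFactor.fderiv_of_isOpen (isOpen_spacetime T) (by simp)).clm_apply contDiffOn_const

lemma smooth_logSpeed (h : IsFlow T u)
    : ContDiffOn ℝ (⊤ : ℕ∞) (logSpeed u) ((univ : Set ℂ) ×ˢ Ioo (0:ℝ) T) :=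
  h.smooth_fderiv_logFactor (0, 1)

lemma differentiableAt {f : ℂ × ℝ → ℝ} (hf : ContDiffOn ℝ (⊤ : ℕ∞) f
    ((univ : Set ℂ) ×ˢ Ioo (0:ℝ) T)) {p : ℂ × ℝ} (hp : p ∈ (univ : Set ℂ) ×ˢ Ioo (0:ℝ) T) :
    DifferentiableAt ℝ f p :=
  (hf.differentiableOn (by simp)).differentiableAt ((isOpen_spacetime T).mem_nhds hp)

lemma fderiv_factor (h : IsFlow T u)
    {p : ℂ × ℝ} (hp : p ∈ (univ : Set ℂ) ×ˢ Ioo (0:ℝ) T) (e : ℂ × ℝ) :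
    fderiv ℝ (fun p : ℂ × ℝ => u p.1 p.2) p e = u p.1 p.2 * fderiv ℝ (logFactor u) p e := by
  have := (differentiableAt h.smooth hp).hasFDerivAt.log (h.pos p.1 p.2 hp.2).ne'
  have h2 : fderiv ℝ (logFactor u) p = _ := this.fderiv
  rw [h2]
  have := (h.pos p.1 p.2 hp.2).ne'
  simp [this]

lemma hasDerivAt_time (h : IsFlow T u) {z : ℂ} {t : ℝ} (ht : t ∈ Ioo (0:ℝ) T) :
    HasDerivAt (u z) (u z t * logSpeed u (z, t)) t := by
  have hp : (z, t) ∈ (univ : Set ℂ) ×ˢ Ioo (0:ℝ) T := ⟨mem_univ _, ht⟩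
  have := hasDerivAt_time_slice (differentiableAt h.smooth hp)
  rwa [h.fderiv_factor hp] at this

lemma lap_logFactor (h : IsFlow T u) {p : ℂ × ℝ} (hp : p ∈ (univ : Set ℂ) ×ˢ Ioo (0:ℝ) T) :
    fderiv ℝ (fderiv ℝ (logFactor u)) p (1, 0) (1, 0) +
      fderiv ℝ (fderiv ℝ (logFactor u)) p (Complex.I, 0) (Complex.I, 0) =
      u p.1 p.2 * logSpeed u p := by
  have h1 := h.lfde p.1 p.2 hp.2
  have h2 : ContDiffOn ℝ 2 (logFactor u) _ := h.smooth_logFactor.of_le two_le_smooth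
  rw [(h.hasDerivAt_time hp.2).deriv, lap] at h1
  have e1 := iteratedFDeriv_space_slice (isOpen_spacetime T) h2 hp 1
  have e2 := iteratedFDeriv_space_slice (isOpen_spacetime T) h2 hp Complex.I
  simp only [logFactor] at e1 e2
  rw [e1, e2] at h1
  exact h1.symm

lemma lap_logSpeed (h : IsFlow T u) {p : ℂ × ℝ} (hp : p ∈ (univ : Set ℂ) ×ˢ Ioo (0:ℝ) T) :
    fderiv ℝ (fderiv ℝ (logSpeed u)) p (1, 0) (1, 0) +
      fderiv ℝ (fderiv ℝ (logSpeed u)) p (Complex.I, 0) (Complex.I, 0) =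
      u p.1 p.2 * logSpeed u p ^ 2 + u p.1 p.2 * fderiv ℝ (logSpeed u) p (0, 1) := by
  set Ω := (univ : Set ℂ) ×ˢ Ioo (0:ℝ) T
  have hΩ : IsOpen Ω := isOpen_spacetime T
  have sm : ∀ {f : ℂ × ℝ → ℝ}, ContDiffOn ℝ (⊤ : ℕ∞) f Ω → ∀ e, ContDiffOn ℝ (⊤ : ℕ∞)
      (fun p => fderiv ℝ f p e) Ω := fun hf e =>
    (hf.fderiv_of_isOpen hΩ (by simp)).clm_apply contDiffOn_const
  have dd : ∀ {f : ℂ × ℝ → ℝ}, ContDiffOn ℝ (⊤ : ℕ∞) f Ω → ∀ q ∈ Ω, ∀ e,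
      fderiv ℝ (fderiv ℝ f) q e e = fderiv ℝ (fun q => fderiv ℝ f q e) q e := fun hf q hq e => by
    refine (fderiv_fderiv_apply ?_ e e).symm
    exact ((hf.fderiv_of_isOpen hΩ (m := 1) (by simpa [one_add_one_eq_two] using two_le_smooth)).differentiableOn
      one_ne_zero).differentiableAt (hΩ.mem_nhds hq)
  have key : ∀ e : ℂ × ℝ, fderiv ℝ (fun q => fderiv ℝ (fun q => fderiv ℝ (logFactor u) q e) q e)
      p (0, 1) = fderiv ℝ (fun q => fderiv ℝ (logSpeed u) q e) p e := by
    intro e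
    rw [fderiv_apply_comm hΩ ((sm h.smooth_logFactor e).of_le two_le_smooth) hp]
    refine congrArg (fun L : ℂ × ℝ →L[ℝ] ℝ => L e) (Filter.EventuallyEq.fderiv_eq ?_)
    filter_upwards [hΩ.mem_nhds hp] with q hq
    rw [fderiv_apply_comm hΩ (h.smooth_logFactor.of_le two_le_smooth) hq]
    rfl
  have hL := h.smooth_logFactor
  rw [dd h.smooth_logSpeed p hp, dd h.smooth_logSpeed p hp, ← key, ← key,
    ← add_apply, ← fderiv_add (differentiableAt (sm (sm hL _) _) hp)
      (differentiableAt (sm (sm hL _) _) hp)]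
  have hev : ((fun q => fderiv ℝ (fun q => fderiv ℝ (logFactor u) q (1, 0)) q (1, 0)) +
      fun q => fderiv ℝ (fun q => fderiv ℝ (logFactor u) q (Complex.I, 0)) q (Complex.I, 0))
      =ᶠ[nhds p] fun q => u q.1 q.2 * logSpeed u q := by
    filter_upwards [hΩ.mem_nhds hp] with q hq
    rw [← h.lap_logFactor hq, dd hL q hq, dd hL q hq]
    rfl
  rw [hev.fderiv_eq]
  have := ((differentiableAt h.smooth hp).hasFDerivAt.mul
    (differentiableAt h.smooth_logSpeed hp).hasFDerivAt).fderiv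
  refine (congrArg (fun L : ℂ × ℝ →L[ℝ] ℝ => L (0, 1)) this).trans ?_
  simp only [add_apply, smul_apply, smul_eq_mul, h.fderiv_factor hp]
  simp only [logSpeed]
  ring

end IsFlow

lemma eventually_mul_le (c : ℝ) {d : ℝ} (hd : 0 < d) :
    ∀ᶠ x in nhdsWithin (0:ℝ) (Ioi 0), c * x ≤ d := by
  have : Tendsto (fun x : ℝ => c * x) (nhdsWithin 0 (Ioi 0)) (nhds 0) :=
    tendsto_nhdsWithin_of_tendsto_nhds (by simpa using (continuous_const_mul c).tendsto 0)
  exact (this.eventually (gt_mem_nhds hd)).mono fun _ h => h.le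

lemma abs_log_norm_one_sub_add_re_le {y : ℂ} (hy : ‖y‖ ≤ 1 / 2) :
    |Real.log ‖1 - y‖ + y.re| ≤ ‖y‖ ^ 2 := by
  have h := Complex.norm_log_one_add_sub_self_le (z := -y) (by rw [norm_neg]; linarith)
  have h2 := (Complex.abs_re_le_norm _).trans h
  rw [Complex.sub_re, Complex.log_re, norm_neg, ← sub_eq_add_neg, Complex.neg_re,
    sub_neg_eq_add] at h2
  refine h2.trans ?_
  have : (1 - ‖y‖)⁻¹ ≤ 2 := by
    rw [inv_le_comm₀ (by linarith) (by norm_num)]; linarith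
  have := mul_le_mul_of_nonneg_left this (sq_nonneg ‖y‖)
  linarith

lemma sum_log_norm_one_sub_le {y : ℂ} (hy : ‖y‖ ≤ 1 / 2) :
    Real.log ‖1 - y‖ + Real.log ‖1 - Complex.I * y‖ + Real.log ‖1 - -y‖
      + Real.log ‖1 - -(Complex.I * y)‖ ≤ ‖y‖ ^ 4 := by
  have hne : ∀ w : ℂ, ‖w‖ = ‖y‖ → ‖1 - w‖ ≠ 0 := fun w hw h => by
    rw [norm_eq_zero, sub_eq_zero] at h
    rw [← h, norm_one] at hw
    linarith
  have n1 := hne y rfl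
  have n2 := hne (Complex.I * y) (by simp)
  have n3 := hne (-y) (by simp)
  have n4 := hne (-(Complex.I * y)) (by simp)
  rw [← Real.log_mul n1 n2, ← Real.log_mul (mul_ne_zero n1 n2) n3,
    ← Real.log_mul (mul_ne_zero (mul_ne_zero n1 n2) n3) n4, ← norm_mul, ← norm_mul, ← norm_mul]
  have e : (1 - y) * (1 - Complex.I * y) * (1 - -y) * (1 - -(Complex.I * y)) = 1 - y ^ 4 := by
    linear_combination (y ^ 4 - y ^ 2) * Complex.I_sq
  have hle : ‖1 - y ^ 4‖ ≤ 1 + ‖y‖ ^ 4 := by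
    have := norm_sub_le (1:ℂ) (y ^ 4)
    rwa [norm_one, norm_pow] at this
  have := Real.log_le_sub_one_of_pos (x := ‖1 - y ^ 4‖) (by
    rw [← e, norm_mul, norm_mul, norm_mul]
    positivity)
  rw [e]
  linarith

lemma abs_half_sub_half_add_le {a b c A B C : ℝ} (ha : |a| ≤ A) (hb : |b| ≤ B) (hc : |c| ≤ C) :
    |a / 2 - b / 2 + c| ≤ A / 2 + B / 2 + C := by
  rw [abs_le] at *
  constructor <;> linarith

/-- The complex number representing half the spatial gradient of the logarithm of the factor. -/
noncomputable def logGrad (u : ℂ → ℝ → ℝ) (p : ℂ × ℝ) : ℂ :=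
  ⟨fderiv ℝ (logFactor u) p (1, 0) / 2, -(fderiv ℝ (logFactor u) p (Complex.I, 0) / 2)⟩

/-- The length density of the displacement of a path by a transported vector `ρ`, with the time
shifted accordingly. -/
noncomputable def lengthDensity (u : ℂ → ℝ → ℝ) (p : ℂ × ℝ) (ρ : ℂ) : ℝ :=
  Real.sqrt (u (p.1 + ρ) (p.2 - u p.1 p.2 * ‖ρ‖ ^ 2 / 4)) * ‖1 - logGrad u p * ρ‖

lemma logGrad_mul_re (u : ℂ → ℝ → ℝ) (p : ℂ × ℝ) (ρ : ℂ) :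
    (logGrad u p * ρ).re = fderiv ℝ (logFactor u) p (ρ, 0) / 2 := by
  have h1 : ((ρ, 0) : ℂ × ℝ) = ρ.re • ((1, 0) : ℂ × ℝ) + ρ.im • ((Complex.I, 0) : ℂ × ℝ) := by
    ext <;> simp
  rw [h1, map_add, map_smul, map_smul, Complex.mul_re]
  simp only [logGrad, smul_eq_mul]
  ring

namespace IsFlow

variable {T : ℝ} {u : ℂ → ℝ → ℝ}

lemma continuousOn_logGrad (h : IsFlow T u) :
    ContinuousOn (logGrad u) ((univ : Set ℂ) ×ˢ Ioo (0:ℝ) T) := by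
  have h1 := (h.smooth_fderiv_logFactor (1, 0)).continuousOn
  have h2 := (h.smooth_fderiv_logFactor (Complex.I, 0)).continuousOn
  have : ContinuousOn (fun p => ((fderiv ℝ (logFactor u) p (1, 0) / 2 : ℝ) : ℂ) +
      ((-(fderiv ℝ (logFactor u) p (Complex.I, 0) / 2) : ℝ) : ℂ) * Complex.I)
      ((univ : Set ℂ) ×ˢ Ioo (0:ℝ) T) :=
    (Complex.continuous_ofReal.comp_continuousOn (h1.div_const 2)).add
      ((Complex.continuous_ofReal.comp_continuousOn (h2.div_const 2).neg).mul continuousOn_const)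
  refine this.congr fun p _ => ?_
  simp only
  rw [← Complex.mk_eq_add_mul_I]
  rfl

lemma sqrt_eq_exp (h : IsFlow T u) {p : ℂ × ℝ} (hp : p ∈ (univ : Set ℂ) ×ˢ Ioo (0:ℝ) T) :
    Real.sqrt (u p.1 p.2) = Real.exp (logFactor u p / 2) := by
  rw [logFactor, Real.sqrt_eq_rpow, Real.rpow_def_of_pos (h.pos _ _ hp.2)]
  congr 1; ring

set_option maxHeartbeats 2000000 in
/-- First order control of a single length density and second order control of the sum over the
vertices of a square. -/
theorem exists_lengthDensity_le (h : IsFlow T u) {K : Set (ℂ × ℝ)} (hK : IsCompact K)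
    (hKΩ : K ⊆ (univ : Set ℂ) ×ˢ Ioo (0:ℝ) T) {ε : ℝ} (hε : 0 < ε) :
    ∃ δ > 0, ∀ p ∈ K, ∀ ρ : ℂ, ‖ρ‖ ≤ δ →
      |lengthDensity u p ρ - Real.sqrt (u p.1 p.2)| ≤ ε * ‖ρ‖ * Real.sqrt (u p.1 p.2) ∧
      lengthDensity u p ρ + lengthDensity u p (Complex.I * ρ) + lengthDensity u p (-ρ)
        + lengthDensity u p (-(Complex.I * ρ)) ≤ (4 + ε * ‖ρ‖ ^ 2) * Real.sqrt (u p.1 p.2) := by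
  set Ω := (univ : Set ℂ) ×ˢ Ioo (0:ℝ) T
  have hΩ : IsOpen Ω := isOpen_spacetime T
  have hΦ : ContDiffOn ℝ 2 (logFactor u) Ω := h.smooth_logFactor.of_le two_le_smooth
  obtain ⟨M₁, hM₁⟩ := hK.exists_bound_of_continuousOn (h.smooth.continuousOn.mono hKΩ)
  obtain ⟨M₂, hM₂⟩ := hK.exists_bound_of_continuousOn (h.smooth_logSpeed.continuousOn.mono hKΩ)
  obtain ⟨M₃, hM₃⟩ := hK.exists_bound_of_continuousOn (h.continuousOn_logGrad.mono hKΩ)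
  set M := |M₁| + |M₂| + |M₃| + 1
  have hM : 0 < M := by positivity
  have bu : ∀ p ∈ K, u p.1 p.2 ≤ M := fun p hp => by
    have := (le_abs_self _).trans (hM₁ p hp)
    simp only [M]; linarith [le_abs_self M₁, abs_nonneg M₂, abs_nonneg M₃]
  have bQ : ∀ p ∈ K, |logSpeed u p| ≤ M := fun p hp => by
    have := hM₂ p hp
    rw [Real.norm_eq_abs] at this
    simp only [M]; linarith [le_abs_self M₂, abs_nonneg M₁, abs_nonneg M₃]
  have bq : ∀ p ∈ K, ‖logGrad u p‖ ≤ M := fun p hp => by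
    have := hM₃ p hp
    simp only [M]; linarith [le_abs_self M₃, abs_nonneg M₁, abs_nonneg M₂]
  obtain ⟨C, hC, δ₁, hδ₁, ht1⟩ := exists_taylor_one hΩ hΦ hK hKΩ
  obtain ⟨δ₂, hδ₂, ht2⟩ := exists_four_point hΩ hΦ hK hKΩ (κ := M) hM hε
  set C₁ := C / 2 + M ^ 2 / 8 + M ^ 2
  have hC₁ : 0 < C₁ := by positivity
  have hpos0 : ∀ᶠ x : ℝ in nhdsWithin 0 (Ioi 0), 0 < x := self_mem_nhdsWithin
  obtain ⟨δ, hδ0, d1, d2, d3, d4, d5, d6, d7⟩ := (hpos0.and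
    ((eventually_mul_le 1 hδ₁).and ((eventually_mul_le 1 hδ₂).and
    ((eventually_mul_le M (show (0:ℝ) < 1/2 by norm_num)).and ((eventually_mul_le 1 one_pos).and
    ((eventually_mul_le (2 * C₁) (lt_min one_pos hε)).and
    ((eventually_mul_le (4 * C₁ ^ 2) (show 0 < ε / 4 by positivity)).and
    (eventually_mul_le (M ^ 4) (show 0 < ε / 4 by positivity))))))))).exists
  refine ⟨δ, hδ0, fun p hp ρ hρ => ?_⟩
  have hpΩ := hKΩ hp
  have hu0 := h.pos p.1 p.2 hpΩ.2
  set τ := u p.1 p.2 * ‖ρ‖ ^ 2 / 4 with hτ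
  have hρ0 := norm_nonneg ρ
  have hρ1 : ‖ρ‖ ≤ 1 := by linarith
  have hρ2 : ‖ρ‖ ^ 2 ≤ δ * ‖ρ‖ := by nlinarith
  have hρ3 : ‖ρ‖ ^ 2 ≤ δ := by nlinarith
  have hτ0 : 0 ≤ τ := by positivity
  have hτM : τ ≤ M / 4 * ‖ρ‖ ^ 2 := by
    have := mul_le_mul_of_nonneg_right (bu p hp) (sq_nonneg ‖ρ‖)
    rw [hτ]; linarith
  have hτρ : τ ≤ ‖ρ‖ := hτM.trans (by nlinarith)
  -- the logarithm of the ratio of the densities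
  let e : ℂ → ℝ := fun w =>
    (logFactor u (p + (w, -τ)) - logFactor u p) / 2 + Real.log ‖1 - logGrad u p * w‖
  have hy : ∀ w : ℂ, ‖w‖ = ‖ρ‖ → ‖logGrad u p * w‖ ≤ M * ‖ρ‖ := fun w hw => by
    rw [norm_mul, hw]; exact mul_le_mul_of_nonneg_right (bq p hp) hρ0
  have hMρ : M * ‖ρ‖ ≤ 1 / 2 := (mul_le_mul_of_nonneg_left hρ hM.le).trans d3
  have hn : ∀ w : ℂ, ‖w‖ = ‖ρ‖ → ‖((w, -τ) : ℂ × ℝ)‖ = ‖ρ‖ := fun w hw => by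
    rw [Prod.norm_def]; simp only [hw, norm_neg, Real.norm_of_nonneg hτ0]
    exact max_eq_left hτρ
  have hdens : ∀ w : ℂ, ‖w‖ = ‖ρ‖ →
      lengthDensity u p w = Real.sqrt (u p.1 p.2) * Real.exp (e w) := by
    intro w hw
    have hmem := (ht1 p hp (w, -τ) (by rw [hn w hw]; linarith)).1
    have hne : 0 < ‖1 - logGrad u p * w‖ := by
      rw [norm_pos_iff, sub_ne_zero]
      intro hh
      have := hy w hw
      rw [← hh, norm_one] at this
      linarith
    have h1 := h.sqrt_eq_exp hmem
    have h2 := h.sqrt_eq_exp hpΩ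
    simp only [Prod.fst_add, Prod.snd_add, ← sub_eq_add_neg] at h1
    rw [lengthDensity, hw, h1, h2, ← Real.exp_add, ← Real.exp_log hne, ← Real.exp_add]
    congr 1
    simp only [e]
    ring
  have hebd : ∀ w : ℂ, ‖w‖ = ‖ρ‖ → |e w| ≤ C₁ * ‖ρ‖ ^ 2 := by
    intro w hw
    have a1 := (ht1 p hp (w, -τ) (by rw [hn w hw]; linarith)).2
    rw [hn w hw] at a1
    have hexp : ((w, -τ) : ℂ × ℝ) = (w, 0) + (-τ) • ((0, 1) : ℂ × ℝ) := by ext <;> simp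
    have a2 : fderiv ℝ (logFactor u) p (w, -τ) =
        2 * (logGrad u p * w).re - τ * logSpeed u p := by
      rw [hexp, map_add, map_smul, logGrad_mul_re, smul_eq_mul, logSpeed]; ring
    have a3 := abs_log_norm_one_sub_add_re_le ((hy w hw).trans hMρ)
    have a4 : |τ * logSpeed u p| ≤ M / 4 * ‖ρ‖ ^ 2 * M := by
      rw [abs_mul, abs_of_nonneg hτ0]
      exact mul_le_mul hτM (bQ p hp) (abs_nonneg _) (by positivity)
    have a5 : ‖logGrad u p * w‖ ^ 2 ≤ M ^ 2 * ‖ρ‖ ^ 2 := by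
      rw [← mul_pow]
      exact pow_le_pow_left₀ (norm_nonneg _) (hy w hw) 2
    have a6 : e w = (logFactor u (p + (w, -τ)) - logFactor u p -
        fderiv ℝ (logFactor u) p (w, -τ)) / 2 - τ * logSpeed u p / 2 +
        (Real.log ‖1 - logGrad u p * w‖ + (logGrad u p * w).re) := by
      rw [a2]; simp only [e]; ring
    rw [a6]
    have a7 : C₁ * ‖ρ‖ ^ 2 = C * ‖ρ‖ ^ 2 / 2 + M / 4 * ‖ρ‖ ^ 2 * M / 2 + M ^ 2 * ‖ρ‖ ^ 2 := by
      simp only [C₁]; ring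
    rw [a7]
    exact abs_half_sub_half_add_le a1 a4 a3 |>.trans (by linarith only [a5])
  have hC₁ρ : C₁ * ‖ρ‖ ^ 2 ≤ 1 := by
    have := mul_le_mul_of_nonneg_left hρ3 hC₁.le
    linarith [min_le_left 1 ε]
  have hs0 := Real.sqrt_nonneg (u p.1 p.2)
  refine ⟨?_, ?_⟩
  · rw [hdens ρ rfl]
    have b1 := Real.abs_exp_sub_one_le ((hebd ρ rfl).trans hC₁ρ)
    have b2 : 2 * (C₁ * ‖ρ‖ ^ 2) ≤ ε * ‖ρ‖ := by
      have k1 := mul_le_mul_of_nonneg_left hρ2 (show 0 ≤ 2 * C₁ by positivity)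
      have k2 := mul_le_mul_of_nonneg_right (d5.trans (min_le_right 1 ε)) hρ0
      linarith only [k1, k2]
    have b3 : Real.sqrt (u p.1 p.2) * Real.exp (e ρ) - Real.sqrt (u p.1 p.2) =
        (Real.exp (e ρ) - 1) * Real.sqrt (u p.1 p.2) := by ring
    rw [b3, abs_mul, abs_of_nonneg hs0]
    refine mul_le_mul_of_nonneg_right ?_ hs0
    linarith only [b1, b2, hebd ρ rfl]
  · have i2 : ‖Complex.I * ρ‖ = ‖ρ‖ := by simp
    have i3 : ‖-ρ‖ = ‖ρ‖ := by simp
    have i4 : ‖-(Complex.I * ρ)‖ = ‖ρ‖ := by simp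
    rw [hdens ρ rfl, hdens _ i2, hdens _ i3, hdens _ i4]
    have hexp2 : ∀ w, ‖w‖ = ‖ρ‖ → Real.exp (e w) ≤ 1 + e w + C₁ ^ 2 * ‖ρ‖ ^ 4 := by
      intro w hw
      have c1 := Real.abs_exp_sub_one_sub_id_le ((hebd w hw).trans hC₁ρ)
      have c2 : (e w) ^ 2 ≤ (C₁ * ‖ρ‖ ^ 2) ^ 2 := sq_le_sq' (abs_le.1 (hebd w hw)).1
        (abs_le.1 (hebd w hw)).2
      have c3 := (abs_le.1 c1).2
      have c4 : (C₁ * ‖ρ‖ ^ 2) ^ 2 = C₁ ^ 2 * ‖ρ‖ ^ 4 := by ring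
      linarith
    have f1 := ht2 p hp ρ τ (by linarith) hτ0 (hτM.trans (by nlinarith [sq_nonneg ‖ρ‖]))
    rw [h.lap_logFactor hpΩ] at f1
    have f2 := sum_log_norm_one_sub_le ((hy ρ rfl).trans hMρ)
    have f3 : ‖logGrad u p * ρ‖ ^ 4 ≤ M ^ 4 * ‖ρ‖ ^ 4 := by
      rw [← mul_pow]
      exact pow_le_pow_left₀ (norm_nonneg _) (hy ρ rfl) 4
    have f4 : ‖ρ‖ ^ 4 ≤ δ * ‖ρ‖ ^ 2 := by
      have := mul_le_mul_of_nonneg_right hρ3 (sq_nonneg ‖ρ‖)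
      linarith [show ‖ρ‖ ^ 4 = ‖ρ‖ ^ 2 * ‖ρ‖ ^ 2 by ring]
    have f5 : e ρ + e (Complex.I * ρ) + e (-ρ) + e (-(Complex.I * ρ)) ≤
        ε / 2 * ‖ρ‖ ^ 2 + M ^ 4 * ‖ρ‖ ^ 4 := by
      have g1 : 4 * τ * logSpeed u p = ‖ρ‖ ^ 2 * (u p.1 p.2 * logSpeed u p) := by
        rw [hτ]; ring
      have g2 := (abs_le.1 f1).2
      have g3 : fderiv ℝ (logFactor u) p (0, 1) = logSpeed u p := rfl
      rw [g3, g1] at g2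
      have j1 : logGrad u p * (Complex.I * ρ) = Complex.I * (logGrad u p * ρ) := by ring
      have j3 : logGrad u p * (-(Complex.I * ρ)) = -(Complex.I * (logGrad u p * ρ)) := by ring
      simp only [e, j1, j3, mul_neg]
      linarith only [g2, f2, f3]
    have f6 := mul_le_mul_of_nonneg_right d6 (sq_nonneg ‖ρ‖)
    have f7 := mul_le_mul_of_nonneg_right d7 (sq_nonneg ‖ρ‖)
    have f8 := mul_le_mul_of_nonneg_left f4 (show 0 ≤ M ^ 4 by positivity)
    have f9 := mul_le_mul_of_nonneg_left f4 (show 0 ≤ 4 * C₁ ^ 2 by positivity)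
    rw [← mul_add, ← mul_add, ← mul_add, mul_comm]
    refine mul_le_mul_of_nonneg_right ?_ hs0
    linarith only [hexp2 ρ rfl, hexp2 _ i2, hexp2 _ i3, hexp2 _ i4, f5, f6, f7, f8, f9]

end IsFlow

namespace IsFlow

variable {T : ℝ} {u : ℂ → ℝ → ℝ}

lemma continuous_factor_slice (h : IsFlow T u)
    {t : ℝ} (ht : t ∈ Ioo (0:ℝ) T) : Continuous fun z => u z t :=
  continuous_slice h.smooth.continuousOn ht

/-- Parallel transport, along a path, of the unit vector at its end point: a complex multiplier
whose length in the metric is constant. -/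
lemma exists_transport (h : IsFlow T u)
    {t : ℝ} (ht : t ∈ Ioo (0:ℝ) T) {γ : ℝ → ℂ} (hγ : ContDiff ℝ 1 γ) :
    ∃ a : ℝ → ℂ, ContDiff ℝ 1 a ∧ a 1 = 1 ∧
      (∀ s, HasDerivAt a (-(logGrad u (γ s, t) * deriv γ s) * a s) s) ∧
      ∀ s, ‖a s‖ ^ 2 * u (γ s) t = u (γ 1) t := by
  have hq : Continuous fun s => logGrad u (γ s, t) := by
    rw [← continuousOn_univ]
    exact h.continuousOn_logGrad.comp (f := fun s => (γ s, t))
      (hγ.continuous.prodMk continuous_const).continuousOn fun s _ => ⟨mem_univ _, ht⟩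
  have hg : Continuous fun s => logGrad u (γ s, t) * deriv γ s :=
    hq.mul (hγ.continuous_deriv le_rfl)
  set b : ℝ → ℂ := fun s => ∫ σ in s..1, logGrad u (γ σ, t) * deriv γ σ
  have hb : ∀ s, HasDerivAt b (-(logGrad u (γ s, t) * deriv γ s)) s := fun s =>
    intervalIntegral.integral_hasDerivAt_left (hg.intervalIntegrable _ _)
      (hg.stronglyMeasurableAtFilter _ _) hg.continuousAt
  have ha : ∀ s, HasDerivAt (fun s => Complex.exp (b s))
      (-(logGrad u (γ s, t) * deriv γ s) * Complex.exp (b s)) s := fun s => by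
    simpa only [mul_comm] using (hb s).cexp
  have hac : Continuous fun s => Complex.exp (b s) :=
    continuous_iff_continuousAt.2 fun s => (ha s).continuousAt
  have hb1 : b 1 = 0 := intervalIntegral.integral_same
  refine ⟨fun s => Complex.exp (b s), ?_, by simp [hb1], ha, ?_⟩
  · rw [contDiff_one_iff_deriv]
    refine ⟨fun s => (ha s).differentiableAt, ?_⟩
    rw [show deriv (fun s => Complex.exp (b s)) = _ from funext fun s => (ha s).deriv]
    exact hg.neg.mul hac
  · set G : ℝ → ℝ := fun s => logFactor u (γ s, t) + 2 * (b s).re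
    have hG : ∀ s, HasDerivAt G 0 s := fun s => by
      have hp : (γ s, t) ∈ (univ : Set ℂ) ×ˢ Ioo (0:ℝ) T := ⟨mem_univ _, ht⟩
      have h1 := (hasFDerivAt_space_slice (differentiableAt h.smooth_logFactor hp)).comp_hasDerivAt s
        (hγ.differentiable one_ne_zero s).hasDerivAt
      have h2 := (Complex.reCLM.hasFDerivAt.comp_hasDerivAt s (hb s)).const_mul 2
      refine (h1.add h2).congr_deriv ?_
      have h3 := logGrad_mul_re u (γ s, t) (deriv γ s)
      simp only [ContinuousLinearMap.comp_apply, ContinuousLinearMap.inl_apply,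
        Complex.reCLM_apply, Complex.neg_re, h3]
      ring
    intro s
    have hconst : G s = G 1 := is_const_of_deriv_eq_zero (fun s => (hG s).differentiableAt)
      (fun s => (hG s).deriv) s 1
    have hs := h.pos (γ s) t ht
    have h1 := h.pos (γ 1) t ht
    simp only [G, hb1, logFactor, Complex.zero_re, mul_zero, add_zero] at hconst
    rw [Complex.norm_exp, ← Real.exp_log hs, ← Real.exp_log h1, ← Real.exp_nat_mul,
      ← Real.exp_add]
    congr 1
    push_cast
    linarith

/-- Variation of the length of a path under displacement by a transported vector and the
corresponding time shift. -/
theorem exists_path_family (h : IsFlow T u) {K : Set (ℂ × ℝ)} (hK : IsCompact K)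
    (hKΩ : K ⊆ (univ : Set ℂ) ×ˢ Ioo (0:ℝ) T) {ε : ℝ} (hε : 0 < ε) :
    ∃ δ > 0, ∀ (t : ℝ) (γ : ℝ → ℂ), ContDiff ℝ 1 γ → (∀ s ∈ Icc (0:ℝ) 1, (γ s, t) ∈ K) →
      ∃ a : ℝ → ℂ, ContDiff ℝ 1 a ∧ a 1 = 1 ∧ ‖a 0‖ ^ 2 * u (γ 0) t = u (γ 1) t ∧
        ∀ (ζ : ℂ) (τ : ℝ), ‖ζ‖ ≤ δ → τ = u (γ 1) t * ‖ζ‖ ^ 2 / 4 →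
          t - τ ∈ Ioo 0 T ∧
          |clen (fun z => u z (t - τ)) (fun s => γ s + ζ * a s) - clen (fun z => u z t) γ| ≤
            ε * ‖ζ‖ * clen (fun z => u z t) γ ∧
          clen (fun z => u z (t - τ)) (fun s => γ s + ζ * a s)
            + clen (fun z => u z (t - τ)) (fun s => γ s + Complex.I * ζ * a s)
            + clen (fun z => u z (t - τ)) (fun s => γ s + -ζ * a s)
            + clen (fun z => u z (t - τ)) (fun s => γ s + -(Complex.I * ζ) * a s) ≤
            (4 + ε * ‖ζ‖ ^ 2) * clen (fun z => u z t) γ := by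
  obtain ⟨M, hM⟩ := hK.exists_bound_of_continuousOn (h.smooth.continuousOn.mono hKΩ)
  obtain ⟨M', hM'⟩ := hK.exists_bound_of_continuousOn
    ((h.smooth.continuousOn.mono hKΩ).inv₀ fun p hp => (h.pos p.1 p.2 (hKΩ hp).2).ne')
  set Λ := |M| * |M'| + 1
  have hΛ1 : 1 ≤ Λ := by simp only [Λ]; linarith [mul_nonneg (abs_nonneg M) (abs_nonneg M')]
  obtain ⟨δ₁, hδ₁, hd⟩ := h.exists_lengthDensity_le hK hKΩ (show 0 < ε / Λ by positivity)
  obtain ⟨δ₂, hδ₂, hadd⟩ := exists_add_mem_of_isCompact (isOpen_spacetime T) hK hKΩ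
  refine ⟨min (δ₁ / Λ) (min 1 (δ₂ / (|M| + 1))), by positivity, fun t γ hγ hγK => ?_⟩
  have h0K := hγK 0 (by simp)
  have h1K := hγK 1 (by simp)
  have ht : t ∈ Ioo 0 T := (hKΩ h0K).2
  obtain ⟨a, ha, ha1, had, han⟩ := h.exists_transport ht hγ
  refine ⟨a, ha, ha1, han 0, fun ζ τ hζ hτ => ?_⟩
  have hζ1 : ‖ζ‖ * Λ ≤ δ₁ := (le_div_iff₀ (by positivity)).1 (hζ.trans (min_le_left _ _))
  have hζ2 : ‖ζ‖ ≤ 1 := hζ.trans ((min_le_right _ _).trans (min_le_left _ _))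
  have hζ3 : ‖ζ‖ * (|M| + 1) ≤ δ₂ :=
    (le_div_iff₀ (by positivity)).1 (hζ.trans ((min_le_right _ _).trans (min_le_right _ _)))
  have hu1 := h.pos (γ 1) t ht
  have hu1M : u (γ 1) t ≤ |M| := (le_abs_self _).trans ((hM _ h1K).trans (le_abs_self M))
  have hτ0 : 0 ≤ τ := by rw [hτ]; positivity
  have hτδ : τ ≤ δ₂ := by
    have k1 : ‖ζ‖ ^ 2 ≤ ‖ζ‖ := by nlinarith [norm_nonneg ζ]
    have k2 := mul_le_mul hu1M k1 (sq_nonneg _) (abs_nonneg M)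
    have := mul_nonneg (norm_nonneg ζ) (abs_nonneg M)
    rw [hτ]
    linarith [norm_nonneg ζ]
  have htτ : t - τ ∈ Ioo 0 T := by
    have := hadd _ h0K (0, -τ) (by
      rw [Prod.norm_def]; simpa [abs_of_nonneg hτ0] using ⟨hδ₂.le, hτδ⟩)
    simpa [← sub_eq_add_neg] using this.2
  have haΛ : ∀ s ∈ Icc (0:ℝ) 1, ‖a s‖ ^ 2 ≤ Λ := fun s hs => by
    have hus := h.pos (γ s) t ht
    have e1 : ‖a s‖ ^ 2 = u (γ 1) t * (u (γ s) t)⁻¹ := by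
      rw [← han s]; field_simp
    have e2 : (u (γ s) t)⁻¹ ≤ |M'| :=
      (le_abs_self _).trans ((hM' _ (hγK s hs)).trans (le_abs_self M'))
    rw [e1]
    have := mul_le_mul hu1M e2 (by positivity) (abs_nonneg M)
    simp only [Λ]; linarith
  have haΛ' : ∀ s ∈ Icc (0:ℝ) 1, ‖a s‖ ≤ Λ := fun s hs =>
    abs_le_of_sq_le_sq' ((haΛ s hs).trans (by nlinarith)) (by positivity) |>.2
  have hγc : ∀ ξ : ℂ, ContDiff ℝ 1 fun s => γ s + ξ * a s := fun ξ =>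
    hγ.add (contDiff_const.mul ha)
  have hint : ∀ ξ : ℂ, ‖ξ‖ = ‖ζ‖ → ∀ s,
      Real.sqrt (u (γ s + ξ * a s) (t - τ)) * ‖deriv (fun s => γ s + ξ * a s) s‖ =
        lengthDensity u (γ s, t) (ξ * a s) * ‖deriv γ s‖ := fun ξ hξ s => by
    have e1 : deriv (fun s => γ s + ξ * a s) s =
        (1 - logGrad u (γ s, t) * (ξ * a s)) * deriv γ s := by
      refine ((hγ.differentiable one_ne_zero s).hasDerivAt.add
        ((had s).const_mul ξ)).deriv.trans ?_
      ring
    have e2 : τ = u (γ s) t * ‖ξ * a s‖ ^ 2 / 4 := by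
      rw [hτ, ← han s, norm_mul, hξ]; ring
    rw [e1, norm_mul, lengthDensity, ← e2, mul_assoc]
  have hcont : ∀ ξ : ℂ, ‖ξ‖ = ‖ζ‖ →
      Continuous fun s => lengthDensity u (γ s, t) (ξ * a s) * ‖deriv γ s‖ := fun ξ hξ => by
    have := continuous_clen_integrand (h.continuous_factor_slice htτ) (hγc ξ)
    refine this.congr fun s => hint ξ hξ s
  have hclen : ∀ ξ : ℂ, ‖ξ‖ = ‖ζ‖ → clen (fun z => u z (t - τ)) (fun s => γ s + ξ * a s) =
      ∫ s in (0:ℝ)..1, lengthDensity u (γ s, t) (ξ * a s) * ‖deriv γ s‖ := fun ξ hξ =>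
    intervalIntegral.integral_congr fun s _ => hint ξ hξ s
  have hbase := continuous_clen_integrand (h.continuous_factor_slice ht) hγ
  have hsmall : ∀ s ∈ Icc (0:ℝ) 1, ‖ζ * a s‖ ≤ δ₁ := fun s hs => by
    rw [norm_mul]
    exact (mul_le_mul_of_nonneg_left (haΛ' s hs) (norm_nonneg _)).trans hζ1
  have i1 : ‖Complex.I * ζ‖ = ‖ζ‖ := by simp
  have i2 : ‖-ζ‖ = ‖ζ‖ := by simp
  have i3 : ‖-(Complex.I * ζ)‖ = ‖ζ‖ := by simp
  refine ⟨htτ, ?_, ?_⟩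
  · rw [hclen ζ rfl, clen, ← intervalIntegral.integral_sub
      ((hcont ζ rfl).intervalIntegrable _ _) (hbase.intervalIntegrable _ _),
      ← intervalIntegral.integral_const_mul]
    refine (intervalIntegral.abs_integral_le_integral_abs zero_le_one).trans
      (intervalIntegral.integral_mono_on zero_le_one
        ((((hcont ζ rfl).sub hbase).abs).intervalIntegrable _ _)
        ((hbase.const_mul _).intervalIntegrable _ _) fun s hs => ?_)
    have k1 := (hd _ (hγK s hs) _ (hsmall s hs)).1
    simp only at k1 ⊢
    rw [← sub_mul, abs_mul, abs_of_nonneg (norm_nonneg (deriv γ s)), ← mul_assoc]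
    refine mul_le_mul_of_nonneg_right (k1.trans ?_) (norm_nonneg _)
    refine mul_le_mul_of_nonneg_right ?_ (Real.sqrt_nonneg _)
    rw [norm_mul]
    have k2 := mul_le_mul_of_nonneg_left (haΛ' s hs) (show 0 ≤ ε / Λ * ‖ζ‖ by positivity)
    have k3 : ε / Λ * ‖ζ‖ * Λ = ε * ‖ζ‖ := by field_simp
    linarith only [k2, k3]
  · have I1 := (hcont ζ rfl).intervalIntegrable (μ := volume) 0 1
    have I2 := (hcont _ i1).intervalIntegrable (μ := volume) 0 1
    have I3 := (hcont _ i2).intervalIntegrable (μ := volume) 0 1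
    have I4 := (hcont _ i3).intervalIntegrable (μ := volume) 0 1
    rw [hclen ζ rfl, hclen _ i1, hclen _ i2, hclen _ i3, clen,
      ← intervalIntegral.integral_const_mul, ← intervalIntegral.integral_add I1 I2,
      ← intervalIntegral.integral_add (I1.add I2) I3,
      ← intervalIntegral.integral_add ((I1.add I2).add I3) I4]
    refine intervalIntegral.integral_mono_on zero_le_one (((I1.add I2).add I3).add I4)
      ((hbase.const_mul _).intervalIntegrable _ _) fun s hs => ?_
    have k1 := (hd _ (hγK s hs) _ (hsmall s hs)).2
    simp only at k1 ⊢
    rw [← add_mul, ← add_mul, ← add_mul, ← mul_assoc]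
    refine mul_le_mul_of_nonneg_right ?_ (norm_nonneg _)
    rw [show Complex.I * ζ * a s = Complex.I * (ζ * a s) by ring,
      show -ζ * a s = -(ζ * a s) by ring,
      show -(Complex.I * ζ) * a s = -(Complex.I * (ζ * a s)) by ring]
    refine k1.trans (mul_le_mul_of_nonneg_right ?_ (Real.sqrt_nonneg _))
    rw [norm_mul, mul_pow]
    have k2 := mul_le_mul_of_nonneg_left (haΛ s hs) (show 0 ≤ ε / Λ * ‖ζ‖ ^ 2 by positivity)
    have k3 : ε / Λ * ‖ζ‖ ^ 2 * Λ = ε * ‖ζ‖ ^ 2 := by field_simp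
    linarith only [k2, k3]

end IsFlow

lemma div_sq_sub_le {A D d : ℝ} (hA : 0 ≤ A) (hD : 0 < D) (hd : |d| ≤ D / 4) :
    A / (D - d) ^ 2 ≤ A / D ^ 2 * (1 + 2 * (d / D) + 6 * (d ^ 2 / D ^ 2)) := by
  obtain ⟨h1, h2⟩ := abs_le.1 hd
  set x := d / D with hx
  have hdx : d = D * x := by rw [hx]; field_simp
  have hx1 : -(1 / 4) ≤ x := by rw [hx, le_div_iff₀ hD]; linarith
  have hx2 : x ≤ 1 / 4 := by rw [hx, div_le_iff₀ hD]; linarith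
  have e1 : d ^ 2 / D ^ 2 = x ^ 2 := by rw [hx, div_pow]
  have e2 : (D - d) ^ 2 = D ^ 2 * (1 - x) ^ 2 := by rw [hdx]; ring
  have h0 : 0 < (1 - x) ^ 2 := by have : 0 < 1 - x := by linarith
                                  positivity
  rw [e1, e2, ← div_div]
  rw [div_le_iff₀ h0, mul_assoc]
  refine le_mul_of_one_le_right (by positivity) ?_
  have k1 : 0 ≤ x ^ 2 * (3 - 10 * x + 6 * x ^ 2) :=
    mul_nonneg (sq_nonneg x) (by nlinarith [sq_nonneg x])
  linarith [show (1 + 2 * x + 6 * x ^ 2) * (1 - x) ^ 2 = 1 + x ^ 2 * (3 - 10 * x + 6 * x ^ 2) by ring]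

lemma one_div_sub_le {y τ : ℝ} (hy : 0 < y) (hτ : τ ≤ y / 2) :
    1 / (y - τ) ≤ 1 / y + τ / y ^ 2 + 2 * τ ^ 2 / y ^ 3 := by
  rw [div_le_iff₀ (by linarith)]
  have e : (1 / y + τ / y ^ 2 + 2 * τ ^ 2 / y ^ 3) * (y - τ) =
      1 + τ ^ 2 / y ^ 3 * (y - 2 * τ) := by
    field_simp; ring
  rw [e]
  have : 0 ≤ τ ^ 2 / y ^ 3 * (y - 2 * τ) := mul_nonneg (by positivity) (by linarith)
  linarith

lemma sum_le_of_barrier {q₁ q₂ q₃ q₄ d₁ d₂ d₃ d₄ P β D R E S : ℝ} (hβ : 0 ≤ β) (hD : 0 < D)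
    (hDR : D ≤ R) (hE : 0 ≤ E)
    (h₁ : q₁ ≤ P + β * (1 + 2 * (d₁ / D) + 6 * (d₁ ^ 2 / D ^ 2)))
    (h₂ : q₂ ≤ P + β * (1 + 2 * (d₂ / D) + 6 * (d₂ ^ 2 / D ^ 2)))
    (h₃ : q₃ ≤ P + β * (1 + 2 * (d₃ / D) + 6 * (d₃ ^ 2 / D ^ 2)))
    (h₄ : q₄ ≤ P + β * (1 + 2 * (d₄ / D) + 6 * (d₄ ^ 2 / D ^ 2)))
    (s₁ : d₁ ^ 2 ≤ S) (s₂ : d₂ ^ 2 ≤ S) (s₃ : d₃ ^ 2 ≤ S) (s₄ : d₄ ^ 2 ≤ S)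
    (hsum : d₁ + d₂ + d₃ + d₄ ≤ E) :
    q₁ + q₂ + q₃ + q₄ ≤ 4 * P + 4 * β + β / D ^ 2 * (2 * R * E + 24 * S) := by
  have e1 : (d₁ + d₂ + d₃ + d₄) / D ≤ R * E / D ^ 2 := by
    rw [div_le_div_iff₀ hD (by positivity)]
    have := mul_le_mul_of_nonneg_right hsum (show 0 ≤ D ^ 2 by positivity)
    have := mul_le_mul_of_nonneg_right hDR (show 0 ≤ E * D by positivity)
    nlinarith
  have e2 : (d₁ ^ 2 + d₂ ^ 2 + d₃ ^ 2 + d₄ ^ 2) / D ^ 2 ≤ 4 * S / D ^ 2 :=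
    div_le_div_of_nonneg_right (by linarith) (by positivity)
  have e3 := mul_le_mul_of_nonneg_left e1 (show 0 ≤ 2 * β by positivity)
  have e4 := mul_le_mul_of_nonneg_left e2 (show 0 ≤ 6 * β by positivity)
  have e5 : β / D ^ 2 * (2 * R * E + 24 * S) =
      2 * β * (R * E / D ^ 2) + 6 * β * (4 * S / D ^ 2) := by ring
  rw [e5]
  have e6 : 2 * β * ((d₁ + d₂ + d₃ + d₄) / D) =
    β * (2 * (d₁ / D)) + β * (2 * (d₂ / D)) + β * (2 * (d₃ / D)) + β * (2 * (d₄ / D)) := by ring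
  have e7 : 6 * β * ((d₁ ^ 2 + d₂ ^ 2 + d₃ ^ 2 + d₄ ^ 2) / D ^ 2) =
    β * (6 * (d₁ ^ 2 / D ^ 2)) + β * (6 * (d₂ ^ 2 / D ^ 2)) + β * (6 * (d₃ ^ 2 / D ^ 2))
      + β * (6 * (d₄ ^ 2 / D ^ 2)) := by ring
  linarith only [h₁, h₂, h₃, h₄, e3, e4, e6, e7]

lemma sum_sq_norm_square (z w : ℂ) :
    ‖z + w‖ ^ 2 + ‖z + Complex.I * w‖ ^ 2 + ‖z + -w‖ ^ 2 + ‖z + -(Complex.I * w)‖ ^ 2 =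
      4 * ‖z‖ ^ 2 + 4 * ‖w‖ ^ 2 := by
  simp only [Complex.sq_norm, Complex.normSq_apply, Complex.add_re, Complex.add_im, Complex.neg_re,
    Complex.neg_im, Complex.mul_re, Complex.mul_im, Complex.I_re, Complex.I_im]
  ring

/-- A penalized length of a path. -/
noncomputable def penLength (u : ℂ → ℝ → ℝ) (B : ℝ) (γ : ℝ → ℂ) (t : ℝ) : ℝ :=
  B * ‖γ 0‖ ^ 2 + clen (fun z => u z t) γ

/-- The paths of penalized length less than `R` starting in the unit disc. -/
structure Admissible (u : ℂ → ℝ → ℝ) (B R s t₀ : ℝ) (γ : ℝ → ℂ) (t : ℝ) : Prop where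
  time : t ∈ Ioc s t₀
  smooth : ContDiff ℝ 1 γ
  start : ‖γ 0‖ ≤ 1
  lt : penLength u B γ t < R

/-- The speed at the end point of a path minus a barrier. -/
noncomputable def barrierGap (u : ℂ → ℝ → ℝ) (A B R s : ℝ) (γ : ℝ → ℂ) (t : ℝ) : ℝ :=
  logSpeed u (γ 1, t) - 1 / (t - s) - A / (R - penLength u B γ t) ^ 2

namespace IsFlow

variable {T : ℝ} {u : ℂ → ℝ → ℝ}

set_option maxHeartbeats 1000000 in
/-- Comparison of the speed at a point with the barrier at the vertices of a square, at an
earlier time. -/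
theorem exists_barrier_comparison (h : IsFlow T u) {K : Set (ℂ × ℝ)} (hK : IsCompact K)
    (hKΩ : K ⊆ (univ : Set ℂ) ×ˢ Ioo (0:ℝ) T) {A B R s t₀ m y₀ D₀ ε : ℝ} (hm : 0 < m) (hB : 0 < B)
    (hR : 0 < R) (hA : A = (8 * B * R + 96 * B ^ 2) / m) (hy₀ : 0 < y₀) (hD₀ : 0 < D₀)
    (hε : 0 < ε) (hε1 : ε ≤ 1) :
    ∃ r > 0, ∀ N γ t, Admissible u B R s t₀ γ t → (∀ σ ∈ Icc (0:ℝ) 1, (γ σ, t) ∈ K) →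
      ‖γ 0‖ ≤ 1 / 2 → m ≤ u (γ 0) t → y₀ ≤ t - s → D₀ ≤ R - penLength u B γ t →
      (∀ γ' t', Admissible u B R s t₀ γ' t' → barrierGap u A B R s γ' t' ≤ N) →
      ∀ τ, τ = u (γ 1) t * r ^ 2 / 4 →
      4 * logSpeed u (γ 1, t) + 4 * τ * logSpeed u (γ 1, t) ^ 2 ≤
        4 * N + 4 * (1 / (t - s)) + 4 * τ * (1 / (t - s)) ^ 2 +
        4 * (A / (R - penLength u B γ t) ^ 2) + 4 * τ * (A / (R - penLength u B γ t) ^ 2) ^ 2 +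
        (2 + 50 * R ^ 2 * (A / D₀ ^ 4)) * ε * r ^ 2 := by
  set Ω := (univ : Set ℂ) ×ˢ Ioo (0:ℝ) T
  have hA0 : 0 < A := by rw [hA]; positivity
  obtain ⟨M₀, hM₀⟩ := hK.exists_bound_of_continuousOn (h.smooth.continuousOn.mono hKΩ)
  set M := |M₀| + 1
  have hM : 0 < M := by positivity
  obtain ⟨δ₁, hδ₁, hpath⟩ := h.exists_path_family hK hKΩ hε
  obtain ⟨δ₂, hδ₂, hfour⟩ := exists_four_point (isOpen_spacetime T)
    (h.smooth_logSpeed.of_le two_le_smooth) hK hKΩ (κ := M) hM hε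
  set W := Real.sqrt (M / m)
  have hW : 0 ≤ W := Real.sqrt_nonneg _
  have hpos0 : ∀ᶠ x : ℝ in nhdsWithin 0 (Ioi 0), 0 < x := self_mem_nhdsWithin
  obtain ⟨r, hr, c1, c2, c3, c4, c5, c6, c7⟩ := (hpos0.and
    ((eventually_mul_le 1 hδ₁).and ((eventually_mul_le 1 hδ₂).and
    ((eventually_mul_le 1 one_pos).and
    ((eventually_mul_le W (show (0:ℝ) < 1 / 4 by norm_num)).and
    ((eventually_mul_le (2 * B * W + R) (show 0 < D₀ / 4 by positivity)).and
    ((eventually_mul_le M (show 0 < y₀ / 2 by positivity)).and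
    (eventually_mul_le (8 * M ^ 2 / y₀ ^ 3) hε)))))))).exists
  refine ⟨r, hr, ?_⟩
  intro N γ t hadm hγK hstart hmu hy hD hN τ hτ
  have hp1 := hγK 1 (by simp)
  have hu1 := h.pos (γ 1) t (hKΩ hp1).2
  have hu1M : u (γ 1) t ≤ M := by
    have := (le_abs_self _).trans (hM₀ _ hp1)
    simp only [M]; linarith [le_abs_self M₀]
  have hr1 : r ≤ 1 := by linarith
  have hr2 : r ^ 2 ≤ r := by nlinarith
  have hτ0 : 0 ≤ τ := by rw [hτ]; positivity
  have hτM : τ ≤ M * r ^ 2 := by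
    have := mul_le_mul_of_nonneg_right hu1M (sq_nonneg r)
    have : 0 ≤ M * r ^ 2 := by positivity
    rw [hτ]; linarith
  have hτy : τ ≤ y₀ / 2 := by
    have := mul_le_mul_of_nonneg_left hr2 hM.le
    linarith
  obtain ⟨a, ha, ha1, ha0, hvar⟩ := hpath t γ hadm.smooth hγK
  set L := clen (fun z => u z t) γ with hL
  set f₀ := penLength u B γ t with hf₀
  set D := R - f₀ with hDdef
  have hDpos : 0 < D := hD₀.trans_le hD
  have hL0 : 0 ≤ L := clen_nonneg _ _
  have hf₀e : f₀ = B * ‖γ 0‖ ^ 2 + L := rfl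
  have hBz : 0 ≤ B * ‖γ 0‖ ^ 2 := by positivity
  have hLR : L ≤ R := by linarith [hadm.lt]
  have hDR : D ≤ R := by linarith
  have hw2 : (r * ‖a 0‖) ^ 2 ≤ 4 * τ / m := by
    rw [le_div_iff₀ hm, hτ, ← ha0]
    have := mul_le_mul_of_nonneg_left hmu (show 0 ≤ (r * ‖a 0‖) ^ 2 by positivity)
    linarith
  have hwW : r * ‖a 0‖ ≤ W * r := by
    have e : (r * ‖a 0‖) ^ 2 ≤ (W * r) ^ 2 := by
      rw [mul_pow W, Real.sq_sqrt (by positivity)]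
      refine hw2.trans ?_
      rw [div_mul_eq_mul_div, div_le_div_iff_of_pos_right hm]
      have := mul_le_mul_of_nonneg_right hu1M (sq_nonneg r)
      rw [hτ]; linarith
    exact (abs_le_of_sq_le_sq' e (by positivity)).2
  have hw4 : r * ‖a 0‖ ≤ 1 / 4 := hwW.trans c4
  -- the variation of the penalized length
  let Lz : ℂ → ℝ := fun ζ => clen (fun z => u z (t - τ)) (fun s => γ s + ζ * a s)
  let d : ℂ → ℝ := fun ζ => B * ‖γ 0 + ζ * a 0‖ ^ 2 + Lz ζ - f₀
  have hdle : ∀ ζ : ℂ, ‖ζ‖ = r → |d ζ| ≤ B * (r * ‖a 0‖) * (5 / 4) + ε * r * R := by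
    intro ζ hζ
    have k1 := (hvar ζ τ (by rw [hζ]; linarith) (by rw [hζ, hτ])).2.1
    rw [hζ] at k1
    have k2 : |‖γ 0 + ζ * a 0‖ ^ 2 - ‖γ 0‖ ^ 2| ≤ (r * ‖a 0‖) * (5 / 4) := by
      have n1 : ‖ζ * a 0‖ = r * ‖a 0‖ := by rw [norm_mul, hζ]
      have n2 := abs_norm_sub_norm_le (γ 0 + ζ * a 0) (γ 0)
      rw [add_sub_cancel_left, n1] at n2
      have n3 := norm_add_le (γ 0) (ζ * a 0)
      rw [n1] at n3
      have n4 : ‖γ 0 + ζ * a 0‖ ^ 2 - ‖γ 0‖ ^ 2 =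
        (‖γ 0 + ζ * a 0‖ - ‖γ 0‖) * (‖γ 0 + ζ * a 0‖ + ‖γ 0‖) := by ring
      rw [n4, abs_mul, abs_of_nonneg (show 0 ≤ ‖γ 0 + ζ * a 0‖ + ‖γ 0‖ by positivity)]
      exact mul_le_mul n2 (by linarith) (by positivity) (by positivity)
    have k3 : d ζ = B * (‖γ 0 + ζ * a 0‖ ^ 2 - ‖γ 0‖ ^ 2) + (Lz ζ - L) := by
      simp only [d, hf₀e]; ring
    have k4 := mul_le_mul_of_nonneg_left hLR (show 0 ≤ ε * r by positivity)
    rw [k3]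
    refine (abs_add_le _ _).trans ?_
    rw [abs_mul, abs_of_pos hB, mul_assoc B]
    exact add_le_add (mul_le_mul_of_nonneg_left k2 hB.le) (k1.trans k4)
  have hdD : ∀ ζ : ℂ, ‖ζ‖ = r → |d ζ| ≤ D / 4 := by
    intro ζ hζ
    refine (hdle ζ hζ).trans ?_
    have k1 := mul_le_mul_of_nonneg_left hwW (show 0 ≤ B * (5 / 4) by positivity)
    have k2 := mul_le_mul_of_nonneg_right hε1 (show 0 ≤ r * R by positivity)
    have k3 : 0 ≤ B * (W * r) := by positivity
    linarith only [k1, k2, k3, c5, hD]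
  have hdsq : ∀ ζ : ℂ, ‖ζ‖ = r → d ζ ^ 2 ≤ 16 * B ^ 2 * τ / m + 2 * ε ^ 2 * r ^ 2 * R ^ 2 := by
    intro ζ hζ
    have k1 := sq_le_sq' (abs_le.1 (hdle ζ hζ)).1 (abs_le.1 (hdle ζ hζ)).2
    have k2 : (B * (r * ‖a 0‖) * (5 / 4) + ε * r * R) ^ 2 ≤
        4 * B ^ 2 * (r * ‖a 0‖) ^ 2 + 2 * ε ^ 2 * r ^ 2 * R ^ 2 := by
      have q1 := sq_nonneg (B * (r * ‖a 0‖) * (5 / 4) - ε * r * R)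
      have q2 : 0 ≤ B ^ 2 * (r * ‖a 0‖) ^ 2 := by positivity
      linarith only [q1, q2]
    have k3 := mul_le_mul_of_nonneg_left hw2 (show 0 ≤ 4 * B ^ 2 by positivity)
    have k4 : 4 * B ^ 2 * (4 * τ / m) = 16 * B ^ 2 * τ / m := by ring
    linarith only [k1, k2, k3, k4]
  have hpt : ∀ ζ : ℂ, ‖ζ‖ = r → logSpeed u ((γ 1, t) + (ζ, -τ)) ≤
      (N + 1 / (t - s - τ)) + A / D ^ 2 * (1 + 2 * (d ζ / D) + 6 * (d ζ ^ 2 / D ^ 2)) := by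
    intro ζ hζ
    have k0 := abs_le.1 (hdD ζ hζ)
    have kpen : penLength u B (fun s => γ s + ζ * a s) (t - τ) = f₀ + d ζ := by
      simp only [penLength, d, Lz]; ring
    have kadm : Admissible u B R s t₀ (fun s => γ s + ζ * a s) (t - τ) := by
      refine ⟨⟨by linarith, by linarith [hadm.time.2]⟩,
        hadm.smooth.add (contDiff_const.mul ha), ?_, ?_⟩
      · refine (norm_add_le _ _).trans ?_
        rw [norm_mul, hζ]
        linarith
      · rw [kpen]; linarith
    have k1 := hN _ _ kadm
    rw [barrierGap, kpen, ha1, mul_one] at k1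
    have k2 := div_sq_sub_le hA0.le hDpos (hdD ζ hζ)
    rw [show R - (f₀ + d ζ) = D - d ζ by rw [hDdef]; ring,
      show t - τ - s = t - s - τ by ring] at k1
    rw [Prod.mk_add_mk, ← sub_eq_add_neg]
    linarith only [k1, k2]
  have n0 : ‖(r : ℂ)‖ = r := by rw [Complex.norm_real, Real.norm_of_nonneg hr.le]
  have n1 : ‖Complex.I * (r : ℂ)‖ = r := by simp [hr.le]
  have n2 : ‖-(r : ℂ)‖ = r := by simp [hr.le]
  have n3 : ‖-(Complex.I * (r : ℂ))‖ = r := by simp [hr.le]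
  have hsum : d r + d (Complex.I * r) + d (-r) + d (-(Complex.I * r)) ≤
      16 * B * τ / m + ε * r ^ 2 * R := by
    have k1 := (hvar r τ (by rw [n0]; linarith) (by rw [n0, hτ])).2.2
    rw [n0] at k1
    have k2 := sum_sq_norm_square (γ 0) ((r:ℂ) * a 0)
    rw [norm_mul, n0] at k2
    have k3 := mul_le_mul_of_nonneg_left hw2 (show 0 ≤ 4 * B by positivity)
    have k4 : 4 * B * (4 * τ / m) = 16 * B * τ / m := by ring
    have k5 := mul_le_mul_of_nonneg_left hLR (show 0 ≤ ε * r ^ 2 by positivity)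
    have k6 : B * (‖γ 0 + (r:ℂ) * a 0‖ ^ 2 + ‖γ 0 + Complex.I * ((r:ℂ) * a 0)‖ ^ 2 +
      ‖γ 0 + -((r:ℂ) * a 0)‖ ^ 2 + ‖γ 0 + -(Complex.I * ((r:ℂ) * a 0))‖ ^ 2) =
      B * (4 * ‖γ 0‖ ^ 2 + 4 * (r * ‖a 0‖) ^ 2) := by rw [k2]
    simp only [d, Lz, neg_mul, mul_assoc Complex.I] at k1 ⊢
    linarith only [k1, k3, k4, k5, k6, hf₀e]
  have hS := sum_le_of_barrier (by positivity) hDpos hDR (by positivity) (hpt r n0) (hpt _ n1)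
    (hpt _ n2) (hpt _ n3) (hdsq r n0) (hdsq _ n1) (hdsq _ n2) (hdsq _ n3) hsum
  have hF := (abs_le.1 (hfour _ hp1 r τ (by rw [n0]; linarith) hτ0 (by rwa [n0]))).1
  rw [h.lap_logSpeed (hKΩ hp1), n0] at hF
  have hF1 : 4 * logSpeed u (γ 1, t) + 4 * τ * logSpeed u (γ 1, t) ^ 2 - ε * r ^ 2 ≤
      logSpeed u ((γ 1, t) + ((r:ℂ), -τ)) + logSpeed u ((γ 1, t) + (Complex.I * r, -τ)) +
      logSpeed u ((γ 1, t) + (-(r:ℂ), -τ)) + logSpeed u ((γ 1, t) + (-(Complex.I * r), -τ)) := by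
    have k1 : 4 * τ = r ^ 2 * u (γ 1) t := by rw [hτ]; ring
    rw [k1] at hF ⊢
    simp only at hF
    linarith only [hF]
  have hT := one_div_sub_le (τ := τ) (hy₀.trans_le hy) (by linarith)
  have hT1 : 4 * (2 * τ ^ 2 / (t - s) ^ 3) ≤ ε * r ^ 2 := by
    have k1 : τ ^ 2 ≤ M ^ 2 * r ^ 4 := by
      have := pow_le_pow_left₀ hτ0 hτM 2
      linarith [show (M * r ^ 2) ^ 2 = M ^ 2 * r ^ 4 by ring]
    have k2 : τ ^ 2 / (t - s) ^ 3 ≤ M ^ 2 * r ^ 4 / y₀ ^ 3 :=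
      div_le_div₀ (by positivity) k1 (by positivity) (pow_le_pow_left₀ hy₀.le hy 3)
    have k3 : 8 * M ^ 2 / y₀ ^ 3 * r ^ 2 ≤ ε :=
      (mul_le_mul_of_nonneg_left hr2 (by positivity)).trans c7
    have k4 := mul_le_mul_of_nonneg_right k3 (sq_nonneg r)
    have k5 : 8 * M ^ 2 / y₀ ^ 3 * r ^ 2 * r ^ 2 = 8 * (M ^ 2 * r ^ 4 / y₀ ^ 3) := by ring
    have k6 : 4 * (2 * τ ^ 2 / (t - s) ^ 3) = 8 * (τ ^ 2 / (t - s) ^ 3) := by ring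
    linarith only [k2, k4, k5, k6]
  have hE : A / D ^ 2 / D ^ 2 * (2 * R * (16 * B * τ / m + ε * r ^ 2 * R) +
      24 * (16 * B ^ 2 * τ / m + 2 * ε ^ 2 * r ^ 2 * R ^ 2)) ≤
      4 * τ * (A / D ^ 2) ^ 2 + 50 * R ^ 2 * (A / D₀ ^ 4) * ε * r ^ 2 := by
    have k1 : 2 * R * (16 * B * τ / m + ε * r ^ 2 * R) +
      24 * (16 * B ^ 2 * τ / m + 2 * ε ^ 2 * r ^ 2 * R ^ 2) =
      4 * A * τ + (2 * ε + 48 * ε ^ 2) * (r ^ 2 * R ^ 2) := by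
      rw [hA]; ring
    have k2 : 2 * ε + 48 * ε ^ 2 ≤ 50 * ε := by nlinarith only [hε, hε1]
    have k3 := mul_le_mul_of_nonneg_right k2 (show 0 ≤ r ^ 2 * R ^ 2 by positivity)
    have k4 := mul_le_mul_of_nonneg_left k3 (show 0 ≤ A / D ^ 4 by positivity)
    have k5 : A / D ^ 4 ≤ A / D₀ ^ 4 :=
      div_le_div_of_nonneg_left hA0.le (by positivity) (pow_le_pow_left₀ hD₀.le hD 4)
    have k6 := mul_le_mul_of_nonneg_right k5 (show 0 ≤ 50 * ε * (r ^ 2 * R ^ 2) by positivity)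
    have k7 : A / D ^ 2 / D ^ 2 * (4 * A * τ) = 4 * τ * (A / D ^ 2) ^ 2 := by ring
    have k8 : A / D ^ 2 / D ^ 2 = A / D ^ 4 := by rw [div_div, ← pow_add]
    rw [k1, mul_add, k7, k8]
    linarith only [k4, k6]
  have hT2 : 4 * (τ / (t - s) ^ 2) = 4 * τ * (1 / (t - s)) ^ 2 := by
    rw [div_pow, one_pow]; ring
  linarith only [hS, hF1, hT, hT1, hE, hT2]

end IsFlow

lemma div_sq_sub_div_sq_ge {A D R : ℝ} (hA : 0 ≤ A) (hD : 0 < D) (hDR : D ≤ R) :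
    A / (R ^ 2 * (R + 1) ^ 2) ≤ A / D ^ 2 - A / (D + 1) ^ 2 := by
  have e : A / D ^ 2 - A / (D + 1) ^ 2 = A * (2 * D + 1) / (D ^ 2 * (D + 1) ^ 2) := by
    field_simp; ring
  rw [e]
  have h1 : D ^ 2 * (D + 1) ^ 2 ≤ R ^ 2 * (R + 1) ^ 2 := by gcongr
  exact div_le_div₀ (by positivity) (le_mul_of_one_le_right hA (by linarith)) (by positivity) h1

namespace IsFlow

variable {T : ℝ} {u : ℂ → ℝ → ℝ}

/-- A path whose gap is almost maximal starts close to the origin. -/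
lemma norm_start_le_half (h : IsFlow T u)
    {A B R s t₀ Al N δ : ℝ} (hs : 0 < s) (ht₀ : t₀ < T) (hAl : 0 ≤ Al)
    (hAu : ∀ z : ℂ, ‖z‖ ≤ 1 → ∀ t ∈ Icc s t₀, Real.sqrt (u z t) ≤ Al) (hB : B = 4 * (Al + 1))
    (hA : 0 < A) {γ : ℝ → ℂ} {t : ℝ} (hadm : Admissible u B R s t₀ γ t)
    (hN : ∀ γ' t', Admissible u B R s t₀ γ' t' → barrierGap u A B R s γ' t' ≤ N)
    (hgap : N - δ < barrierGap u A B R s γ t) (hδ : δ ≤ A / (R ^ 2 * (R + 1) ^ 2)) :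
    ‖γ 0‖ ≤ 1 / 2 := by
  by_contra! hlt
  have ht : t ∈ Ioo 0 T := ⟨hs.trans hadm.time.1, hadm.time.2.trans_lt ht₀⟩
  have hv := h.continuous_factor_slice ht
  obtain ⟨γ', hγ', h0, h1, hl⟩ := exists_concat hv (contDiff_segment 0 (γ 0)) hadm.smooth (by simp)
  have hseg := clen_segment_le hv (convex_closedBall (0:ℂ) 1) (mem_closedBall_self zero_le_one)
    (mem_closedBall_zero_iff.2 hadm.start) (A := Al)
    fun z hz => hAu z (mem_closedBall_zero_iff.1 hz) t ⟨hadm.time.1.le, hadm.time.2⟩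
  rw [sub_zero] at hseg
  have h00 : γ' 0 = 0 := by simpa using h0
  have hL0 := clen_nonneg (fun z => u z t) γ
  have hpen : penLength u B γ' t ≤ penLength u B γ t - 1 := by
    have e1 : penLength u B γ' t = clen (fun z => u z t) γ' := by simp [penLength, h00]
    have e2 : penLength u B γ t = B * ‖γ 0‖ ^ 2 + clen (fun z => u z t) γ := rfl
    have e3 : 1 ≤ B * ‖γ 0‖ ^ 2 - Al * ‖γ 0‖ := by
      rw [hB]
      nlinarith [mul_nonneg hAl (sub_nonneg.2 hlt.le), mul_nonneg (mul_nonneg hAl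
        (sub_nonneg.2 hlt.le)) (norm_nonneg (γ 0))]
    simp only [sub_zero] at hl
    linarith only [e1, e2, e3, hl, hseg]
  have hpen0 : 0 ≤ penLength u B γ t := by
    have : 0 ≤ B := by rw [hB]; positivity
    rw [penLength]; positivity
  have hlt' := hadm.lt
  have hadm' : Admissible u B R s t₀ γ' t :=
    ⟨hadm.time, hγ', by rw [h00, norm_zero]; exact zero_le_one, by linarith⟩
  have k1 := hN γ' t hadm'
  have hD : 0 < R - penLength u B γ t := by linarith
  have k2 := div_sq_sub_div_sq_ge hA.le hD (R := R) (by linarith)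
  have k3 : A / (R - penLength u B γ' t) ^ 2 ≤ A / (R - penLength u B γ t + 1) ^ 2 := by
    refine div_le_div_of_nonneg_left hA.le (by positivity) (pow_le_pow_left₀ (by linarith) ?_ 2)
    linarith
  rw [barrierGap] at k1 hgap
  rw [h1] at k1
  linarith only [k1, k2, k3, hgap, hδ]

theorem barrierGap_nonpos (h : IsFlow T u)
    {A B R s t₀ m Al : ℝ} (hs : 0 < s) (ht₀ : t₀ < T) (hm : 0 < m)
    (hmu : ∀ z : ℂ, ‖z‖ ≤ 1 → ∀ t ∈ Icc s t₀, m ≤ u z t) (hAl : 0 ≤ Al)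
    (hAu : ∀ z : ℂ, ‖z‖ ≤ 1 → ∀ t ∈ Icc s t₀, Real.sqrt (u z t) ≤ Al) (hR : 0 < R)
    (hB : B = 4 * (Al + 1)) (hA : A = (8 * B * R + 96 * B ^ 2) / m)
    {γ : ℝ → ℂ} {t : ℝ} (hadm : Admissible u B R s t₀ γ t) : barrierGap u A B R s γ t ≤ 0 := by
  have hB0 : 0 < B := by rw [hB]; positivity
  have hA0 : 0 < A := by rw [hA]; positivity
  obtain ⟨ϱ, hϱ⟩ := exists_uniform_bound h.pos h.smooth.continuousOn h.complete hs ht₀ R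
  set K : Set (ℂ × ℝ) := closedBall 0 ϱ ×ˢ Icc s t₀
  have hK : IsCompact K := (isCompact_closedBall _ _).prod isCompact_Icc
  have hKΩ : K ⊆ (univ : Set ℂ) ×ˢ Ioo (0:ℝ) T := fun p hp =>
    ⟨mem_univ _, hs.trans_le hp.2.1, hp.2.2.trans_lt ht₀⟩
  have hγK : ∀ γ t, Admissible u B R s t₀ γ t → ∀ σ ∈ Icc (0:ℝ) 1, (γ σ, t) ∈ K := by
    intro γ t ha σ hσ
    have hI : t ∈ Icc s t₀ := ⟨ha.time.1.le, ha.time.2⟩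
    refine ⟨mem_closedBall_zero_iff.2 (hϱ t hI γ ha.smooth ha.start ?_ σ hσ), hI⟩
    have := ha.lt
    rw [penLength] at this
    have h0 : 0 ≤ B * ‖γ 0‖ ^ 2 := by positivity
    linarith
  obtain ⟨C₁, hC₁⟩ := hK.exists_bound_of_continuousOn (h.smooth_logSpeed.continuousOn.mono hKΩ)
  set Qm := |C₁| + 1
  have hQm0 : 0 < Qm := by positivity
  have hQm : ∀ γ t, Admissible u B R s t₀ γ t → logSpeed u (γ 1, t) < Qm := fun γ t ha => by
    have := (le_abs_self _).trans (hC₁ _ (hγK γ t ha 1 (by simp)))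
    simp only [Qm]; linarith [le_abs_self C₁]
  obtain ⟨C₂, hC₂⟩ := hK.exists_bound_of_continuousOn
    ((h.smooth.continuousOn.mono hKΩ).inv₀ fun p hp => (h.pos p.1 p.2 (hKΩ hp).2).ne')
  set m' := 1 / (|C₂| + 1)
  have hm'0 : 0 < m' := by positivity
  have hm' : ∀ p ∈ K, m' ≤ u p.1 p.2 := fun p hp => by
    have h1 := (le_abs_self _).trans (hC₂ p hp)
    have hu := h.pos p.1 p.2 (hKΩ hp).2
    simp only [Pi.inv_apply] at h1
    simp only [m']
    rw [one_div_le (by positivity) hu, one_div]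
    linarith [le_abs_self C₂]
  by_contra! hcon
  set S : Set ℝ := {x | ∃ γ t, Admissible u B R s t₀ γ t ∧ x = barrierGap u A B R s γ t}
  have hSb : BddAbove S := by
    refine ⟨Qm, ?_⟩
    rintro x ⟨γ, t, ha, rfl⟩
    have h1 : 0 ≤ 1 / (t - s) := one_div_nonneg.2 (by linarith [ha.time.1])
    have h2 : 0 ≤ A / (R - penLength u B γ t) ^ 2 := by positivity
    rw [barrierGap]
    linarith [hQm γ t ha]
  have hSne : S.Nonempty := ⟨_, γ, t, hadm, rfl⟩
  set N := sSup S
  have hN0 : 0 < N := hcon.trans_le (le_csSup hSb ⟨γ, t, hadm, rfl⟩)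
  have hN : ∀ γ' t', Admissible u B R s t₀ γ' t' → barrierGap u A B R s γ' t' ≤ N :=
    fun γ' t' ha => le_csSup hSb ⟨γ', t', ha, rfl⟩
  clear hadm hcon
  set D₀ := Real.sqrt (A / Qm)
  have hD₀ : 0 < D₀ := Real.sqrt_pos.2 (by positivity)
  set C := 2 + 50 * R ^ 2 * (A / D₀ ^ 4)
  have hC : 0 < C := by positivity
  set ε := min 1 (m' * N ^ 2 / (16 * C))
  have hε : 0 < ε := by positivity
  have hεC : C * ε ≤ m' * N ^ 2 / 16 := by
    have := mul_le_mul_of_nonneg_left (min_le_right 1 (m' * N ^ 2 / (16 * C))) hC.le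
    refine this.trans (le_of_eq ?_)
    field_simp
  obtain ⟨r, hr, hcomp⟩ := h.exists_barrier_comparison hK hKΩ (s := s) (t₀ := t₀) hm hB0 hR hA
    (show 0 < 1 / Qm by positivity) hD₀ hε (min_le_left _ _)
  set δ := min (N / 2) (min (A / (R ^ 2 * (R + 1) ^ 2)) (r ^ 2 * m' * N ^ 2 / 64))
  have hδ : 0 < δ := by positivity
  obtain ⟨x, ⟨γ, t, ha, rfl⟩, hx⟩ := exists_lt_of_lt_csSup hSne (show N - δ < N by linarith)
  have hstart := h.norm_start_le_half hs ht₀ hAl hAu hB hA0 ha hN hx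
    ((min_le_right _ _).trans (min_le_left _ _))
  have hδ1 : δ ≤ N / 2 := min_le_left _ _
  have hδ2 : δ ≤ r ^ 2 * m' * N ^ 2 / 64 := (min_le_right _ _).trans (min_le_right _ _)
  have hQ := hQm γ t ha
  have hy0 : 0 < t - s := by linarith [ha.time.1]
  have hD0 : 0 < R - penLength u B γ t := by linarith [ha.lt]
  rw [barrierGap] at hx
  have hy1 : 0 < 1 / (t - s) := by positivity
  have hβ : 0 < A / (R - penLength u B γ t) ^ 2 := by positivity
  have hy : 1 / Qm ≤ t - s := by
    rw [one_div_le hQm0 hy0]; linarith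
  have hD : D₀ ≤ R - penLength u B γ t := by
    refine Real.sqrt_le_iff.2 ⟨hD0.le, ?_⟩
    rw [div_le_comm₀ hQm0 (by positivity)]
    linarith
  have hI : t ∈ Icc s t₀ := ⟨ha.time.1.le, ha.time.2⟩
  have key := hcomp N γ t ha (hγK γ t ha) hstart (hmu _ ha.start t hI) hy hD hN _ rfl
  have hu := hm' _ (hγK γ t ha 1 (by simp))
  simp only at hu
  generalize logSpeed u (γ 1, t) = Q at *
  generalize 1 / (t - s) = P at *
  generalize A / (R - penLength u B γ t) ^ 2 = β at *
  generalize u (γ 1) t = U at *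
  have hsq : N ^ 2 / 4 ≤ Q ^ 2 - P ^ 2 - β ^ 2 := by
    have h1 : P + β + N / 2 ≤ Q := by linarith
    have h2 := pow_le_pow_left₀ (by positivity) h1 2
    have h3 : 0 ≤ P * β := by positivity
    have h4 : 0 ≤ P * N := by positivity
    have h5 : 0 ≤ β * N := by positivity
    linarith only [h2, h3, h4, h5]
  have h1 : r ^ 2 * m' * (N ^ 2 / 4) ≤ r ^ 2 * U * (Q ^ 2 - P ^ 2 - β ^ 2) :=
    mul_le_mul (mul_le_mul_of_nonneg_left hu (sq_nonneg r)) hsq (by positivity) (by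
      have := hm'0.trans_le hu
      positivity)
  have h2 := mul_le_mul_of_nonneg_right hεC (sq_nonneg r)
  have h3 : 0 < r ^ 2 * m' * N ^ 2 := by positivity
  linarith only [h1, h2, h3, key, hx, hδ2]

/-- The logarithmic speed of a complete flow is at most `1 / t`. -/
theorem logSpeed_le (h : IsFlow T u)
    {t : ℝ} (ht : t ∈ Ioo 0 T) (p : ℂ) : logSpeed u (p, t) ≤ 1 / t := by
  have main : ∀ s ∈ Ioo 0 t, logSpeed u (p, t) ≤ 1 / (t - s) := by
    intro s hs
    set K : Set (ℂ × ℝ) := closedBall 0 1 ×ˢ Icc s t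
    have hK : IsCompact K := (isCompact_closedBall _ _).prod isCompact_Icc
    have hKΩ : K ⊆ (univ : Set ℂ) ×ˢ Ioo (0:ℝ) T := fun p hp =>
      ⟨mem_univ _, hs.1.trans_le hp.2.1, hp.2.2.trans_lt ht.2⟩
    have hKne : K.Nonempty := ⟨(0, t), by simp, hs.2.le, le_rfl⟩
    have hc := h.smooth.continuousOn.mono hKΩ
    obtain ⟨q, hq, hmin⟩ := hK.exists_isMinOn hKne hc
    obtain ⟨C, hC⟩ := hK.exists_bound_of_continuousOn hc.sqrt
    set B := 4 * (|C| + 1)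
    set J := clen (fun z => u z t) (fun σ : ℝ => 0 + (σ : ℂ) * (p - 0))
    have hJ : 0 ≤ J := clen_nonneg _ _
    set m := u q.1 q.2
    have hm : 0 < m := h.pos _ _ (hKΩ hq).2
    have hR : ∀ᶠ R in atTop, logSpeed u (p, t) ≤
        1 / (t - s) + ((8 * B * R + 96 * B ^ 2) / m) / (R - J) ^ 2 := by
      filter_upwards [eventually_gt_atTop J] with R hRJ
      have hadm : Admissible u B R s t (fun σ : ℝ => 0 + (σ : ℂ) * (p - 0)) t :=
        ⟨⟨hs.2, le_rfl⟩, contDiff_segment 0 p, by simp, by simpa [penLength, J] using hRJ⟩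
      have := h.barrierGap_nonpos hs.1 ht.2 hm
        (fun z hz t' ht' => hmin (show (z, t') ∈ K from ⟨mem_closedBall_zero_iff.2 hz, ht'⟩))
        (abs_nonneg C) (fun z hz t' ht' => (le_abs_self _).trans ((hC (z, t')
          ⟨mem_closedBall_zero_iff.2 hz, ht'⟩).trans (le_abs_self C)))
        (hJ.trans_lt hRJ) rfl rfl hadm
      have e : penLength u B (fun σ : ℝ => 0 + (σ : ℂ) * (p - 0)) t = J := by
        simp [penLength, J]
      rw [barrierGap, e] at this
      simp only [Complex.ofReal_one, one_mul, zero_add, sub_zero] at this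
      linarith
    have hlim : Tendsto (fun R => ((8 * B * R + 96 * B ^ 2) / m) / (R - J) ^ 2) atTop (nhds 0) := by
      have e : ∀ᶠ R in atTop, (8 * B / m) * (R - J)⁻¹ + ((8 * B * J + 96 * B ^ 2) / m) *
          ((R - J)⁻¹) ^ 2 = ((8 * B * R + 96 * B ^ 2) / m) / (R - J) ^ 2 := by
        filter_upwards [eventually_gt_atTop J] with R hRJ
        have : R - J ≠ 0 := by linarith
        field_simp
        ring
      refine Tendsto.congr' e ?_
      have h1 : Tendsto (fun R : ℝ => (R - J)⁻¹) atTop (nhds 0) :=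
        tendsto_inv_atTop_zero.comp (tendsto_atTop_add_const_right _ _ tendsto_id)
      simpa using (h1.const_mul (8 * B / m)).add ((h1.pow 2).const_mul ((8 * B * J + 96 * B ^ 2) / m))
    have := hlim.const_add (1 / (t - s))
    rw [add_zero] at this
    exact ge_of_tendsto this hR
  have hc : ContinuousAt (fun s : ℝ => 1 / (t - s)) 0 := by
    refine ContinuousAt.div continuousAt_const (by fun_prop) ?_
    simpa using ht.1.ne'
  have hlim : Tendsto (fun s : ℝ => 1 / (t - s)) (nhdsWithin 0 (Ioi 0)) (nhds (1 / t)) := by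
    have := hc.tendsto.mono_left (nhdsWithin_le_nhds (s := Ioi 0))
    rwa [sub_zero] at this
  refine ge_of_tendsto hlim ?_
  filter_upwards [Ioo_mem_nhdsGT ht.1] with s hs
  exact main s hs

lemma antitoneOn_div_time (h : IsFlow T u) (z : ℂ) : AntitoneOn (fun t => u z t / t) (Ioo 0 T) := by
  have hd : ∀ t ∈ Ioo 0 T, HasDerivAt (fun t => u z t / t)
      ((u z t * logSpeed u (z, t) * t - u z t * 1) / t ^ 2) t := fun t ht =>
    (h.hasDerivAt_time ht).div (hasDerivAt_id t) ht.1.ne'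
  refine antitoneOn_of_deriv_nonpos (convex_Ioo 0 T)
    (fun t ht => (hd t ht).continuousAt.continuousWithinAt)
    (fun t ht => (hd t (interior_subset ht)).differentiableAt.differentiableWithinAt)
    fun t ht => ?_
  have ht' := interior_subset ht
  rw [(hd t ht').deriv]
  have hu := h.pos z t ht'
  have hQ := h.logSpeed_le ht' z
  rw [le_div_iff₀ ht'.1] at hQ
  refine div_nonpos_of_nonpos_of_nonneg ?_ (sq_nonneg t)
  have := mul_le_mul_of_nonneg_left hQ hu.le
  linarith

end IsFlow

lemma lap_eq_fderiv_fderiv {f : ℂ → ℝ} (hf : ContDiff ℝ 2 f) (z : ℂ) :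
    lap f z = fderiv ℝ (fun w => fderiv ℝ f w 1) z 1 +
      fderiv ℝ (fun w => fderiv ℝ f w Complex.I) z Complex.I := by
  have hd : DifferentiableAt ℝ (fderiv ℝ f) z :=
    (hf.fderiv_right (m := 1) (by norm_num)).differentiable one_ne_zero z
  rw [lap, iteratedFDeriv_two_apply, iteratedFDeriv_two_apply, fderiv_fderiv_apply hd,
    fderiv_fderiv_apply hd]
  rfl

lemma continuous_lap {f : ℂ → ℝ} (hf : ContDiff ℝ 2 f) : Continuous (lap f) := by
  have h (e : ℂ) : Continuous fun z => fderiv ℝ (fun w => fderiv ℝ f w e) z e :=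
    (((hf.fderiv_right (m := 1) (by norm_num)).clm_apply contDiff_const).continuous_fderiv
      one_ne_zero).clm_apply continuous_const
  rw [show lap f = _ from funext fun z => lap_eq_fderiv_fderiv hf z]
  exact (h 1).add (h Complex.I)

lemma hasCompactSupport_lap {f : ℂ → ℝ} (hf : ContDiff ℝ 2 f) (hc : HasCompactSupport f) :
    HasCompactSupport (lap f) := by
  have h (e : ℂ) : HasCompactSupport fun z => fderiv ℝ (fun w => fderiv ℝ f w e) z e :=
    (hc.fderiv_apply ℝ e).fderiv_apply ℝ e
  rw [show lap f = _ from funext fun z => lap_eq_fderiv_fderiv hf z]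
  exact (h 1).add (h Complex.I)

lemma integral_mul_second_deriv {N f : ℂ → ℝ} (hN : ContDiff ℝ 2 N) (hc : HasCompactSupport N)
    (hf : ContDiff ℝ 2 f) (e : ℂ) :
    ∫ w, N w * fderiv ℝ (fun w => fderiv ℝ f w e) w e =
      ∫ w, fderiv ℝ (fun w => fderiv ℝ N w e) w e * f w := by
  have hN1 : ContDiff ℝ 1 fun w => fderiv ℝ N w e :=
    (hN.fderiv_right (m := 1) (by norm_num)).clm_apply contDiff_const
  have hf1 : ContDiff ℝ 1 fun w => fderiv ℝ f w e :=
    (hf.fderiv_right (m := 1) (by norm_num)).clm_apply contDiff_const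
  have hN2 : Continuous fun w => fderiv ℝ (fun w => fderiv ℝ N w e) w e :=
    (hN1.continuous_fderiv one_ne_zero).clm_apply continuous_const
  have hf2 : Continuous fun w => fderiv ℝ (fun w => fderiv ℝ f w e) w e :=
    (hf1.continuous_fderiv one_ne_zero).clm_apply continuous_const
  have hc1 : HasCompactSupport fun w => fderiv ℝ N w e := hc.fderiv_apply ℝ e
  have hc2 : HasCompactSupport fun w => fderiv ℝ (fun w => fderiv ℝ N w e) w e :=
    hc1.fderiv_apply ℝ e
  have int {a b : ℂ → ℝ} (ha : Continuous a) (hb : Continuous b) (hca : HasCompactSupport a) :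
      Integrable fun w => a w * b w :=
    (ha.mul hb).integrable_of_hasCompactSupport hca.mul_right
  rw [integral_mul_fderiv_eq_neg_fderiv_mul_of_integrable
      (int hN1.continuous hf1.continuous hc1) (int hN.continuous hf2 hc)
      (int hN.continuous hf1.continuous hc)
      (fun x _ => hN.differentiable two_ne_zero x) (fun x _ => hf1.differentiable one_ne_zero x),
    integral_mul_fderiv_eq_neg_fderiv_mul_of_integrable
      (int hN2 hf.continuous hc2) (int hN1.continuous hf1.continuous hc1)
      (int hN1.continuous hf.continuous hc1)
      (fun x _ => hN1.differentiable one_ne_zero x) (fun x _ => hf.differentiable two_ne_zero x),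
    neg_neg]

/-- Green's identity for a compactly supported test function. -/
lemma integral_mul_lap {N f : ℂ → ℝ} (hN : ContDiff ℝ 2 N) (hc : HasCompactSupport N)
    (hf : ContDiff ℝ 2 f) : ∫ w, N w * lap f w = ∫ w, lap N w * f w := by
  have hN1 (e : ℂ) : ContDiff ℝ 1 fun w => fderiv ℝ N w e :=
    (hN.fderiv_right (m := 1) (by norm_num)).clm_apply contDiff_const
  have hf1 (e : ℂ) : ContDiff ℝ 1 fun w => fderiv ℝ f w e :=
    (hf.fderiv_right (m := 1) (by norm_num)).clm_apply contDiff_const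
  have hN2 (e : ℂ) : Continuous fun w => fderiv ℝ (fun w => fderiv ℝ N w e) w e :=
    ((hN1 e).continuous_fderiv one_ne_zero).clm_apply continuous_const
  have hf2 (e : ℂ) : Continuous fun w => fderiv ℝ (fun w => fderiv ℝ f w e) w e :=
    ((hf1 e).continuous_fderiv one_ne_zero).clm_apply continuous_const
  have hc2 (e : ℂ) : HasCompactSupport fun w => fderiv ℝ (fun w => fderiv ℝ N w e) w e :=
    (hc.fderiv_apply ℝ e).fderiv_apply ℝ e
  have int {a b : ℂ → ℝ} (ha : Continuous a) (hb : Continuous b) (hca : HasCompactSupport a) :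
      Integrable fun w => a w * b w :=
    (ha.mul hb).integrable_of_hasCompactSupport hca.mul_right
  simp only [lap_eq_fderiv_fderiv hN, lap_eq_fderiv_fderiv hf, mul_add, add_mul]
  rw [integral_add (int hN.continuous (hf2 _) hc) (int hN.continuous (hf2 _) hc),
    integral_add (int (hN2 _) hf.continuous (hc2 _)) (int (hN2 _) hf.continuous (hc2 _)),
    integral_mul_second_deriv hN hc hf, integral_mul_second_deriv hN hc hf]

lemma integral_lap {N : ℂ → ℝ} (hN : ContDiff ℝ 2 N) (hc : HasCompactSupport N) :
    ∫ w, lap N w = 0 := by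
  have h := integral_mul_lap hN hc (contDiff_const (c := (1:ℝ)))
  have h0 (w : ℂ) : lap (fun _ => (1:ℝ)) w = 0 := by
    rw [lap_eq_fderiv_fderiv contDiff_const]; simp
  simpa [h0] using h.symm

/-- The Laplacian of a function of the squared distance to a point. -/
lemma lap_radial {f f₁ f₂ : ℝ → ℝ} (h₁ : ∀ x, 0 ≤ x → HasDerivAt f (f₁ x) x)
    (h₂ : ∀ x, 0 ≤ x → HasDerivAt f₁ (f₂ x) x) (z₀ w : ℂ)
    (hN : ContDiff ℝ 2 fun w : ℂ => f (‖w - z₀‖ ^ 2)) :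
    lap (fun w : ℂ => f (‖w - z₀‖ ^ 2)) w =
      4 * f₁ (‖w - z₀‖ ^ 2) + 4 * ‖w - z₀‖ ^ 2 * f₂ (‖w - z₀‖ ^ 2) := by
  have hq (w : ℂ) : HasFDerivAt (fun w : ℂ => ‖w - z₀‖ ^ 2) (2 • (innerSL ℝ (w - z₀))) w := by
    simpa using ((hasFDerivAt_id w).sub_const z₀).norm_sq
  have e1 (e : ℂ) : (fun w => fderiv ℝ (fun w : ℂ => f (‖w - z₀‖ ^ 2)) w e) =
      fun w => f₁ (‖w - z₀‖ ^ 2) * (2 * inner ℝ (w - z₀) e) := by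
    funext w
    refine (congrArg (fun L : ℂ →L[ℝ] ℝ => L e)
      ((h₁ _ (sq_nonneg _)).comp_hasFDerivAt w (hq w)).fderiv).trans ?_
    simp
    left
    ring
  have e2 (e : ℂ) : fderiv ℝ (fun w => fderiv ℝ (fun w : ℂ => f (‖w - z₀‖ ^ 2)) w e) w e =
      f₂ (‖w - z₀‖ ^ 2) * (2 * inner ℝ (w - z₀) e) ^ 2 + f₁ (‖w - z₀‖ ^ 2) * (2 * inner ℝ e e) := by
    rw [e1]
    have hi : HasFDerivAt (fun w : ℂ => 2 * inner ℝ (w - z₀) e)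
        ((2:ℝ) • (innerSL ℝ e)) w := by
      have := ((innerSL ℝ e).hasFDerivAt.comp w ((hasFDerivAt_id w).sub_const z₀)).const_mul (2:ℝ)
      simpa [Function.comp_def, real_inner_comm] using this
    refine (congrArg (fun L : ℂ →L[ℝ] ℝ => L e)
      (((h₂ _ (sq_nonneg _)).comp_hasFDerivAt w (hq w)).mul hi).fderiv).trans ?_
    simp
    ring
  rw [lap_eq_fderiv_fderiv hN, e2, e2]
  have n := Complex.sq_norm (w - z₀)
  rw [Complex.normSq_apply] at n
  simp only [Complex.inner, Complex.mul_re, Complex.conj_re, Complex.conj_im, Complex.one_re,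
    Complex.one_im, Complex.I_re, Complex.I_im, n]
  ring

namespace IsFlow

variable {T : ℝ} {u : ℂ → ℝ → ℝ}

lemma contDiff_log_slice (h : IsFlow T u) {t : ℝ} (ht : t ∈ Ioo (0:ℝ) T) :
    ContDiff ℝ 2 fun w => Real.log (u w t) := by
  rw [← contDiffOn_univ]
  exact (h.smooth_logFactor.of_le two_le_smooth).comp
    (f := fun w : ℂ => (w, t)) (contDiff_id.prodMk contDiff_const).contDiffOn
    fun w _ => ⟨mem_univ _, ht⟩

lemma continuous_log_div_slice (h : IsFlow T u) {s : ℝ} (hs : s ∈ Ioo (0:ℝ) T) (C : ℝ) :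
    Continuous fun w => Real.log (u w s / s) + C :=
  (((h.continuous_factor_slice hs).div_const s).log
    fun w => (div_pos (h.pos w s hs) hs.1).ne').add continuous_const

/-- The time derivative of the integral of the flow against a test function. -/
lemma hasDerivAt_integral_mul (h : IsFlow T u)
    {N : ℂ → ℝ} (hN : ContDiff ℝ 2 N) (hc : HasCompactSupport N)
    {t : ℝ} (ht : t ∈ Ioo (0:ℝ) T) (C : ℝ) :
    HasDerivAt (fun τ => ∫ w, N w * u w τ) (∫ w, lap N w * (Real.log (u w t / t) + C)) t := by
  have hs : Icc (t / 2) ((t + T) / 2) ∈ nhds t :=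
    Icc_mem_nhds (by linarith [ht.1]) (by linarith [ht.2])
  have hsub : Icc (t / 2) ((t + T) / 2) ⊆ Ioo 0 T := fun s hs' =>
    ⟨by linarith [ht.1, hs'.1], by linarith [ht.2, hs'.2]⟩
  have hg : ContinuousOn (fun p : ℂ × ℝ => u p.1 p.2 * logSpeed u p)
      ((univ : Set ℂ) ×ˢ Ioo (0:ℝ) T) := h.smooth.continuousOn.mul h.smooth_logSpeed.continuousOn
  have hgs (s : ℝ) (hs' : s ∈ Ioo (0:ℝ) T) : Continuous fun w => u w s * logSpeed u (w, s) := by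
    rw [← continuousOn_univ]
    exact hg.comp (f := fun w : ℂ => (w, s)) (by fun_prop) fun w _ => ⟨mem_univ _, hs'⟩
  obtain ⟨B, hB⟩ := (hc.isCompact.prod (isCompact_Icc (a := t / 2) (b := (t + T) / 2))
    ).exists_bound_of_continuousOn (hg.mono (prod_mono (subset_univ _) hsub))
  have hcu (s : ℝ) (hs' : s ∈ Ioo (0:ℝ) T) : Continuous fun w => N w * u w s :=
    hN.continuous.mul (h.continuous_factor_slice hs')
  have key := (hasDerivAt_integral_of_dominated_loc_of_deriv_le (μ := volume)
    (F := fun s w => N w * u w s) (F' := fun s w => N w * (u w s * logSpeed u (w, s)))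
    (bound := fun w => |N w| * B) hs
    (eventually_of_mem hs fun s hs' => (hcu s (hsub hs')).aestronglyMeasurable)
    ((hcu t ht).integrable_of_hasCompactSupport hc.mul_right)
    (hN.continuous.mul (hgs t ht)).aestronglyMeasurable
    (.of_forall fun w s hs' => ?_)
    ((hN.continuous.abs.mul continuous_const).integrable_of_hasCompactSupport
      (hc.norm.mul_right : HasCompactSupport fun w => ‖N w‖ * B))
    (.of_forall fun w s hs' => (h.hasDerivAt_time (hsub hs')).const_mul (N w))).2
  · refine key.congr_deriv ?_
    have hl := h.contDiff_log_slice ht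
    have e1 : ∀ w, u w t * logSpeed u (w, t) = lap (fun w => Real.log (u w t)) w := fun w => by
      rw [← h.lfde w t ht, (h.hasDerivAt_time ht).deriv]
    have e2 : ∀ w, lap N w * (Real.log (u w t / t) + C) =
        lap N w * Real.log (u w t) + lap N w * (C - Real.log t) := fun w => by
      rw [Real.log_div (h.pos w t ht).ne' ht.1.ne']; ring
    have hL := hasCompactSupport_lap hN hc
    simp only [e1, e2]
    rw [integral_mul_lap hN hc hl, integral_add, integral_mul_const, integral_lap hN hc, zero_mul,
      add_zero]
    · exact ((continuous_lap hN).mul hl.continuous).integrable_of_hasCompactSupport hL.mul_right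
    · exact ((continuous_lap hN).mul continuous_const).integrable_of_hasCompactSupport hL.mul_right
  · rw [Real.norm_eq_abs, abs_mul]
    by_cases hw : w ∈ tsupport N
    · exact mul_le_mul_of_nonneg_left (hB (w, s) ⟨hw, hs'⟩) (abs_nonneg _)
    · simp [image_eq_zero_of_notMem_tsupport hw]

end IsFlow

lemma le_of_deriv_nonpos_of_tendsto {F F' : ℝ → ℝ} {t L : ℝ} (ht : 0 < t)
    (hF : ∀ s ∈ Ioc 0 t, HasDerivAt F (F' s) s) (hF' : ∀ s ∈ Ioc 0 t, F' s ≤ 0)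
    (hL : Tendsto F (nhdsWithin 0 (Ioi 0)) (nhds L)) : F t ≤ L := by
  have anti : AntitoneOn F (Ioc 0 t) := by
    refine antitoneOn_of_deriv_nonpos (convex_Ioc 0 t)
      (fun s hs => (hF s hs).continuousAt.continuousWithinAt)
      (fun s hs => (hF s (interior_subset hs)).differentiableAt.differentiableWithinAt)
      fun s hs => ?_
    rw [(hF s (interior_subset hs)).deriv]
    exact hF' s (interior_subset hs)
  refine ge_of_tendsto hL ?_
  filter_upwards [Ioo_mem_nhdsGT ht] with s hs
  exact anti ⟨hs.1, hs.2.le⟩ ⟨ht, le_rfl⟩ hs.2.le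

/-- A Grönwall type estimate for nonnegative functions with `X' ≤ A √((X + δ) / s)`. -/
lemma le_mul_of_deriv_le_sqrt {X X' : ℝ → ℝ} {t A : ℝ} (ht : 0 < t)
    (h0 : ∀ s ∈ Ioc 0 t, 0 ≤ X s) (hX : ∀ s ∈ Ioc 0 t, HasDerivAt X (X' s) s)
    (hX' : ∀ s ∈ Ioc 0 t, X' s ≤ A * Real.sqrt ((X s + t) / s))
    (hL : Tendsto X (nhdsWithin 0 (Ioi 0)) (nhds 0)) : X t ≤ (1 + A) ^ 2 * t := by
  have hlim : Tendsto (fun s => Real.sqrt (X s + t) - A * Real.sqrt s) (nhdsWithin 0 (Ioi 0))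
      (nhds (Real.sqrt t)) := by
    have h1 := (hL.add_const t).sqrt
    have h2 : Tendsto (fun s => A * Real.sqrt s) (nhdsWithin 0 (Ioi 0)) (nhds (A * Real.sqrt 0)) :=
      ((Real.continuous_sqrt.const_mul A).tendsto 0).mono_left nhdsWithin_le_nhds
    simpa using h1.sub h2
  have key := le_of_deriv_nonpos_of_tendsto ht (F' := fun s =>
      X' s / (2 * Real.sqrt (X s + t)) - A * (1 / (2 * Real.sqrt s)))
    (fun s hs => (((hX s hs).add_const t).sqrt (by linarith [h0 s hs])).sub
      ((Real.hasDerivAt_sqrt hs.1.ne').const_mul A)) (fun s hs => ?_) hlim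
  · have hXt := h0 t ⟨ht, le_rfl⟩
    have h1 : Real.sqrt (X t + t) ≤ (1 + A) * Real.sqrt t := by
      simp only [Pi.sub_apply] at key
      linarith
    have h2 := pow_le_pow_left₀ (Real.sqrt_nonneg _) h1 2
    rw [mul_pow, Real.sq_sqrt (by linarith), Real.sq_sqrt ht.le] at h2
    linarith
  · have hp : 0 < Real.sqrt (X s + t) := Real.sqrt_pos.2 (by linarith [h0 s hs])
    have hq : 0 < Real.sqrt s := Real.sqrt_pos.2 hs.1
    have h1 := hX' s hs
    rw [Real.sqrt_div (by linarith [h0 s hs])] at h1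
    rw [sub_nonpos, div_le_iff₀ (by positivity)]
    refine h1.trans (le_of_eq ?_)
    field_simp

/-- A smooth cutoff function on the line, equal to `1` below `b` and to `0` above `2 b`. -/
noncomputable def cutoff (b x : ℝ) : ℝ := Real.smoothTransition (2 - x / b)

lemma contDiff_cutoff (b : ℝ) {n : WithTop ℕ∞} (hn : n ≤ ((⊤ : ℕ∞) : WithTop ℕ∞)) :
    ContDiff ℝ n (cutoff b) :=
  Real.smoothTransition.contDiff.of_le hn |>.comp (by fun_prop)

lemma contDiff_deriv_cutoff (b : ℝ) : ContDiff ℝ 1 (deriv (cutoff b)) :=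
  (contDiff_succ_iff_deriv (n := 1)).1
    (by exact contDiff_cutoff b two_le_smooth) |>.2.2

lemma hasDerivAt_cutoff (b x : ℝ) : HasDerivAt (cutoff b) (deriv (cutoff b) x) x :=
  ((contDiff_cutoff b two_le_smooth).differentiable two_ne_zero x).hasDerivAt

lemma hasDerivAt_deriv_cutoff (b x : ℝ) :
    HasDerivAt (deriv (cutoff b)) (deriv (deriv (cutoff b)) x) x :=
  ((contDiff_deriv_cutoff b).differentiable one_ne_zero x).hasDerivAt

lemma cutoff_nonneg (b x : ℝ) : 0 ≤ cutoff b x := Real.smoothTransition.nonneg _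

lemma cutoff_le_one (b x : ℝ) : cutoff b x ≤ 1 := Real.smoothTransition.le_one _

lemma cutoff_eq_one {b x : ℝ} (hb : 0 < b) (hx : x ≤ b) : cutoff b x = 1 := by
  have : x / b ≤ 1 := (div_le_one hb).2 hx
  exact Real.smoothTransition.one_of_one_le (by linarith)

lemma cutoff_eq_zero {b x : ℝ} (hb : 0 < b) (hx : 2 * b ≤ x) : cutoff b x = 0 := by
  have : 2 ≤ x / b := (le_div_iff₀ hb).2 hx
  exact Real.smoothTransition.zero_of_nonpos (by linarith)

lemma deriv_cutoff_eq_zero {b x : ℝ} (hb : 0 < b) (hx : x < b ∨ 2 * b < x) :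
    deriv (cutoff b) x = 0 := by
  rcases hx with hx | hx
  · have : cutoff b =ᶠ[nhds x] fun _ => 1 := by
      filter_upwards [Iio_mem_nhds hx] with y hy using cutoff_eq_one hb (le_of_lt hy)
    rw [this.deriv_eq, deriv_const]
  · have : cutoff b =ᶠ[nhds x] fun _ => 0 := by
      filter_upwards [Ioi_mem_nhds hx] with y hy using cutoff_eq_zero hb (le_of_lt hy)
    rw [this.deriv_eq, deriv_const]

lemma deriv_deriv_cutoff_eq_zero {b x : ℝ} (hb : 0 < b) (hx : x < b ∨ 2 * b < x) :
    deriv (deriv (cutoff b)) x = 0 := by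
  have : deriv (cutoff b) =ᶠ[nhds x] fun _ => 0 := by
    rcases hx with hx | hx
    · filter_upwards [Iio_mem_nhds hx] with y hy using deriv_cutoff_eq_zero hb (.inl hy)
    · filter_upwards [Ioi_mem_nhds hx] with y hy using deriv_cutoff_eq_zero hb (.inr hy)
  rw [this.deriv_eq, deriv_const]

lemma exists_deriv_cutoff_bound (b : ℝ) : ∃ c : ℝ, 0 ≤ c ∧ ∀ x ∈ Icc 0 (2 * b),
    |deriv (cutoff b) x| ≤ c ∧ |deriv (deriv (cutoff b)) x| ≤ c := by
  obtain ⟨c₁, h₁⟩ := (isCompact_Icc (a := 0) (b := 2 * b)).exists_bound_of_continuousOn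
    (contDiff_deriv_cutoff b).continuous.continuousOn
  obtain ⟨c₂, h₂⟩ := (isCompact_Icc (a := 0) (b := 2 * b)).exists_bound_of_continuousOn
    ((contDiff_deriv_cutoff b).continuous_deriv le_rfl).continuousOn
  exact ⟨max (max c₁ c₂) 0, le_max_right _ _, fun x hx =>
    ⟨(h₁ x hx).trans ((le_max_left _ _).trans (le_max_left _ _)),
      (h₂ x hx).trans ((le_max_right _ _).trans (le_max_left _ _))⟩⟩

lemma hasCompactSupport_of_eq_zero {f : ℂ → ℝ} {z₀ : ℂ} {b : ℝ}
    (hf : ∀ w, 2 * b ≤ ‖w - z₀‖ ^ 2 → f w = 0) : HasCompactSupport f := by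
  refine HasCompactSupport.intro (isCompact_closedBall z₀ (Real.sqrt (2 * b))) fun w hw => hf w ?_
  rw [mem_closedBall, dist_eq_norm, not_le] at hw
  exact ((Real.sqrt_lt' ((Real.sqrt_nonneg _).trans_lt hw)).1 hw).le

lemma contDiff_sq_dist (z₀ : ℂ) {n : WithTop ℕ∞} : ContDiff ℝ n fun w : ℂ => ‖w - z₀‖ ^ 2 :=
  (contDiff_id.sub contDiff_const).norm_sq ℝ

/-- The fourth power of the cutoff has Laplacian controlled by the square of the cutoff. -/
lemma exists_lap_cutoff_bound {b : ℝ} (hb : 0 < b) (z₀ : ℂ) : ∃ c : ℝ, 0 ≤ c ∧ ∀ w : ℂ,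
    |lap (fun w => cutoff b (‖w - z₀‖ ^ 2) ^ 4) w| ≤ c * cutoff b (‖w - z₀‖ ^ 2) ^ 2 := by
  obtain ⟨c, hc, hcb⟩ := exists_deriv_cutoff_bound b
  refine ⟨16 * c + 4 * (2 * b) * (12 * c ^ 2 + 4 * c), by positivity, fun w => ?_⟩
  have hN : ContDiff ℝ 2 fun w : ℂ => cutoff b (‖w - z₀‖ ^ 2) ^ 4 :=
    ((contDiff_cutoff b two_le_smooth).comp (contDiff_sq_dist z₀)).pow 4
  rw [lap_radial (f := fun x => cutoff b x ^ 4)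
    (f₁ := fun x => 4 * cutoff b x ^ 3 * deriv (cutoff b) x)
    (f₂ := fun x => 12 * cutoff b x ^ 2 * deriv (cutoff b) x ^ 2 +
      4 * cutoff b x ^ 3 * deriv (deriv (cutoff b)) x) ?_ ?_ z₀ w hN]
  · set x := ‖w - z₀‖ ^ 2
    have hx0 : 0 ≤ x := sq_nonneg _
    rcases le_total (2 * b) x with hx | hx
    · simp [cutoff_eq_zero hb hx]
    obtain ⟨h1, h2⟩ := hcb x ⟨hx0, hx⟩
    have p0 := cutoff_nonneg b x
    have p1 := cutoff_le_one b x
    set p := cutoff b x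
    set d := deriv (cutoff b) x
    set e := deriv (deriv (cutoff b)) x
    have e1 : 4 * (4 * p ^ 3 * d) + 4 * x * (12 * p ^ 2 * d ^ 2 + 4 * p ^ 3 * e) =
        (16 * (p * d) + 4 * x * (12 * d ^ 2 + 4 * (p * e))) * p ^ 2 := by ring
    rw [e1, abs_mul, abs_of_nonneg (sq_nonneg p)]
    refine mul_le_mul_of_nonneg_right ?_ (sq_nonneg p)
    have b1 : |p * d| ≤ c := by
      rw [abs_mul, abs_of_nonneg p0]
      exact (mul_le_of_le_one_left (abs_nonneg _) p1).trans h1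
    have b2 : |p * e| ≤ c := by
      rw [abs_mul, abs_of_nonneg p0]
      exact (mul_le_of_le_one_left (abs_nonneg _) p1).trans h2
    have b3 : d ^ 2 ≤ c ^ 2 := by
      rw [← sq_abs]; exact pow_le_pow_left₀ (abs_nonneg _) h1 2
    have b4 : |12 * d ^ 2 + 4 * (p * e)| ≤ 12 * c ^ 2 + 4 * c := by
      rw [abs_le] at b2 ⊢
      constructor <;> linarith [sq_nonneg d]
    have b5 : |4 * x * (12 * d ^ 2 + 4 * (p * e))| ≤ 4 * (2 * b) * (12 * c ^ 2 + 4 * c) := by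
      rw [abs_mul, abs_of_nonneg (by linarith : 0 ≤ 4 * x)]
      exact mul_le_mul (by linarith) b4 (abs_nonneg _) (by linarith)
    refine (abs_add_le _ _).trans (add_le_add ?_ b5)
    rw [abs_mul, abs_of_pos (by norm_num : (0:ℝ) < 16)]
    linarith
  · intro x _
    exact ((hasDerivAt_cutoff b x).pow 4).congr_deriv (by norm_num)
  · intro x _
    refine ((((hasDerivAt_cutoff b x).pow 3).const_mul 4).mul
      (hasDerivAt_deriv_cutoff b x)).congr_deriv ?_
    norm_num
    ring

lemma Real.log_le_two_mul_sqrt {y : ℝ} (hy : 0 < y) : Real.log y ≤ 2 * Real.sqrt y := by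
  have h := Real.log_le_sub_one_of_pos (Real.sqrt_pos.2 hy)
  rw [Real.log_sqrt hy.le] at h
  linarith

namespace IsFlow

variable {T : ℝ} {u : ℂ → ℝ → ℝ}

/-- Where the initial measure vanishes, the mass of the flow grows at most linearly. -/
lemma exists_mass_bound (h : IsFlow T u)
    {z₀ : ℂ} {b : ℝ} (hb : 0 < b) {t₁ : ℝ} (ht₁ : t₁ < T) {C₀ : ℝ}
    (hlog : ∀ τ ∈ Ioc 0 t₁, ∀ w, ‖w - z₀‖ ^ 2 ≤ 2 * b → 0 ≤ Real.log (u w τ / τ) + C₀)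
    (hX : Tendsto (fun t => ∫ w, cutoff b (‖w - z₀‖ ^ 2) ^ 4 * u w t)
      (nhdsWithin 0 (Ioi 0)) (nhds 0)) :
    ∃ A, ∀ t ∈ Ioc 0 t₁, ∫ w, cutoff b (‖w - z₀‖ ^ 2) ^ 4 * u w t ≤ A * t := by
  obtain ⟨c, hc, hlap⟩ := exists_lap_cutoff_bound hb z₀
  set θ : ℂ → ℝ := fun w => cutoff b (‖w - z₀‖ ^ 2) ^ 4 with hθ
  have hθ2 : ContDiff ℝ 2 θ :=
    ((contDiff_cutoff b two_le_smooth).comp (contDiff_sq_dist z₀)).pow 4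
  have hθc : HasCompactSupport θ := hasCompactSupport_of_eq_zero (b := b) (z₀ := z₀) fun w hw => by
    simp [hθ, cutoff_eq_zero hb hw]
  set B : Set ℂ := {w | ‖w - z₀‖ ^ 2 ≤ 2 * b} with hB
  have hBeq : B = closedBall z₀ (Real.sqrt (2 * b)) := by
    ext w
    rw [mem_closedBall, dist_eq_norm, Real.le_sqrt (norm_nonneg _) (by positivity)]
    rfl
  have hBm : MeasurableSet B := hBeq ▸ measurableSet_closedBall
  have hBf : volume B ≠ ⊤ := hBeq ▸ measure_closedBall_lt_top.ne
  set V : ℝ := volume.real B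
  have hV : 0 ≤ V := measureReal_nonneg
  refine ⟨(1 + c * (Real.exp C₀ + V)) ^ 2, fun t ht => ?_⟩
  have hsub : Ioc 0 t ⊆ Ioc 0 t₁ := Ioc_subset_Ioc_right ht.2
  have hT (s : ℝ) (hs : s ∈ Ioc 0 t) : s ∈ Ioo 0 T := ⟨hs.1, hs.2.trans_lt (ht.2.trans_lt ht₁)⟩
  have hX0 (s : ℝ) (hs : s ∈ Ioc 0 t) : 0 ≤ ∫ w, θ w * u w s :=
    integral_nonneg fun w => mul_nonneg (pow_nonneg (cutoff_nonneg _ _) 4) (h.pos w s (hT s hs)).le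
  refine le_mul_of_deriv_le_sqrt (X := fun s => ∫ w, θ w * u w s) ht.1 hX0
    (fun s hs => h.hasDerivAt_integral_mul hθ2 hθc (hT s hs) C₀) (fun s hs => ?_) hX
  set X : ℝ := ∫ w, θ w * u w s with hXdef
  have hXs : 0 ≤ X := hX0 s hs
  have hpos : 0 < (X + t) / s := div_pos (by linarith [ht.1]) hs.1
  set lam : ℝ := Real.sqrt ((X + t) / s) with hlam
  have hl : 0 < lam := Real.sqrt_pos.2 hpos
  have hl2 : lam ^ 2 = (X + t) / s := Real.sq_sqrt hpos.le
  have hiX : Integrable fun w => θ w * u w s :=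
    (hθ2.continuous.mul (h.continuous_factor_slice (hT s hs))).integrable_of_hasCompactSupport
      hθc.mul_right
  have hiB : Integrable (B.indicator fun _ => lam) :=
    (integrable_indicator_iff hBm).2 (integrableOn_const hBf)
  have hiR : Integrable fun w => c * (Real.exp C₀ / (s * lam) * (θ w * u w s) +
      B.indicator (fun _ => lam) w) := ((hiX.const_mul _).add hiB).const_mul c
  have hiL : Integrable fun w => lap θ w * (Real.log (u w s / s) + C₀) :=
    ((continuous_lap hθ2).mul (h.continuous_log_div_slice (hT s hs) C₀)
      ).integrable_of_hasCompactSupport (hasCompactSupport_lap hθ2 hθc).mul_right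
  calc ∫ w, lap θ w * (Real.log (u w s / s) + C₀)
      ≤ ∫ w, c * (Real.exp C₀ / (s * lam) * (θ w * u w s) + B.indicator (fun _ => lam) w) := by
        refine integral_mono hiL hiR fun w => ?_
        have hw := hlap w
        by_cases hwB : w ∈ B
        · have hlg := hlog s (hsub hs) w hwB
          simp only [indicator_of_mem hwB]
          set p := cutoff b (‖w - z₀‖ ^ 2)
          have hus := div_pos (h.pos w s (hT s hs)) hs.1
          have hy : 0 < Real.exp C₀ * (u w s / s) := mul_pos (Real.exp_pos _) hus
          have h1 := Real.log_le_two_mul_sqrt hy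
          rw [Real.log_mul (Real.exp_pos _).ne' hus.ne', Real.log_exp] at h1
          set r := Real.sqrt (Real.exp C₀ * (u w s / s)) with hr
          have hr2 : r ^ 2 = Real.exp C₀ * (u w s / s) := Real.sq_sqrt hy.le
          have h2 : p ^ 2 * (2 * r) ≤ p ^ 4 * r ^ 2 / lam + lam := by
            rw [div_add' _ _ _ hl.ne', le_div_iff₀ hl]
            nlinarith [sq_nonneg (p ^ 2 * r - lam)]
          have h3 : Real.exp C₀ / (s * lam) * (θ w * u w s) = p ^ 4 * r ^ 2 / lam := by
            rw [hr2]
            have := hs.1.ne'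
            rw [show θ w = p ^ 4 from rfl]
            field_simp
          rw [h3]
          calc lap θ w * (Real.log (u w s / s) + C₀)
              ≤ c * p ^ 2 * (Real.log (u w s / s) + C₀) :=
                mul_le_mul_of_nonneg_right ((le_abs_self _).trans hw) hlg
            _ ≤ c * p ^ 2 * (2 * r) := mul_le_mul_of_nonneg_left (by linarith) (by positivity)
            _ = c * (p ^ 2 * (2 * r)) := by ring
            _ ≤ _ := mul_le_mul_of_nonneg_left h2 hc
        · have hp : cutoff b (‖w - z₀‖ ^ 2) = 0 := cutoff_eq_zero hb (not_le.1 hwB).le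
          have h0 : lap θ w = 0 := by
            rw [hp] at hw
            exact abs_nonpos_iff.1 (hw.trans (by simp))
          have hθ0 : θ w = 0 := by simp [hθ, hp]
          simp [h0, hθ0, indicator_of_notMem hwB]
    _ = c * (Real.exp C₀ / (s * lam) * X + lam * V) := by
        rw [integral_const_mul, integral_add (hiX.const_mul _) hiB, integral_const_mul,
          integral_indicator_const _ hBm, smul_eq_mul, mul_comm lam]
    _ ≤ c * (Real.exp C₀ * lam + lam * V) := by
        refine mul_le_mul_of_nonneg_left (add_le_add ?_ le_rfl) hc
        rw [div_mul_eq_mul_div, mul_div_assoc]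
        refine mul_le_mul_of_nonneg_left ?_ (Real.exp_pos _).le
        have h4 : lam * (s * lam) = X + t := by
          rw [show lam * (s * lam) = lam ^ 2 * s by ring, hl2, div_mul_cancel₀ _ hs.1.ne']
        rw [div_le_iff₀ (mul_pos hs.1 hl), h4]
        linarith [ht.1]
    _ = c * (Real.exp C₀ + V) * lam := by ring

end IsFlow

/-- A truncated, regularised logarithmic potential with pole at the origin, as a function of the
squared distance to the origin. -/
noncomputable def cutoffLog (b e x : ℝ) : ℝ := -(cutoff b x * Real.log (x + e))

lemma cutoffLog_eq_zero {b e x : ℝ} (hb : 0 < b) (hx : 2 * b ≤ x) : cutoffLog b e x = 0 := by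
  simp [cutoffLog, cutoff_eq_zero hb hx]

lemma cutoffLog_nonneg {b e x : ℝ} (hb : 0 < b) (he : 0 < e) (hx : 0 ≤ x)
    (hbe : 2 * b + e ≤ 1) : 0 ≤ cutoffLog b e x := by
  rcases le_total (2 * b) x with h | h
  · exact (cutoffLog_eq_zero hb h).ge
  · rw [cutoffLog, Left.nonneg_neg_iff]
    exact mul_nonpos_of_nonneg_of_nonpos (cutoff_nonneg _ _)
      (Real.log_nonpos (by linarith) (by linarith))

lemma contDiff_cutoffLog {b e : ℝ} (he : 0 < e) (z₀ : ℂ) :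
    ContDiff ℝ 2 fun w : ℂ => cutoffLog b e (‖w - z₀‖ ^ 2) :=
  (((contDiff_cutoff b two_le_smooth).comp (contDiff_sq_dist z₀)).mul
    (((contDiff_sq_dist z₀).add contDiff_const).log fun w => by positivity)).neg

/-- The Laplacian of the truncated logarithmic potential is an approximate (negative) Dirac mass
up to a bounded error. -/
lemma exists_lap_cutoffLog_bound {b : ℝ} (hb : 0 < b) (z₀ : ℂ) : ∃ c : ℝ, 0 ≤ c ∧
    ∀ e, 0 < e → 2 * b + e ≤ 1 → ∀ w : ℂ,
      |lap (fun w => cutoffLog b e (‖w - z₀‖ ^ 2)) w +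
        cutoff b (‖w - z₀‖ ^ 2) * (4 * e / (‖w - z₀‖ ^ 2 + e) ^ 2)| ≤ c ∧
      (2 * b < ‖w - z₀‖ ^ 2 → lap (fun w => cutoffLog b e (‖w - z₀‖ ^ 2)) w = 0) := by
  obtain ⟨c, hc, hcb⟩ := exists_deriv_cutoff_bound b
  refine ⟨4 * c * |Real.log b| + 8 * c + 4 * (2 * b) * c * |Real.log b|, by positivity,
    fun e he hbe w => ?_⟩
  have hlog (x : ℝ) (hx : 0 ≤ x) : HasDerivAt (fun x => Real.log (x + e)) (1 / (x + e)) x := by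
    simpa using ((hasDerivAt_id x).add_const e).log (by simp; linarith)
  have hinv (x : ℝ) (hx : 0 ≤ x) : HasDerivAt (fun x => 1 / (x + e)) (-1 / (x + e) ^ 2) x := by
    have := ((hasDerivAt_id x).add_const e).inv (by simp; linarith)
    simpa [Pi.inv_def] using this
  rw [lap_radial (f := cutoffLog b e)
    (f₁ := fun x => -(deriv (cutoff b) x * Real.log (x + e) + cutoff b x * (1 / (x + e))))
    (f₂ := fun x => -(deriv (deriv (cutoff b)) x * Real.log (x + e) +
      deriv (cutoff b) x * (1 / (x + e)) + (deriv (cutoff b) x * (1 / (x + e)) +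
        cutoff b x * (-1 / (x + e) ^ 2)))) ?_ ?_ z₀ w (contDiff_cutoffLog he z₀)]
  · set x := ‖w - z₀‖ ^ 2
    have hx0 : 0 ≤ x := sq_nonneg _
    have hxe : 0 < x + e := by linarith
    have hz1 := deriv_cutoff_eq_zero (x := x) hb
    have hz2 := deriv_deriv_cutoff_eq_zero (x := x) hb
    constructor
    · set p := cutoff b x
      have e1 : 4 * -(deriv (cutoff b) x * Real.log (x + e) + p * (1 / (x + e))) +
          4 * x * -(deriv (deriv (cutoff b)) x * Real.log (x + e) +
            deriv (cutoff b) x * (1 / (x + e)) + (deriv (cutoff b) x * (1 / (x + e)) +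
              p * (-1 / (x + e) ^ 2))) + p * (4 * e / (x + e) ^ 2) =
          -(4 * deriv (cutoff b) x * Real.log (x + e)) -
            8 * deriv (cutoff b) x * (x / (x + e)) -
            4 * x * deriv (deriv (cutoff b)) x * Real.log (x + e) := by
        field_simp
        ring
      rw [e1]
      by_cases hx : x < b ∨ 2 * b < x
      · rw [hz1 hx, hz2 hx]
        simp
        positivity
      · rw [not_or, not_lt, not_lt] at hx
        obtain ⟨h1, h2⟩ := hcb x ⟨hx0, hx.2⟩
        have hL : |Real.log (x + e)| ≤ |Real.log b| := by
          have l1 := Real.log_le_log hb (by linarith : b ≤ x + e)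
          have l2 := Real.log_nonpos hxe.le (by linarith : x + e ≤ 1)
          rw [abs_of_nonpos l2, abs_of_nonpos (l1.trans l2)]
          linarith
        have hR : |x / (x + e)| ≤ 1 := by
          rw [abs_of_nonneg (by positivity), div_le_one hxe]; linarith
        have a1 : |-(4 * deriv (cutoff b) x * Real.log (x + e))| ≤ 4 * c * |Real.log b| := by
          rw [abs_neg, abs_mul, abs_mul, abs_of_pos (by norm_num : (0:ℝ) < 4)]
          gcongr
        have a2 : |8 * deriv (cutoff b) x * (x / (x + e))| ≤ 8 * c := by
          rw [abs_mul, abs_mul, abs_of_pos (by norm_num : (0:ℝ) < 8)]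
          have := mul_le_mul (mul_le_mul_of_nonneg_left h1 (by norm_num : (0:ℝ) ≤ 8)) hR
            (abs_nonneg _) (by positivity)
          linarith
        have a3 : |4 * x * deriv (deriv (cutoff b)) x * Real.log (x + e)| ≤
            4 * (2 * b) * c * |Real.log b| := by
          rw [abs_mul, abs_mul, abs_mul, abs_of_pos (by norm_num : (0:ℝ) < 4), abs_of_nonneg hx0]
          gcongr
          exact hx.2
        exact (abs_sub _ _).trans (add_le_add ((abs_sub _ _).trans (add_le_add a1 a2)) a3)
    · intro hx
      simp [hz1 (.inr hx), hz2 (.inr hx), cutoff_eq_zero hb hx.le]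
  · intro x hx
    exact ((hasDerivAt_cutoff b x).mul (hlog x hx)).neg
  · intro x hx
    exact (((hasDerivAt_deriv_cutoff b x).mul (hlog x hx)).add
      ((hasDerivAt_cutoff b x).mul (hinv x hx))).neg

namespace IsFlow

variable {T : ℝ} {u : ℂ → ℝ → ℝ}

/-- Where the initial measure vanishes, `u / t` stays bounded at the centre. -/
lemma exists_log_div_bound (h : IsFlow T u)
    {z₀ : ℂ} {b : ℝ} (hb : 0 < b) (hb1 : b ≤ 1 / 2) {t₁ : ℝ} (ht₁ : t₁ < T)
    {C₀ A : ℝ}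
    (hlog : ∀ τ ∈ Ioc 0 t₁, ∀ w, ‖w - z₀‖ ^ 2 ≤ 2 * b → 0 ≤ Real.log (u w τ / τ) + C₀)
    (hX : ∀ N : ℂ → ℝ, Continuous N → (∀ w, 2 * b ≤ ‖w - z₀‖ ^ 2 → N w = 0) →
      Tendsto (fun t => ∫ w, N w * u w t) (nhdsWithin 0 (Ioi 0)) (nhds 0))
    (hA : ∀ t ∈ Ioc 0 t₁, ∫ w, cutoff b (‖w - z₀‖ ^ 2) ^ 4 * u w t ≤ A * t) :
    ∃ K, ∀ t ∈ Ioc 0 t₁, Real.log (u z₀ t / t) + C₀ ≤ K := by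
  have hb2 : 0 < b / 2 := half_pos hb
  obtain ⟨c, hc, hlap⟩ := exists_lap_cutoffLog_bound hb2 z₀
  set K₁ : ℝ := c * Real.exp C₀ * A with hK₁
  refine ⟨max (K₁ / Real.pi) 0, fun t ht => ?_⟩
  by_contra! hm
  obtain ⟨Λ, hΛ1, hΛ2⟩ := exists_between hm
  have hΛ : 0 < Λ := (le_max_right _ _).trans_lt hΛ1
  have hKΛ : K₁ - Real.pi * Λ < 0 := by
    have := (le_max_left _ _).trans_lt hΛ1
    rw [div_lt_iff₀ Real.pi_pos] at this
    linarith
  have htT : t ∈ Ioo 0 T := ⟨ht.1, ht.2.trans_lt ht₁⟩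
  obtain ⟨δ, hδ, hball⟩ := Metric.mem_nhds_iff.1
    ((h.continuous_log_div_slice htT C₀).continuousAt.eventually (lt_mem_nhds hΛ2))
  obtain ⟨ε, hε, hεδ⟩ := exists_between (lt_min hδ hb2)
  have hεδ' : ε ≤ δ := hεδ.le.trans (min_le_left _ _)
  have hεb : ε ≤ b / 2 := hεδ.le.trans (min_le_right _ _)
  have he : 0 < ε ^ 2 := by positivity
  have heb : ε ^ 2 ≤ b / 2 := by nlinarith
  have hbe : 2 * (b / 2) + ε ^ 2 ≤ 1 := by linarith
  set N : ℂ → ℝ := fun w => cutoffLog (b / 2) (ε ^ 2) (‖w - z₀‖ ^ 2) with hN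
  have hN2 : ContDiff ℝ 2 N := contDiff_cutoffLog he z₀
  have hNc : HasCompactSupport N :=
    hasCompactSupport_of_eq_zero (b := b / 2) (z₀ := z₀) fun w hw => cutoffLog_eq_zero hb2 hw
  have hX0 := hX N hN2.continuous fun w hw => cutoffLog_eq_zero hb2 (by linarith)
  have hT (s : ℝ) (hs : s ∈ Ioc 0 t) : s ∈ Ioo 0 T := ⟨hs.1, hs.2.trans_lt htT.2⟩
  set θ : ℂ → ℝ := fun w => cutoff b (‖w - z₀‖ ^ 2) ^ 4 with hθ
  have hθ2 : ContDiff ℝ 2 θ :=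
    ((contDiff_cutoff b two_le_smooth).comp (contDiff_sq_dist z₀)).pow 4
  have hθc : HasCompactSupport θ := hasCompactSupport_of_eq_zero (b := b) (z₀ := z₀) fun w hw => by
    simp [hθ, cutoff_eq_zero hb hw]
  have hder (s : ℝ) (hs : s ∈ Ioc 0 t) :
      ∫ w, lap N w * (Real.log (u w s / s) + C₀) ≤ K₁ - Real.pi * Λ := by
    have hiX : Integrable fun w => θ w * u w s :=
      (hθ2.continuous.mul (h.continuous_factor_slice (hT s hs))).integrable_of_hasCompactSupport
        hθc.mul_right
    have hiB : Integrable ((ball z₀ ε).indicator fun _ => Λ / ε ^ 2) :=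
      (integrable_indicator_iff measurableSet_ball).2 (integrableOn_const measure_ball_lt_top.ne)
    have hiL : Integrable fun w => lap N w * (Real.log (u w s / s) + C₀) :=
      ((continuous_lap hN2).mul (h.continuous_log_div_slice (hT s hs) C₀)
        ).integrable_of_hasCompactSupport (hasCompactSupport_lap hN2 hNc).mul_right
    calc ∫ w, lap N w * (Real.log (u w s / s) + C₀)
        ≤ ∫ w, (c * Real.exp C₀ / s * (θ w * u w s) -
            (ball z₀ ε).indicator (fun _ => Λ / ε ^ 2) w) := by
          refine integral_mono hiL ((hiX.const_mul _).sub hiB) fun w => ?_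
          obtain ⟨hw1, hw2⟩ := hlap (ε ^ 2) he hbe w
          have hu := h.pos w s (hT s hs)
          have hus := div_pos hu hs.1
          change lap N w * (Real.log (u w s / s) + C₀) ≤ c * Real.exp C₀ / s * (θ w * u w s) -
            (ball z₀ ε).indicator (fun _ => Λ / ε ^ 2) w
          change |lap N w + _| ≤ c at hw1
          change _ → lap N w = 0 at hw2
          have hmem : w ∈ ball z₀ ε ↔ ‖w - z₀‖ < ε := by rw [mem_ball, dist_eq_norm]
          rcases lt_or_ge (2 * (b / 2)) (‖w - z₀‖ ^ 2) with hq | hq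
          · have hnot : w ∉ ball z₀ ε := fun hw => by
              have := pow_lt_pow_left₀ (hmem.1 hw) (norm_nonneg _) two_ne_zero
              linarith
            rw [hw2 hq, indicator_of_notMem hnot, zero_mul, sub_zero]
            have : 0 ≤ θ w := pow_nonneg (cutoff_nonneg _ _) 4
            have := hs.1
            positivity
          · have hθ1 : θ w = 1 := by
              simp [hθ, cutoff_eq_one hb (by linarith : ‖w - z₀‖ ^ 2 ≤ b)]
            have hl0 := hlog s ⟨hs.1, hs.2.trans ht.2⟩ w (by linarith)
            have hl1 : Real.log (u w s / s) + C₀ ≤ Real.exp C₀ * (u w s / s) := by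
              have := Real.log_le_sub_one_of_pos (mul_pos (Real.exp_pos C₀) hus)
              rw [Real.log_mul (Real.exp_pos _).ne' hus.ne', Real.log_exp] at this
              linarith
            have hanti : Real.log (u w t / t) + C₀ ≤ Real.log (u w s / s) + C₀ :=
              add_le_add (Real.log_le_log (div_pos (h.pos w t htT) ht.1)
                (h.antitoneOn_div_time w (hT s hs) htT hs.2)) le_rfl
            set l := Real.log (u w s / s) + C₀
            set D := cutoff (b / 2) (‖w - z₀‖ ^ 2) * (4 * ε ^ 2 / (‖w - z₀‖ ^ 2 + ε ^ 2) ^ 2)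
              with hD
            have hD0 : 0 ≤ D := mul_nonneg (cutoff_nonneg _ _) (by positivity)
            have hind : (ball z₀ ε).indicator (fun _ => Λ / ε ^ 2) w ≤ D * l := by
              by_cases hw : w ∈ ball z₀ ε
              · rw [indicator_of_mem hw]
                have hqe : ‖w - z₀‖ ^ 2 ≤ ε ^ 2 :=
                  pow_le_pow_left₀ (norm_nonneg _) (hmem.1 hw).le 2
                have hlΛ : Λ ≤ l := (le_of_lt (hball (ball_subset_ball hεδ' hw))).trans hanti
                have hD1 : 1 / ε ^ 2 ≤ D := by
                  rw [hD, cutoff_eq_one hb2 (by linarith), one_mul,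
                    div_le_div_iff₀ he (by positivity)]
                  have := pow_le_pow_left₀ (by positivity)
                    (by linarith : ‖w - z₀‖ ^ 2 + ε ^ 2 ≤ 2 * ε ^ 2) 2
                  linarith
                calc Λ / ε ^ 2 = 1 / ε ^ 2 * Λ := by ring
                  _ ≤ D * l := mul_le_mul hD1 hlΛ hΛ.le hD0
              · rw [indicator_of_notMem hw]
                exact mul_nonneg hD0 hl0
            have h1 : (lap N w + D) * l ≤ c * l :=
              mul_le_mul_of_nonneg_right ((le_abs_self _).trans hw1) hl0
            have h2 : c * l ≤ c * (Real.exp C₀ * (u w s / s)) := mul_le_mul_of_nonneg_left hl1 hc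
            have h3 : c * Real.exp C₀ / s * (θ w * u w s) = c * (Real.exp C₀ * (u w s / s)) := by
              rw [hθ1]; ring
            rw [h3]
            linarith
      _ = c * Real.exp C₀ / s * (∫ w, θ w * u w s) - Real.pi * Λ := by
          rw [integral_sub (hiX.const_mul _) hiB, integral_const_mul,
            integral_indicator_const _ measurableSet_ball, measureReal_def, Complex.volume_ball]
          simp
          rw [ENNReal.toReal_ofReal hε.le]
          field_simp
      _ ≤ c * Real.exp C₀ / s * (A * s) - Real.pi * Λ := by
          have := hs.1
          have := hA s ⟨hs.1, hs.2.trans ht.2⟩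
          gcongr
      _ = K₁ - Real.pi * Λ := by
          have := hs.1.ne'
          rw [hK₁]
          field_simp
  have hlim : Tendsto (fun s => (∫ w, N w * u w s) - (K₁ - Real.pi * Λ) * s)
      (nhdsWithin 0 (Ioi 0)) (nhds 0) := by
    have : Tendsto (fun s : ℝ => (K₁ - Real.pi * Λ) * s) (nhdsWithin 0 (Ioi 0)) (nhds 0) :=
      tendsto_nhdsWithin_of_tendsto_nhds
        (by simpa using (continuous_const_mul (K₁ - Real.pi * Λ)).tendsto 0)
    simpa using hX0.sub this
  have key := le_of_deriv_nonpos_of_tendsto ht.1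
    (fun s hs => (h.hasDerivAt_integral_mul hN2 hNc (hT s hs) C₀).sub
      ((hasDerivAt_id s).const_mul (K₁ - Real.pi * Λ)))
    (fun s hs => by linarith [hder s hs]) hlim
  have hpos : 0 ≤ ∫ w, N w * u w t := integral_nonneg fun w =>
    mul_nonneg (cutoffLog_nonneg hb2 he (sq_nonneg _) hbe) (h.pos w t htT).le
  have := mul_neg_of_neg_of_pos hKΛ ht.1
  simp only [Pi.sub_apply, id] at key
  linarith

end IsFlow

/-- Finiteness of the initial time blow-up away from the support of the initial
measure. -/
theorem initial_blowup_finite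
    (T : ℝ) (hT : 0 < T) (u : ℂ → ℝ → ℝ)
    (hpos : ∀ (z : ℂ), ∀ t ∈ Ioo (0:ℝ) T, 0 < u z t)
    (hsmooth : ContDiffOn ℝ (⊤ : ℕ∞) (fun p : ℂ × ℝ => u p.1 p.2)
      ((univ : Set ℂ) ×ˢ Ioo (0:ℝ) T))
    (hlfde : ∀ (z : ℂ), ∀ t ∈ Ioo (0:ℝ) T,
      deriv (u z) t = lap (fun w => Real.log (u w t)) z)
    (hcomplete : ∀ t ∈ Ioo (0:ℝ) T, ConfComplete (fun z => u z t) univ)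
    (μ : Measure ℂ) (hμ0 : μ ≠ 0) (hna : ∀ z : ℂ, μ {z} = 0)
    (hrad : ∀ K : Set ℂ, IsCompact K → μ K < ⊤)
    (hweak : ∀ f : ℂ → ℝ, Continuous f → HasCompactSupport f →
      Tendsto (fun t => ∫ z, f z * u z t) (nhdsWithin 0 (Ioi 0)) (nhds (∫ z, f z ∂μ))) :
    ∀ z ∉ measSupport μ,
      ∃ L : ℝ, Tendsto (fun t => u z t / (2 * t)) (nhdsWithin 0 (Ioi 0)) (nhds L) := by
  intro z hz
  have h : IsFlow T u := ⟨hpos, hsmooth, hlfde, hcomplete⟩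
  obtain ⟨U, hU, hzU, hμU⟩ : ∃ U : Set ℂ, IsOpen U ∧ z ∈ U ∧ μ U = 0 := by
    by_contra! hcon
    exact hz hcon
  obtain ⟨R, hR, hRU⟩ := Metric.isOpen_iff.1 hU z hzU
  obtain ⟨b, hb, hb1, hbR⟩ : ∃ b : ℝ, 0 < b ∧ b ≤ 1 / 2 ∧ 2 * b ≤ R ^ 2 :=
    ⟨min (1 / 2) (R ^ 2 / 2), by positivity, min_le_left _ _, by
      linarith [min_le_right (1 / 2) (R ^ 2 / 2)]⟩
  have hX (N : ℂ → ℝ) (hN : Continuous N) (hN0 : ∀ w, 2 * b ≤ ‖w - z‖ ^ 2 → N w = 0) :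
      Tendsto (fun t => ∫ w, N w * u w t) (nhdsWithin 0 (Ioi 0)) (nhds 0) := by
    have hint : ∫ w, N w ∂μ = 0 := by
      refine integral_eq_zero_of_ae ?_
      refine measure_mono_null (fun w hw => ?_) hμU
      refine hRU ?_
      by_contra hwR
      rw [mem_ball, dist_eq_norm, not_lt] at hwR
      exact hw (hN0 w (hbR.trans (pow_le_pow_left₀ hR.le hwR 2)))
    exact hint ▸ hweak N hN (hasCompactSupport_of_eq_zero hN0)
  have ht₁ : T / 2 ∈ Ioo 0 T := ⟨by linarith, by linarith⟩
  obtain ⟨C₀, hC₀⟩ := (isCompact_closedBall z (Real.sqrt (2 * b))).exists_bound_of_continuousOn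
    (h.continuous_log_div_slice ht₁ 0).continuousOn
  have hlog : ∀ τ ∈ Ioc 0 (T / 2), ∀ w, ‖w - z‖ ^ 2 ≤ 2 * b →
      0 ≤ Real.log (u w τ / τ) + C₀ := fun τ hτ w hw => by
    have hτT : τ ∈ Ioo 0 T := ⟨hτ.1, hτ.2.trans_lt ht₁.2⟩
    have h1 := hC₀ w (by
      rwa [mem_closedBall, dist_eq_norm, Real.le_sqrt (norm_nonneg _) (by positivity)])
    rw [add_zero, Real.norm_eq_abs] at h1
    have h2 := Real.log_le_log (div_pos (hpos w _ ht₁) ht₁.1)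
      (h.antitoneOn_div_time w hτT ht₁ hτ.2)
    linarith [neg_le_of_abs_le h1]
  obtain ⟨A, hA⟩ := h.exists_mass_bound hb ht₁.2 hlog
    (hX _ (((contDiff_cutoff b two_le_smooth).comp (contDiff_sq_dist z)).pow 4).continuous
      fun w hw => by simp [cutoff_eq_zero hb hw])
  obtain ⟨K, hK⟩ := h.exists_log_div_bound hb hb1 ht₁.2 hlog hX hA
  refine ⟨_, AntitoneOn.tendsto_nhdsWithin_Ioo_right (nonempty_Ioo.2 ht₁.1) (y := T / 2) ?_ ?_⟩
  · intro s hs t ht hst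
    have := h.antitoneOn_div_time z ⟨hs.1, hs.2.trans ht₁.2⟩ ⟨ht.1, ht.2.trans ht₁.2⟩ hst
    simp only [mul_comm (2:ℝ), ← div_div] at this ⊢
    linarith
  · refine ⟨Real.exp (K - C₀) / 2, ?_⟩
    rintro _ ⟨t, ht, rfl⟩
    have h1 := hK t ⟨ht.1, ht.2.le⟩
    have h2 := (Real.log_le_iff_le_exp (div_pos (hpos z t ⟨ht.1, ht.2.trans ht₁.2⟩) ht.1)).1
      (by linarith : Real.log (u z t / t) ≤ K - C₀)
    simp only [mul_comm (2:ℝ), ← div_div]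
    linarith
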